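/- There exists a constant c₀ > 0 such that for every natural number n there is a totally real number field k with [k : ℚ] ≥ n and |Δ_k| ≤ c₀^{[k : ℚ]} (equivalently, root discriminant rd_k ≤ c₀). -/

import Mathlib

section
namespace GS
open Submodule Module
section growth
variable {k A : Type*} [Field k] [Ring A] [Algebra k A] [FiniteDimensional k A]
theorem finrank_pi (d : ℕ) (J : Submodule k A) :
    finrank k ((Fin d → A) ⧸ Submodule.pi Set.univ (fun _ : Fin d => J))
      = d * finrank k (A ⧸ J) := by
  rw [(Submodule.quotientPi (fun _ : Fin d => J)).finrank_eq, Module.finrank_pi_fintype]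
  simp
theorem growth_step (d r : ℕ) (I : Submodule k A) (hI1 : (⊤ : Submodule k A) * I ≤ I)
    (hI2 : I * (⊤ : Submodule k A) ≤ I) (hdim : finrank k (A ⧸ I) = 1)
    (t : Fin d → A) (ht : ∀ i, t i ∈ I) (φ : (Fin d → A) →ₗ[k] A)
    (hφ : ∀ v, φ v = ∑ i, v i * t i) (hr : I ≤ LinearMap.range φ)
    (hK : LinearMap.ker φ ≤ Submodule.pi Set.univ (fun _ => I))
    (ρ : Fin r → (Fin d → A)) (hρ : ∀ j, ρ j ∈ LinearMap.ker φ)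
    (hgen : LinearMap.ker φ ≤ Submodule.span k (Set.range ρ) ⊔ I • LinearMap.ker φ) (m : ℕ) :
    d * finrank k (A ⧸ I ^ (m + 1)) + 1 ≤
      finrank k (A ⧸ I ^ (m + 2)) + r * finrank k (A ⧸ (I ^ m * ⊤)) := by
  classical
  set K := LinearMap.ker φ with hKdef
  set P : Submodule k (Fin d → A) := Submodule.pi Set.univ (fun _ => I ^ (m + 1)) with hP
  let σ : (Fin r → A) →ₗ[k] (Fin d → A) :=
    { toFun := fun a => ∑ j, a j • ρ j
      map_add' := by intro a b; simp [add_smul, Finset.sum_add_distrib]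
      map_smul' := by intro c a; simp [Finset.smul_sum] }
  have hσ : ∀ a, σ a = ∑ j, a j • ρ j := fun a => rfl
  have hItop : ∀ n, I ^ (n+1) * (⊤ : Submodule k A) ≤ I ^ (n+1) := by
    intro n
    rw [pow_succ, mul_assoc]
    exact Submodule.mul_le.2 fun a ha b hb => Submodule.mul_mem_mul ha (hI2 hb)
  have hKn : ∀ n, K ≤ LinearMap.range σ ⊔ I ^ n • K := by
    intro n
    induction n with
    | zero => rw [pow_zero, Submodule.one_smul]; exact le_sup_right
    | succ n ih =>
      have h1 : I ^ n • K ≤ LinearMap.range σ ⊔ I ^ (n+1) • K := by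
        calc I ^ n • K ≤ I ^ n • (Submodule.span k (Set.range ρ) ⊔ I • K) :=
              Submodule.smul_mono le_rfl hgen
          _ = I ^ n • (Submodule.span k (Set.range ρ)) ⊔ I ^ n • (I • K) := Submodule.smul_sup _ _ _
          _ ≤ _ := by
            refine sup_le_sup ?_ ?_
            · rw [Submodule.smul_le]
              intro a _ v hv
              induction hv using Submodule.span_induction with
              | mem x hx =>
                obtain ⟨j, rfl⟩ := hx
                refine ⟨Pi.single j a, ?_⟩
                rw [hσ, Finset.sum_eq_single j]
                · simp
                · intro b _ hb; simp [hb]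
                · simp
              | zero => simp
              | add x y _ _ hx hy => rw [smul_add]; exact add_mem hx hy
              | smul c x _ hx => rw [smul_comm]; exact Submodule.smul_mem _ _ hx
            · rw [pow_succ, ← Submodule.smul_assoc, smul_eq_mul]
      exact ih.trans (sup_le le_sup_left h1)
  have hKP : K ≤ LinearMap.range σ ⊔ P := by
    refine (hKn m).trans (sup_le_sup le_rfl ?_)
    rw [Submodule.smul_le]
    intro a ha v hv i _
    have := hK hv i (Set.mem_univ i)
    rw [pow_succ]
    exact Submodule.mul_mem_mul ha this
  have hker : Submodule.pi Set.univ (fun _ : Fin r => I ^ m * ⊤) ≤ LinearMap.ker (P.mkQ ∘ₗ σ) := by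
    intro a ha
    rw [LinearMap.mem_ker, LinearMap.comp_apply, Submodule.mkQ_apply, Submodule.Quotient.mk_eq_zero, hσ]
    refine Submodule.sum_mem _ fun j _ => ?_
    intro i _
    rw [pow_succ]
    have h1 : (I ^ m * ⊤) * I ≤ I ^ m * I := by
      rw [mul_assoc]
      exact Submodule.mul_le.2 fun a ha b hb => Submodule.mul_mem_mul ha (hI1 hb)
    exact h1 (Submodule.mul_mem_mul (ha j (Set.mem_univ j)) (hK (hρ j) i (Set.mem_univ i)))
  have e1 : finrank k (LinearMap.range (P.mkQ ∘ₗ σ)) ≤ r * finrank k (A ⧸ (I ^ m * ⊤)) := by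
    have h1 := LinearMap.finrank_range_add_finrank_ker (P.mkQ ∘ₗ σ)
    have h2 := Submodule.finrank_mono hker
    have h3 := Submodule.finrank_quotient_add_finrank (Submodule.pi Set.univ (fun _ : Fin r => I ^ m * ⊤))
    rw [finrank_pi] at h3
    omega
  set T := K ⊔ P with hT
  have e2 : finrank k T ≤ finrank k P + r * finrank k (A ⧸ (I ^ m * ⊤)) := by
    have h1 : T.map P.mkQ ≤ LinearMap.range (P.mkQ ∘ₗ σ) := by
      rw [Submodule.map_le_iff_le_comap]
      refine sup_le (hKP.trans (sup_le ?_ ?_)) ?_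
      · rintro _ ⟨a, rfl⟩; exact ⟨a, rfl⟩
      · intro v hv
        simp only [Submodule.mem_comap]
        have : P.mkQ v = 0 := by simpa using hv
        rw [this]; exact zero_mem _
      · intro v hv
        simp only [Submodule.mem_comap]
        have : P.mkQ v = 0 := by simpa using hv
        rw [this]; exact zero_mem _
    have h2 := Submodule.finrank_mono h1
    have h3 := LinearMap.finrank_range_add_finrank_ker (P.mkQ.domRestrict T)
    have h4 : LinearMap.range (P.mkQ.domRestrict T) = T.map P.mkQ := by
      rw [LinearMap.range_domRestrict]
    have h5 : finrank k (LinearMap.ker (P.mkQ.domRestrict T)) ≤ finrank k P := by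
      rw [← LinearMap.finrank_range_of_inj (f := (T.subtype ∘ₗ (LinearMap.ker (P.mkQ.domRestrict T)).subtype))]
      · apply Submodule.finrank_mono
        rintro _ ⟨⟨⟨v, hv⟩, hv'⟩, rfl⟩
        simpa using hv'
      · exact (Subtype.val_injective).comp Subtype.val_injective
    rw [h4] at h3
    omega
  have e3 : finrank k K + finrank k ↥(I ^ (m+2)) ≤ finrank k T := by
    have h3 := LinearMap.finrank_range_add_finrank_ker (φ.domRestrict T)
    have h5 : finrank k K ≤ finrank k (LinearMap.ker (φ.domRestrict T)) := by
      let f : K →ₗ[k] T := Submodule.inclusion le_sup_left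
      have hf : LinearMap.range f ≤ LinearMap.ker (φ.domRestrict T) := by
        rintro _ ⟨⟨v, hv⟩, rfl⟩
        exact LinearMap.mem_ker.mp hv
      rw [← LinearMap.finrank_range_of_inj (f := f) (Submodule.inclusion_injective _)]
      exact Submodule.finrank_mono hf
    have h6 : I ^ (m+2) ≤ LinearMap.range (φ.domRestrict T) := by
      rw [LinearMap.range_domRestrict, show m + 2 = (m+1)+1 from rfl, pow_succ, Submodule.mul_le]
      intro a ha b hb
      obtain ⟨v, rfl⟩ := hr hb
      refine ⟨fun i => a * v i, ?_, ?_⟩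
      · refine Submodule.mem_sup_right ?_
        intro i _
        exact hItop m (Submodule.mul_mem_mul ha Submodule.mem_top)
      · rw [hφ, hφ, Finset.mul_sum]; simp [mul_assoc]
    have h7 := Submodule.finrank_mono h6
    omega
  have e4 : finrank k (Fin d → A) = finrank k K + finrank k I := by
    have h3 := LinearMap.finrank_range_add_finrank_ker φ
    have : LinearMap.range φ = I := by
      refine le_antisymm ?_ hr
      rintro _ ⟨v, rfl⟩
      rw [hφ]
      exact Submodule.sum_mem _ fun i _ => hI1 (Submodule.mul_mem_mul Submodule.mem_top (ht i))
    rw [this, ← hKdef] at h3; omega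
  have e5 := Submodule.finrank_quotient_add_finrank P
  rw [hP, finrank_pi, ← hP] at e5
  have e6 := Submodule.finrank_quotient_add_finrank (I ^ (m+2))
  have e7 := Submodule.finrank_quotient_add_finrank I
  omega
theorem growth_contra (d r : ℕ) (hd : 2 ≤ d) (hrd : 4 * r ≤ d ^ 2) (b : ℕ → ℕ) (B : ℕ)
    (hB : ∀ n, b n ≤ B) (h0 : b 0 = 0) (h1 : b 1 = 1)
    (h : ∀ m, d * b (m+1) + 1 ≤ b (m+2) + r * b m) : False := by
  have key : ∀ m, d * b m + 2 * (m + 1) ≤ 2 * b (m+1) := by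
    intro m
    induction m with
    | zero => simp [h0, h1]
    | succ m ih =>
      have h2 := h m
      have h3 : d * (d * b m + 2 * (m+1)) ≤ d * (2 * b (m+1)) := Nat.mul_le_mul_left _ ih
      have h4 : 4 * r * b m ≤ d ^ 2 * b m := Nat.mul_le_mul_right _ hrd
      have h5 : 2 * (m+1) ≤ d * (m+1) := Nat.mul_le_mul_right _ hd
      show d * b (m+1) + 2 * (m + 1 + 1) ≤ 2 * b (m+2)
      nlinarith
  have := key B
  have := hB (B+1)
  nlinarith [Nat.zero_le (d * b B)]
end growth
end GS
end
section
namespace GS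
open Submodule Module
section group
variable {G : Type*} [Group G] {d : ℕ} (x : Fin d → G)
abbrev AA (G : Type*) [Group G] := MonoidAlgebra (ZMod 2) G
noncomputable def aff (i : Fin d) : Equiv.Perm (Fin d → AA G) where
  toFun v := Pi.single i 1 + MonoidAlgebra.of (ZMod 2) G (x i) • v
  invFun v := MonoidAlgebra.of (ZMod 2) G (x i)⁻¹ • (v - Pi.single i 1)
  left_inv v := by
    beta_reduce; rw [add_sub_cancel_left, smul_smul, ← map_mul, inv_mul_cancel, map_one, one_smul]
  right_inv v := by
    beta_reduce; rw [smul_smul, ← map_mul, mul_inv_cancel, map_one, one_smul]; abel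
noncomputable def fox (f : FreeGroup (Fin d)) : Fin d → AA G := FreeGroup.lift (aff x) f 0
theorem lift_aff (f : FreeGroup (Fin d)) (v : Fin d → AA G) :
    FreeGroup.lift (aff x) f v = fox x f + MonoidAlgebra.of (ZMod 2) G (FreeGroup.lift x f) • v := by
  have key : ∃ c : Fin d → AA G, ∀ v, FreeGroup.lift (aff x) f v =
      c + MonoidAlgebra.of (ZMod 2) G (FreeGroup.lift x f) • v := by
    induction f using FreeGroup.induction_on with
    | C1 => exact ⟨0, fun v => by simp [← MonoidAlgebra.one_def]⟩
    | of i => exact ⟨Pi.single i 1, fun v => by rw [FreeGroup.lift_apply_of, FreeGroup.lift_apply_of]; rfl⟩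
    | inv_of i _ =>
      refine ⟨- (MonoidAlgebra.of (ZMod 2) G (x i)⁻¹ • Pi.single i 1), fun v => ?_⟩
      rw [map_inv (FreeGroup.lift (aff x)), map_inv (FreeGroup.lift x), FreeGroup.lift_apply_of, FreeGroup.lift_apply_of]
      show MonoidAlgebra.of (ZMod 2) G (x i)⁻¹ • (v - Pi.single i 1) = _
      rw [smul_sub]; abel
    | mul f g hf hg =>
      obtain ⟨c, hc⟩ := hf
      obtain ⟨c', hc'⟩ := hg
      refine ⟨c + MonoidAlgebra.of (ZMod 2) G (FreeGroup.lift x f) • c', fun v => ?_⟩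
      rw [map_mul, Equiv.Perm.mul_apply, hc', hc, map_mul, map_mul, smul_add, smul_smul, add_assoc]
  obtain ⟨c, hc⟩ := key
  have : fox x f = c := by rw [fox, hc]; simp
  rw [hc, this]
theorem fox_mul (f g : FreeGroup (Fin d)) :
    fox x (f * g) = fox x f + MonoidAlgebra.of (ZMod 2) G (FreeGroup.lift x f) • fox x g := by
  rw [← lift_aff, fox, map_mul, Equiv.Perm.mul_apply]; rfl
theorem fox_one : fox x 1 = 0 := by simp [fox]
theorem fox_of (i : Fin d) : fox x (FreeGroup.of i) = Pi.single i 1 := by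
  rw [fox, FreeGroup.lift_apply_of]; simp [aff]
theorem fox_conj (f r : FreeGroup (Fin d)) (hr : FreeGroup.lift x r = 1) :
    fox x (f * r * f⁻¹) = MonoidAlgebra.of (ZMod 2) G (FreeGroup.lift x f) • fox x r := by
  have h1 := fox_mul x f f⁻¹
  rw [mul_inv_cancel, fox_one] at h1
  rw [fox_mul, fox_mul, map_mul, hr, mul_one, add_right_comm, ← h1, zero_add]
noncomputable def phi : (Fin d → AA G) →ₗ[ZMod 2] AA G where
  toFun v := ∑ i, v i * (MonoidAlgebra.of (ZMod 2) G (x i) - 1)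
  map_add' := by intro a b; simp [add_mul, Finset.sum_add_distrib]
  map_smul' := by intro c a; simp [Finset.smul_sum]
theorem phi_apply (v) : phi x v = ∑ i, v i * (MonoidAlgebra.of (ZMod 2) G (x i) - 1) := rfl
theorem phi_smul (a : AA G) (v) : phi x (a • v) = a * phi x v := by
  simp [phi_apply, Finset.mul_sum, mul_assoc]
theorem phi_fox (f : FreeGroup (Fin d)) :
    phi x (fox x f) = MonoidAlgebra.of (ZMod 2) G (FreeGroup.lift x f) - 1 := by
  induction f using FreeGroup.induction_on with
  | C1 => rw [fox_one, map_zero, map_one, map_one, sub_self]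
  | of i =>
    rw [fox_of, phi_apply, Finset.sum_eq_single i]
    · rw [FreeGroup.lift_apply_of]; simp
    · intro b _ hb; simp [hb]
    · simp
  | inv_of i h =>
    have h1 := fox_mul x (FreeGroup.of i)⁻¹ (FreeGroup.of i)
    rw [inv_mul_cancel, fox_one] at h1
    have h2 : fox x (FreeGroup.of i)⁻¹ =
      - (MonoidAlgebra.of (ZMod 2) G (FreeGroup.lift x (FreeGroup.of i)⁻¹) • fox x (FreeGroup.of i)) :=
      eq_neg_of_add_eq_zero_left h1.symm
    rw [h2, map_neg, phi_smul, h, mul_sub, ← map_mul, ← map_mul, inv_mul_cancel]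
    simp only [map_one]; noncomm_ring
  | mul f g hf hg =>
    rw [fox_mul, map_add, phi_smul, hf, hg, mul_sub, ← map_mul, ← map_mul]
    noncomm_ring
theorem ker_phi_le (hsurj : Function.Surjective (FreeGroup.lift x)) :
    LinearMap.ker (phi x) ≤
      Submodule.span (ZMod 2) (fox x '' {r | FreeGroup.lift x r = 1}) := by
  classical
  set N := Submodule.span (ZMod 2) (fox x '' {r | FreeGroup.lift x r = 1}) with hN
  choose s hs using hsurj
  have hc : ∀ f, N.mkQ (fox x f) = N.mkQ (fox x (s (FreeGroup.lift x f))) := by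
    intro f
    have h1 : f = (f * (s (FreeGroup.lift x f))⁻¹) * s (FreeGroup.lift x f) := by group
    have h2 : FreeGroup.lift x (f * (s (FreeGroup.lift x f))⁻¹) = 1 := by
      rw [map_mul, map_inv, hs, mul_inv_cancel]
    conv_lhs => rw [h1]
    rw [fox_mul, h2, map_one, one_smul, map_add]
    have : N.mkQ (fox x (f * (s (FreeGroup.lift x f))⁻¹)) = 0 := by
      rw [Submodule.mkQ_apply, Submodule.Quotient.mk_eq_zero]
      exact Submodule.subset_span ⟨_, h2, rfl⟩
    rw [this, zero_add]
  let Ψ : AA G →ₗ[ZMod 2] ((Fin d → AA G) ⧸ N) :=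
    (MonoidAlgebra.basis G (ZMod 2)).constr (ZMod 2) fun g => N.mkQ (fox x (s g))
  have hΨ : ∀ f, Ψ (MonoidAlgebra.of (ZMod 2) G (FreeGroup.lift x f)) = N.mkQ (fox x f) := by
    intro f
    rw [hc]
    have := (MonoidAlgebra.basis G (ZMod 2)).constr_basis (ZMod 2) (fun g => N.mkQ (fox x (s g))) (FreeGroup.lift x f)
    exact this
  have key : Ψ ∘ₗ phi x = N.mkQ := by
    apply LinearMap.pi_ext'
    intro i
    apply (MonoidAlgebra.basis G (ZMod 2)).ext
    intro g
    have h1 : (LinearMap.single (ZMod 2) (fun _ : Fin d => AA G) i) ((MonoidAlgebra.basis G (ZMod 2)) g)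
      = MonoidAlgebra.of (ZMod 2) G g • Pi.single i 1 := by
      rw [← Pi.single_smul]; simp [MonoidAlgebra.basis]
    have h2 := fox_mul x (s g) (FreeGroup.of i)
    rw [hs, fox_of] at h2
    have h3 := phi_fox x (FreeGroup.of i)
    rw [fox_of] at h3
    rw [LinearMap.comp_apply, LinearMap.comp_apply, LinearMap.comp_apply, h1, phi_smul, h3, mul_sub, mul_one,
      ← map_mul, map_sub]
    have h4 : g * FreeGroup.lift x (FreeGroup.of i) = FreeGroup.lift x (s g * FreeGroup.of i) := by
      rw [map_mul, hs]
    have h5 := hΨ (s g)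
    rw [hs] at h5
    rw [h4, hΨ, h2, h5, map_add, add_sub_cancel_left]
  intro v hv
  have : N.mkQ v = 0 := by rw [← key, LinearMap.comp_apply, LinearMap.mem_ker.mp hv, map_zero]
  simpa using this
end group
end GS
end
section
namespace GS
open Submodule Module
section group
variable {G : Type*} [Group G] {d : ℕ} (x : Fin d → G)
noncomputable def eps (G : Type*) [Group G] : AA G →ₐ[ZMod 2] ZMod 2 := MonoidAlgebra.lift (ZMod 2) (ZMod 2) G 1
theorem eps_of (g : G) : eps G (MonoidAlgebra.of (ZMod 2) G g) = 1 := by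
  simp [eps]
noncomputable def aug (G : Type*) [Group G] : Submodule (ZMod 2) (AA G) := LinearMap.ker (eps G).toLinearMap
theorem mem_aug (a : AA G) : a ∈ aug G ↔ eps G a = 0 := Iff.rfl
theorem aug_le_range (hsurj : Function.Surjective (FreeGroup.lift x)) :
    aug G ≤ LinearMap.range (phi x) := by
  have key : ∀ a : AA G, a - (eps G a) • 1 ∈ LinearMap.range (phi x) := by
    intro a
    induction a using MonoidAlgebra.induction_on with
    | of g =>
      obtain ⟨f, rfl⟩ := hsurj g
      exact ⟨fox x f, by rw [phi_fox, eps_of, one_smul]⟩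
    | add a b ha hb =>
      have := add_mem ha hb
      rwa [map_add, add_smul, add_sub_add_comm]
    | smul c a ha =>
      have := Submodule.smul_mem _ c ha
      rwa [map_smul, smul_eq_mul, mul_smul, ← smul_sub]
  intro a ha
  have := key a
  rwa [(mem_aug a).1 ha, zero_smul, sub_zero] at this
theorem ker_phi_le_pi (χ : Fin d → G → ZMod 2) (hχ : ∀ j g h, χ j (g * h) = χ j g + χ j h)
    (hχx : ∀ i j, χ j (x i) = if i = j then 1 else 0) :
    LinearMap.ker (phi x) ≤ Submodule.pi Set.univ (fun _ => aug G) := by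
  intro v hv j _
  let δ : AA G →ₗ[ZMod 2] ZMod 2 := (MonoidAlgebra.basis G (ZMod 2)).constr (ZMod 2) (χ j)
  have hδ : ∀ g, δ (MonoidAlgebra.of (ZMod 2) G g) = χ j g := fun g =>
    (MonoidAlgebra.basis G (ZMod 2)).constr_basis (ZMod 2) (χ j) g
  have h1 : ∀ (a : AA G) (i : Fin d), δ (a * (MonoidAlgebra.of (ZMod 2) G (x i) - 1)) = eps G a * χ j (x i) := by
    intro a i
    induction a using MonoidAlgebra.induction_on with
    | of g =>
      rw [mul_sub, mul_one, ← map_mul, map_sub, hδ, hδ, hχ, eps_of]; ring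
    | add a b ha hb => rw [add_mul, map_add, ha, hb, map_add, add_mul]
    | smul c a ha => rw [smul_mul_assoc, map_smul, ha, map_smul, smul_eq_mul, smul_eq_mul, mul_assoc]
  have h2 : δ (phi x v) = eps G (v j) := by
    rw [phi_apply, map_sum, Finset.sum_eq_single j]
    · rw [h1, hχx]; simp
    · intro i _ hi; rw [h1, hχx, if_neg hi, mul_zero]
    · simp
  rw [LinearMap.mem_ker.mp hv, map_zero] at h2
  exact h2.symm
def Theta : Set ((FreeGroup.lift x).ker →* ℤˣ) :=
  {θ | ∀ f r, θ (MulAut.conjNormal f r) = θ r}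
theorem uz_add (a b : ZMod 2) : (-1 : ℤˣ) ^ (a + b) = (-1) ^ a * (-1) ^ b := uzpow_add _ _ _
theorem uz_inj {a b : ZMod 2} (h : (-1 : ℤˣ) ^ a = (-1) ^ b) : a = b := by
  revert a b; decide
theorem golod [Finite G] (hsurj : Function.Surjective (FreeGroup.lift x)) (hd : 2 ≤ d)
    (χ : Fin d → G → ZMod 2) (hχ : ∀ j g h, χ j (g * h) = χ j g + χ j h)
    (hχx : ∀ i j, χ j (x i) = if i = j then 1 else 0)
    (hfin : Finite (Theta x)) (r : ℕ) (hr : Nat.card (Theta x) ≤ 2 ^ r) : d ^ 2 < 4 * r := by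
  classical
  by_contra hcon
  push Not at hcon
  set K := LinearMap.ker (phi x) with hK
  have hfd : FiniteDimensional (ZMod 2) (AA G) :=
    Module.Finite.of_basis (MonoidAlgebra.basis G (ZMod 2))
  set IK : Submodule (ZMod 2) K := (aug G • K).comap K.subtype with hIK
  set r' := finrank (ZMod 2) (K ⧸ IK) with hr'
  have hr'r : r' ≤ r := by
    have hmem : ∀ s : (FreeGroup.lift x).ker, fox x s ∈ K := by
      intro s
      rw [hK, LinearMap.mem_ker, phi_fox, s.2, map_one, sub_self]
    let F : (K ⧸ IK →ₗ[ZMod 2] ZMod 2) → ((FreeGroup.lift x).ker →* ℤˣ) := fun l =>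
      { toFun := fun s => (-1) ^ (l (IK.mkQ ⟨fox x s, hmem s⟩))
        map_one' := by
          have : (⟨fox x ((1 : (FreeGroup.lift x).ker) : FreeGroup (Fin d)), hmem 1⟩ : K) = 0 :=
            Subtype.ext (fox_one x)
          rw [this, map_zero, map_zero, uzpow_zero]
        map_mul' := by
          intro s t
          rw [← uz_add, ← map_add, ← map_add]
          congr 3
          apply Subtype.ext
          show fox x (s * t) = fox x s + fox x t
          rw [fox_mul, s.2, map_one, one_smul] }
    have hFθ : ∀ l, F l ∈ Theta x := by
      intro l f s
      show (-1 : ℤˣ) ^ _ = (-1 : ℤˣ) ^ _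
      congr 2
      rw [← sub_eq_zero, ← map_sub, ← map_sub]
      convert map_zero l
      rw [Submodule.mkQ_apply, Submodule.Quotient.mk_eq_zero]
      show fox x (f * s * f⁻¹) - fox x s ∈ aug G • K
      rw [fox_conj x _ _ s.2]
      have : (MonoidAlgebra.of (ZMod 2) G (FreeGroup.lift x f)) • fox x s - fox x s =
        (MonoidAlgebra.of (ZMod 2) G (FreeGroup.lift x f) - 1) • fox x s := by rw [sub_smul, one_smul]
      rw [this]
      refine Submodule.smul_mem_smul ?_ (hmem s)
      rw [mem_aug, map_sub, eps_of, map_one, sub_self]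
    have hinj : Function.Injective (fun l => (⟨F l, hFθ l⟩ : Theta x)) := by
      intro l l' hll
      have h1 : F l = F l' := congrArg Subtype.val hll
      have h2 : ∀ s : (FreeGroup.lift x).ker, l (IK.mkQ ⟨fox x s, hmem s⟩) = l' (IK.mkQ ⟨fox x s, hmem s⟩) :=
        fun s => uz_inj (DFunLike.congr_fun h1 s)
      have h3 : ∀ v : Fin d → AA G, v ∈ Submodule.span (ZMod 2) (fox x '' {r | FreeGroup.lift x r = 1}) →
          ∀ hv : v ∈ K, l (IK.mkQ ⟨v, hv⟩) = l' (IK.mkQ ⟨v, hv⟩) := by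
        have hsp : Submodule.span (ZMod 2) (fox x '' {r | FreeGroup.lift x r = 1}) ≤ K := by
          rw [Submodule.span_le]
          rintro _ ⟨s, hs, rfl⟩
          exact hmem ⟨s, hs⟩
        intro v hv
        induction hv using Submodule.span_induction with
        | mem v hv =>
          obtain ⟨s, hs, rfl⟩ := hv
          intro _; exact h2 ⟨s, hs⟩
        | zero =>
          intro hv
          have : (⟨0, hv⟩ : K) = 0 := rfl
          rw [this]; simp only [map_zero]
        | add a b ha hb iha ihb =>
          intro hv
          have : (⟨a + b, hv⟩ : K) = ⟨a, hsp ha⟩ + ⟨b, hsp hb⟩ := rfl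
          rw [this]; simp only [map_add]; rw [iha, ihb]
        | smul c a ha iha =>
          intro hv
          have : (⟨c • a, hv⟩ : K) = c • ⟨a, hsp ha⟩ := rfl
          rw [this]; simp only [map_smul]; rw [iha]
      refine LinearMap.ext fun q => ?_
      obtain ⟨⟨v, hv⟩, rfl⟩ := IK.mkQ_surjective q
      exact h3 v (ker_phi_le x hsurj hv) hv
    have h1 := Nat.card_le_card_of_injective _ hinj
    have h2 : Nat.card (K ⧸ IK →ₗ[ZMod 2] ZMod 2) = 2 ^ r' := by
      rw [Module.natCard_eq_pow_finrank (K := ZMod 2)]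
      rw [Nat.card_zmod, hr']
      congr 1
      exact Subspace.dual_finrank_eq
    rw [h2] at h1
    exact (Nat.pow_le_pow_iff_right (by norm_num)).1 (h1.trans hr)
  let b := Module.finBasis (ZMod 2) (K ⧸ IK)
  choose ρ hρ using fun j => IK.mkQ_surjective (b j)
  have hI1 : (⊤ : Submodule (ZMod 2) (AA G)) * aug G ≤ aug G := by
    rw [Submodule.mul_le]
    intro a _ c hc
    rw [mem_aug, map_mul, (mem_aug c).1 hc, mul_zero]
  have hI2 : aug G * (⊤ : Submodule (ZMod 2) (AA G)) ≤ aug G := by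
    rw [Submodule.mul_le]
    intro a ha c _
    rw [mem_aug, map_mul, (mem_aug a).1 ha, zero_mul]
  have hdim : finrank (ZMod 2) (AA G ⧸ aug G) = 1 := by
    have hs : Function.Surjective (eps G).toLinearMap := fun c => ⟨algebraMap _ _ c, (eps G).commutes c⟩
    rw [aug, ((eps G).toLinearMap.quotKerEquivOfSurjective hs).finrank_eq]
    simp
  have hgen : K ≤ Submodule.span (ZMod 2) (Set.range fun j => (ρ j : Fin d → AA G)) ⊔ aug G • K := by
    intro v hv
    have h1 := b.sum_repr (IK.mkQ ⟨v, hv⟩)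
    simp_rw [← hρ] at h1
    have h2 : IK.mkQ (⟨v, hv⟩ - ∑ j, (b.repr (IK.mkQ ⟨v, hv⟩)) j • ρ j) = 0 := by
      rw [map_sub, map_sum]
      simp_rw [map_smul]
      rw [h1, sub_self]
    rw [Submodule.mkQ_apply, Submodule.Quotient.mk_eq_zero] at h2
    have h3 : v - ∑ j, (b.repr (IK.mkQ ⟨v, hv⟩)) j • (ρ j : Fin d → AA G) ∈ aug G • K := by
      have : _ ∈ aug G • K := h2
      simpa using this
    have h4 : v = ∑ j, (b.repr (IK.mkQ ⟨v, hv⟩)) j • (ρ j : Fin d → AA G) +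
      (v - ∑ j, (b.repr (IK.mkQ ⟨v, hv⟩)) j • (ρ j : Fin d → AA G)) := by abel
    rw [h4]
    refine Submodule.add_mem_sup ?_ h3
    exact Submodule.sum_mem _ fun j _ => Submodule.smul_mem _ _ (Submodule.subset_span ⟨j, rfl⟩)
  have hpow : ∀ n, aug G ^ (n + 1) * ⊤ = aug G ^ (n + 1) := by
    intro n
    refine le_antisymm ?_ ?_
    · rw [pow_succ, mul_assoc]
      exact Submodule.mul_le.2 fun a ha b hb => Submodule.mul_mem_mul ha (hI2 hb)
    · intro a ha
      have := Submodule.mul_mem_mul ha (Submodule.mem_top (R := ZMod 2) (x := (1 : AA G)))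
      rwa [mul_one] at this
  refine growth_contra d r' hd (by omega) (fun m => finrank (ZMod 2) (AA G ⧸ ((aug G) ^ m * ⊤)))
    (finrank (ZMod 2) (AA G)) ?_ ?_ ?_ ?_
  · intro n
    have := Submodule.finrank_quotient_add_finrank (aug G ^ n * ⊤)
    omega
  · rw [pow_zero, one_mul]
    exact Module.finrank_zero_of_subsingleton
  · rw [hpow, pow_one]; exact hdim
  · intro m
    show d * finrank (ZMod 2) (AA G ⧸ ((aug G) ^ (m + 1) * ⊤)) + 1 ≤
      finrank (ZMod 2) (AA G ⧸ ((aug G) ^ (m + 2) * ⊤)) + _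
    rw [hpow, hpow]
    exact growth_step d r' (aug G) hI1 hI2 hdim _ (fun i => by
      rw [mem_aug, map_sub, eps_of, map_one, sub_self]) (phi x) (phi_apply x) (aug_le_range x hsurj)
      (ker_phi_le_pi x χ hχ hχx) (fun j => ρ j) (fun j => (ρ j).2) hgen m
end group
end GS
end
section
namespace Amb
open Subgroup
theorem img_idx {G H : Type*} [CommGroup G] [Group H] (f : G →* H) (A B : Subgroup G) (h : A ≤ B) :
    (A.map f).relIndex (B.map f) = (A ⊔ f.ker).relIndex B := by
  rw [relIndex_map_map]
  have : B ⊔ f.ker = B ⊔ (A ⊔ f.ker) := by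
    rw [← sup_assoc, sup_eq_left.2 h]
  rw [this, relIndex_sup_right]
theorem split_idx {G H : Type*} [CommGroup G] [Group H] (f : G →* H) (A B : Subgroup G) (h : A ≤ B) :
    A.relIndex B = (A.map f).relIndex (B.map f) * A.relIndex (B ⊓ f.ker) := by
  rw [img_idx f A B h]
  have h1 := relIndex_mul_relIndex A ((A ⊔ f.ker) ⊓ B) B (le_inf le_sup_left h) inf_le_right
  rw [inf_relIndex_right] at h1
  have h2 : (A ⊔ f.ker) ⊓ B = A ⊔ (B ⊓ f.ker) := by
    rw [inf_comm B, sup_inf_assoc_of_le _ h]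
  rw [h2, relIndex_sup_left] at h1
  rw [← h1, mul_comm]
def nu {G : Type*} [CommGroup G] (σ : G →* G) : G →* G := MonoidHom.id G * σ
def di {G : Type*} [CommGroup G] (σ : G →* G) : G →* G := MonoidHom.id G / σ
theorem nu_apply {G : Type*} [CommGroup G] (σ : G →* G) (x : G) : nu σ x = x * σ x := rfl
theorem di_apply {G : Type*} [CommGroup G] (σ : G →* G) (x : G) : di σ x = x / σ x := rfl
abbrev fx {G : Type*} [CommGroup G] (σ : G →* G) : Subgroup G := (di σ).ker
theorem mem_fx {G : Type*} [CommGroup G] (σ : G →* G) (x : G) : x ∈ fx σ ↔ σ x = x := by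
  rw [MonoidHom.mem_ker, di_apply, div_eq_one, eq_comm]
theorem card_coinv {I : Type*} [CommGroup I] (τ : I →* I) (P : Subgroup I) (hP : P.index ≠ 0)
    (hτ : ∀ x ∈ P, τ x ∈ P) :
    (P ⊔ (di τ).range).index = P.relIndex (P.comap (di τ)) := by
  have hle : P ≤ P.comap (di τ) := fun x hx => by
    rw [mem_comap, di_apply]; exact P.div_mem hx (hτ x hx)
  have h1 : P.relIndex (P.comap (di τ)) * (P.comap (di τ)).index = P.index :=
    relIndex_mul_index hle
  have h2 : (P.comap (di τ)).index = P.relIndex (di τ).range := by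
    rw [index_comap]
  have h3 : P.relIndex (P ⊔ (di τ).range) * (P ⊔ (di τ).range).index = P.index :=
    relIndex_mul_index le_sup_left
  rw [relIndex_sup_left] at h3
  rw [h2] at h1
  have h4 : P.relIndex (di τ).range ≠ 0 := fun h => hP (by rw [← h3, h, zero_mul])
  have h5 : P.relIndex (di τ).range * (P ⊔ (di τ).range).index =
    P.relIndex (di τ).range * P.relIndex (P.comap (di τ)) := by rw [h3, ← h1, mul_comm]
  exact Nat.eq_of_mul_eq_mul_left (Nat.pos_of_ne_zero h4) h5
theorem ambiguous {X I : Type*} [CommGroup X] [CommGroup I] (σ : X →* X) (τ : I →* I)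
    (hσ : ∀ x, σ (σ x) = x) (hτ : ∀ x, τ (τ x) = x) (δ : X →* I) (hδ : ∀ x, δ (σ x) = τ (δ x))
    (hX : (nu σ).ker ≤ (di σ).range) (hI : (nu τ).ker ≤ (di τ).range)
    (hP : δ.range.index ≠ 0)
    (I0 : Subgroup I) (h0 : (nu τ).range ≤ I0) (h1 : (fx σ).map δ ≤ I0) (h2 : I0 ≤ fx τ)
    (n : ℕ) (hE : ((δ.ker ⊓ fx σ).map (powMonoidHom 2)).relIndex (δ.ker ⊓ fx σ) = 2 ^ n)
    (hE' : ((δ.ker ⊓ (nu σ).ker).map (powMonoidHom 2)).relIndex (δ.ker ⊓ (nu σ).ker) = 2 ^ (n+1)) :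
    2 * (nu σ).range.relIndex (fx σ ⊓ (nu τ).range.comap δ) =
      I0.relIndex (fx τ) * ((nu τ).range ⊔ (fx σ).map δ).relIndex I0 := by
  set P := δ.range with hPdef
  set E := δ.ker with hEdef
  set X0 := fx σ with hX0
  set NX := (nu σ).range with hNX
  set Y0 := X0 ⊓ (nu τ).range.comap δ with hY0
  set P0 := X0.map δ with hP0
  set E0 := E ⊓ X0 with hE0
  set Em := E ⊓ (nu σ).ker with hEm
  have hδν : ∀ x, δ (nu σ x) = nu τ (δ x) := by intro x; simp [nu_apply, hδ]
  have hδd : ∀ x, δ (di σ x) = di τ (δ x) := by intro x; simp [di_apply, hδ]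
  have hνX0 : ∀ x, nu σ x ∈ X0 := by
    intro x; rw [mem_fx, nu_apply, map_mul, hσ, mul_comm]
  have hdν : ∀ x, nu σ (di σ x) = 1 := by
    intro x; simp [nu_apply, di_apply, hσ]
  have hdντ : ∀ x, nu τ (di τ x) = 1 := by
    intro x; simp [nu_apply, di_apply, hτ]
  have hX' : (nu σ).ker = (di σ).range := le_antisymm hX (by rintro _ ⟨x, rfl⟩; exact hdν x)
  have hI' : (nu τ).ker = (di τ).range := le_antisymm hI (by rintro _ ⟨x, rfl⟩; exact hdντ x)
  have hEσ : ∀ x ∈ E, σ x ∈ E := by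
    intro x hx; rw [MonoidHom.mem_ker] at hx ⊢; rw [hδ, hx, map_one]
  have hPτ : ∀ x ∈ P, τ x ∈ P := by rintro _ ⟨x, rfl⟩; exact ⟨σ x, hδ x⟩
  have hNXY : NX ≤ Y0 := by
    rintro _ ⟨x, rfl⟩
    exact ⟨hνX0 x, Subgroup.mem_comap.2 (by rw [hδν]; exact ⟨_, rfl⟩)⟩
  have i1 := split_idx δ NX Y0 hNXY
  have i2 : NX.map δ = P.map (nu τ) := by
    rw [hNX, hPdef, MonoidHom.map_range, MonoidHom.map_range]
    congr 1
    ext x; exact hδν x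
  have i3 : Y0.map δ = P0 ⊓ (nu τ).range := by
    ext y; constructor
    · rintro ⟨x, ⟨hx1, hx2⟩, rfl⟩; exact ⟨⟨x, hx1, rfl⟩, hx2⟩
    · rintro ⟨⟨x, hx1, rfl⟩, hx2⟩; exact ⟨x, ⟨hx1, hx2⟩, rfl⟩
  have i4 : Y0 ⊓ δ.ker = E0 := by
    ext y; constructor
    · rintro ⟨⟨hx1, hx2⟩, h⟩; exact ⟨h, hx1⟩
    · rintro ⟨h, hx1⟩; refine ⟨⟨hx1, Subgroup.mem_comap.2 ?_⟩, h⟩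
      rw [MonoidHom.mem_ker.1 h]; exact one_mem _
  rw [i2, i3, i4] at i1
  have hνP : P.map (nu τ) ≤ P0 ⊓ (nu τ).range := by
    rw [← i2, ← i3]; exact map_mono hNXY
  have ii1 := relIndex_mul_relIndex _ _ _ hνP (inf_le_right)
  rw [inf_relIndex_right] at ii1
  have iii1 : (P.map (nu τ)).relIndex (nu τ).range = P.relIndex (P.comap (di τ)) := by
    rw [← card_coinv τ P hP hPτ, ← hI']
    rw [MonoidHom.range_eq_map, img_idx _ _ _ le_top, relIndex_top_right]
  set J := P.comap (di τ) with hJ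
  have hfxJ : fx τ ≤ J := fun x hx => by
    rw [hJ, mem_comap, MonoidHom.mem_ker.1 hx]; exact one_mem _
  have hPJ : P ≤ J := fun x hx => by
    rw [hJ, mem_comap, di_apply]; exact P.div_mem hx (hPτ x hx)
  have iv1 := relIndex_mul_relIndex P (P ⊔ fx τ) J le_sup_left (sup_le hPJ hfxJ)
  rw [relIndex_sup_left] at iv1
  have v1 : (P ⊔ fx τ).relIndex J = (P.map (di τ)).relIndex (J.map (di τ)) :=
    (img_idx (di τ) P J hPJ).symm
  set Z := E.comap (nu σ) with hZ
  have v2 : J.map (di τ) = Z.map δ := by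
    ext y; constructor
    · rintro ⟨b, ⟨x, hx⟩, rfl⟩
      refine ⟨x, ?_, hx⟩
      show nu σ x ∈ δ.ker
      rw [MonoidHom.mem_ker, hδν, hx, hdντ]
    · rintro ⟨x, hx, rfl⟩
      have : δ x ∈ (nu τ).ker := by
        rw [MonoidHom.mem_ker, ← hδν]; exact hx
      rw [hI'] at this
      obtain ⟨b, hb⟩ := this
      exact ⟨b, ⟨x, hb.symm⟩, hb⟩
  have v3 : P.map (di τ) = ((nu σ).ker).map δ := by
    rw [hX', hPdef, MonoidHom.map_range, MonoidHom.map_range]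
    congr 1
    ext x; exact (hδd x).symm
  have hkZ : (nu σ).ker ≤ Z := fun x hx => by
    show nu σ x ∈ E
    rw [MonoidHom.mem_ker.1 hx]; exact one_mem _
  have hEZ : E ≤ Z := fun x hx => by
    show nu σ x ∈ E
    rw [nu_apply]; exact E.mul_mem hx (hEσ x hx)
  have v4 : (P.map (di τ)).relIndex (J.map (di τ)) = (E.map (nu σ)).relIndex (Z.map (nu σ)) := by
    rw [v2, v3, img_idx _ _ _ hkZ, img_idx _ _ _ hEZ, sup_comm]
  have v5 : Z.map (nu σ) = NX ⊓ E0 := by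
    ext y; constructor
    · rintro ⟨x, hx, rfl⟩; exact ⟨⟨x, rfl⟩, hx, hνX0 x⟩
    · rintro ⟨⟨x, rfl⟩, hx, _⟩; exact ⟨x, hx, rfl⟩
  rw [v4, v5] at v1
  have hNE : E.map (nu σ) ≤ NX ⊓ E0 := by rw [← v5]; exact map_mono hEZ
  have v6 := relIndex_mul_relIndex _ _ _ hNE inf_le_right
  rw [inf_relIndex_right] at v6
  have hP0P : P0 ≤ P := by rintro _ ⟨x, _, rfl⟩; exact ⟨x, rfl⟩
  have hP0fx : P0 ≤ fx τ := h1.trans h2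
  have vi1 := relIndex_mul_relIndex P0 (P ⊓ fx τ) (fx τ) (le_inf hP0P hP0fx) inf_le_right
  rw [inf_relIndex_right] at vi1
  have vi2 := relIndex_mul_relIndex P0 I0 (fx τ) h1 h2
  set Q := E.comap (di σ) with hQ
  have vii1 : P ⊓ fx τ = Q.map δ := by
    ext y; constructor
    · rintro ⟨⟨x, rfl⟩, hx⟩
      refine ⟨x, ?_, rfl⟩
      show di σ x ∈ δ.ker
      rw [MonoidHom.mem_ker, hδd]; exact hx
    · rintro ⟨x, hx, rfl⟩
      refine ⟨⟨x, rfl⟩, MonoidHom.mem_ker.2 ?_⟩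
      rw [← hδd]; exact hx
  have hX0Q : X0 ≤ Q := fun x hx => by
    show di σ x ∈ E
    rw [MonoidHom.mem_ker.1 hx]; exact one_mem _
  have hEQ : E ≤ Q := fun x hx => by
    show di σ x ∈ E
    rw [di_apply]; exact E.div_mem hx (hEσ x hx)
  have vii2 : P0.relIndex (P ⊓ fx τ) = (E.map (di σ)).relIndex (Q.map (di σ)) := by
    rw [vii1, hP0, img_idx _ _ _ hX0Q, img_idx _ _ _ hEQ, sup_comm]
  have vii3 : Q.map (di σ) = Em := by
    ext y; constructor
    · rintro ⟨x, hx, rfl⟩; exact ⟨hx, hdν x⟩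
    · rintro ⟨hy, hy'⟩
      rw [hX'] at hy'
      obtain ⟨x, rfl⟩ := hy'
      exact ⟨x, hy, rfl⟩
  rw [vii3] at vii2
  have hdE : E.map (di σ) ≤ Em := by rw [← vii3]; exact map_mono hEQ
  have viii1 : E0.map (powMonoidHom 2) = E0.map (nu σ) := by
    refine Subgroup.ext fun y => ?_
    constructor
    · rintro ⟨x, hx, rfl⟩
      exact ⟨x, hx, by rw [nu_apply, (mem_fx σ x).1 hx.2, powMonoidHom_apply, sq]⟩
    · rintro ⟨x, hx, rfl⟩
      exact ⟨x, hx, by rw [nu_apply, (mem_fx σ x).1 hx.2, powMonoidHom_apply, sq]⟩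
  have hem : ∀ x ∈ Em, σ x = x⁻¹ := fun x hx => by
    have := MonoidHom.mem_ker.1 hx.2
    rw [nu_apply] at this
    exact eq_inv_of_mul_eq_one_right this
  have viii2 : Em.map (powMonoidHom 2) = Em.map (di σ) := by
    refine Subgroup.ext fun y => ?_
    constructor
    · rintro ⟨x, hx, rfl⟩
      exact ⟨x, hx, by rw [di_apply, hem x hx, powMonoidHom_apply, sq, div_inv_eq_mul]⟩
    · rintro ⟨x, hx, rfl⟩
      exact ⟨x, hx, by rw [di_apply, hem x hx, powMonoidHom_apply, sq, div_inv_eq_mul]⟩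
  have hE0E : E0 ≤ E := inf_le_left
  have hEmE : Em ≤ E := inf_le_left
  have viii3 := relIndex_mul_relIndex _ _ _ (map_mono (f := nu σ) hE0E) (hNE.trans inf_le_right)
  have viii4 := relIndex_mul_relIndex _ _ _ (map_mono (f := di σ) hEmE) hdE
  rw [← viii1, hE] at viii3
  rw [← viii2, hE'] at viii4
  have viii5 : (E0.map (nu σ)).relIndex (E.map (nu σ)) = (Em.map (di σ)).relIndex (E.map (di σ)) := by
    rw [img_idx _ _ _ hE0E, img_idx _ _ _ hEmE, ← inf_relIndex_right (E0 ⊔ _),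
      ← inf_relIndex_right (Em ⊔ _)]
    congr 1
    rw [sup_inf_assoc_of_le _ hE0E, sup_inf_assoc_of_le _ hEmE, inf_comm _ E, inf_comm _ E, sup_comm]
  rw [viii1, viii5, ← viii2] at viii3
  have fin1 := relIndex_mul_relIndex P0 ((nu τ).range ⊔ P0) I0 le_sup_right (sup_le h0 h1)
  rw [relIndex_sup_right] at fin1
  have fin2 : P.relIndex J ≠ 0 := fun h => hP (by
    rw [← relIndex_mul_index hPJ, h, zero_mul])
  rw [iii1] at ii1
  rw [v1] at iv1
  rw [i1]
  rw [vii2] at vi1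
  generalize (map (nu τ) P).relIndex (P0 ⊓ (nu τ).range) = q1 at *
  generalize P0.relIndex (nu τ).range = s at *
  generalize P.relIndex J = q2 at *
  generalize NX.relIndex E0 = q3 at *
  generalize (map (nu σ) E).relIndex (NX ⊓ E0) = q4 at *
  generalize P.relIndex (fx τ) = q5 at *
  generalize (map (nu σ) E).relIndex E0 = a at *
  generalize (map (di σ) E).relIndex Em = b at *
  generalize P0.relIndex (fx τ) = q6 at *
  generalize P0.relIndex I0 = q7 at *
  generalize I0.relIndex (fx τ) = q8 at *
  generalize ((nu τ).range ⊔ P0).relIndex I0 = q9 at *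
  generalize (map (powMonoidHom 2) Em).relIndex (map (di σ) E) = c at *
  have hs : 0 < s := Nat.pos_of_ne_zero (by rintro rfl; exact fin2 (by rw [← ii1, mul_zero]))
  have hc : 0 < c := Nat.pos_of_ne_zero (by rintro rfl; rw [zero_mul] at viii3; exact absurd viii3.symm (by positivity))
  have hb : b = 2 * a := by
    apply Nat.eq_of_mul_eq_mul_left hc
    rw [viii4, pow_succ, ← viii3]; ring
  apply Nat.eq_of_mul_eq_mul_left hs
  calc s * (2 * (q1 * q3)) = 2 * (q1 * s) * q3 := by ring
    _ = 2 * (q4 * q3) * q5 := by rw [ii1, ← iv1]; ring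
    _ = q6 := by rw [v6, ← vi1, hb]
    _ = s * (q8 * q9) := by rw [← vi2, ← fin1]; ring
end Amb
end
section
namespace NF
open NumberField IsDedekindDomain
abbrev S (M : Type*) [Field M] := HeightOneSpectrum (𝓞 M)
section
variable {M : Type*} [Field M] [NumberField M]
theorem val_ne (v : S M) (x : Mˣ) : v.valuation M (x : M) ≠ 0 :=
  (Valuation.ne_zero_iff _).2 x.ne_zero
noncomputable def ord (v : S M) (x : Mˣ) : ℤ := -WithZero.log (v.valuation M (x : M))
theorem val_eq (v : S M) (x : Mˣ) : v.valuation M (x : M) = WithZero.exp (-ord v x) := by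
  rw [ord, neg_neg, WithZero.exp_log (val_ne v x)]
theorem ord_mul (v : S M) (x y : Mˣ) : ord v (x * y) = ord v x + ord v y := by
  simp only [ord, Units.val_mul, map_mul]
  rw [WithZero.log_mul (val_ne v x) (val_ne v y)]; ring
theorem ord_one (v : S M) : ord v 1 = 0 := by simp [ord]
theorem ord_finite (x : Mˣ) : (Function.support fun v : S M => ord v x).Finite := by
  refine ((HeightOneSpectrum.Support.finite (𝓞 M) (x : M)).union
    (HeightOneSpectrum.Support.finite (𝓞 M) ((x⁻¹ : Mˣ) : M))).subset fun v hv => ?_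
  by_contra h
  simp only [Set.mem_union, not_or] at h
  obtain ⟨h1, h2⟩ := h
  change ¬ (1 < v.valuation M (x : M)) at h1
  change ¬ (1 < v.valuation M ((x⁻¹ : Mˣ) : M)) at h2
  rw [Units.val_inv_eq_inv_val, map_inv₀, not_lt, inv_le_one₀ (zero_lt_iff.2 (val_ne v x))] at h2
  rw [not_lt] at h1
  apply hv
  simp [ord, le_antisymm h1 h2]
abbrev Dv (M : Type*) [Field M] := S M →₀ ℤ
noncomputable def dv : Mˣ →* Multiplicative (Dv M) where
  toFun x := Multiplicative.ofAdd (Finsupp.ofSupportFinite (fun v => ord v x) (ord_finite x))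
  map_one' := by
    apply Multiplicative.toAdd.injective
    ext v; exact ord_one v
  map_mul' x y := by
    apply Multiplicative.toAdd.injective
    ext v; exact ord_mul v x y
theorem dv_apply (x : Mˣ) (v : S M) : (dv x).toAdd v = ord v x := rfl
theorem ord_pow (v : S M) (x : Mˣ) (n : ℕ) : ord v (x ^ n) = n * ord v x := by
  induction n with
  | zero => simp [ord_one]
  | succ n ih => rw [pow_succ, ord_mul, ih]; push_cast; ring
theorem ord_inv (v : S M) (x : Mˣ) : ord v x⁻¹ = - ord v x := by
  have := ord_mul v x x⁻¹
  rw [mul_inv_cancel, ord_one] at this; linarith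
theorem ord_nonneg_iff (v : S M) (x : Mˣ) : 0 ≤ ord v x ↔ v.valuation M (x : M) ≤ 1 := by
  rw [val_eq, ← WithZero.exp_zero, WithZero.exp_le_exp]; simp
theorem ord_pos_iff (v : S M) (x : Mˣ) : 0 < ord v x ↔ v.valuation M (x : M) < 1 := by
  rw [val_eq, ← WithZero.exp_zero, WithZero.exp_lt_exp]; simp
theorem ord_eq_zero_iff (v : S M) (x : Mˣ) : ord v x = 0 ↔ v.valuation M (x : M) = 1 := by
  rw [val_eq, ← WithZero.exp_zero, WithZero.exp_inj]; simp
theorem int_of (x : M) (h : ∀ v : S M, v.valuation M x ≤ 1) : ∃ r : 𝓞 M, (r : M) = x := by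
  obtain ⟨r, hr⟩ := HeightOneSpectrum.mem_integers_of_valuation_le_one M x h
  exact ⟨r, hr⟩
theorem dv_ker : (dv (M := M)).ker = (Units.map (algebraMap (𝓞 M) M).toMonoidHom).range := by
  ext x
  constructor
  · intro hx
    have h : ∀ v : S M, ord v x = 0 := fun v => by
      rw [← dv_apply, MonoidHom.mem_ker.1 hx]; rfl
    obtain ⟨r, hr⟩ := int_of (x : M) fun v => le_of_eq ((ord_eq_zero_iff v x).1 (h v))
    obtain ⟨r', hr'⟩ := int_of ((x⁻¹ : Mˣ) : M) fun v => le_of_eq ((ord_eq_zero_iff v _).1 (by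
      rw [ord_inv, h, neg_zero]))
    refine ⟨⟨r, r', ?_, ?_⟩, Units.ext hr⟩
    · apply RingOfIntegers.ext; simp [hr, hr']
    · apply RingOfIntegers.ext; simp [hr, hr']
  · rintro ⟨u, rfl⟩
    apply MonoidHom.mem_ker.2
    apply Multiplicative.toAdd.injective
    ext v
    rw [dv_apply]
    have h1 : ∀ u : (𝓞 M)ˣ, 0 ≤ ord v (Units.map (algebraMap (𝓞 M) M).toMonoidHom u) := fun u =>
      (ord_nonneg_iff _ _).2 (HeightOneSpectrum.valuation_le_one v (u : 𝓞 M))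
    have h2 := h1 u⁻¹
    rw [map_inv, ord_inv] at h2
    have := h1 u
    show _ = (0 : ℤ)
    omega
theorem exists_unif (v : S M) : ∃ π : 𝓞 M, π ≠ 0 ∧ v.valuation M (π : M) = WithZero.exp (-1 : ℤ) := by
  obtain ⟨π, h⟩ := v.intValuation_exists_uniformizer
  refine ⟨π, ?_, ?_⟩
  · rintro rfl; rw [map_zero] at h; exact WithZero.exp_ne_zero h.symm
  · rw [HeightOneSpectrum.valuation_of_algebraMap, h]
theorem ord_count (x : Mˣ) (v : S M) :
    FractionalIdeal.count M v (FractionalIdeal.spanSingleton (nonZeroDivisors (𝓞 M)) (x : M)) = ord v x := by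
  obtain ⟨a, b, hb, hx⟩ := IsFractionRing.div_surjective (A := 𝓞 M) (x : M)
  have hb0 : b ≠ 0 := nonZeroDivisors.ne_zero hb
  have ha0 : a ≠ 0 := by
    rintro rfl; rw [map_zero, zero_div] at hx; exact x.ne_zero hx.symm
  have key : ∀ c : 𝓞 M, c ≠ 0 → FractionalIdeal.count M v (FractionalIdeal.spanSingleton (nonZeroDivisors (𝓞 M)) (algebraMap (𝓞 M) M c)) = - WithZero.log (v.valuation M (algebraMap (𝓞 M) M c)) := by
    intro c hc
    rw [← FractionalIdeal.coeIdeal_span_singleton, FractionalIdeal.count_coe M v (by simpa using hc),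
      HeightOneSpectrum.valuation_of_algebraMap, HeightOneSpectrum.intValuation_if_neg _ hc,
      WithZero.log_exp, neg_neg]
  have hA : algebraMap (𝓞 M) M a ≠ 0 := by simpa using ha0
  have hB : algebraMap (𝓞 M) M b ≠ 0 := by simpa using hb0
  rw [ord, ← hx, div_eq_mul_inv, ← FractionalIdeal.spanSingleton_mul_spanSingleton,
    FractionalIdeal.count_mul _ _ (FractionalIdeal.spanSingleton_ne_zero_iff.2 hA) (FractionalIdeal.spanSingleton_ne_zero_iff.2 (inv_ne_zero hB)), key a ha0,
    ← FractionalIdeal.spanSingleton_inv, FractionalIdeal.count_inv, key b hb0, map_mul, map_inv₀,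
    WithZero.log_mul (by simpa using ha0) (by simpa using hb0), WithZero.log_inv]
  ring
noncomputable def qv (v : S M) : (FractionalIdeal (nonZeroDivisors (𝓞 M)) M)ˣ :=
  Units.mk0 (v.asIdeal : FractionalIdeal (nonZeroDivisors (𝓞 M)) M) (by simpa using v.ne_bot)
noncomputable def cls : Dv M →+ Additive (ClassGroup (𝓞 M)) :=
  (ClassGroup.mk (R := 𝓞 M) M).toAdditive.comp
    (Finsupp.liftAddHom fun v => (zmultiplesHom _) (Additive.ofMul (qv v)))
theorem cls_ker (f : Dv M) (hf : cls f = 0) : ∃ x : Mˣ, ∀ v, ord v x = f v := by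
  have h1 : cls f = Additive.ofMul (ClassGroup.mk M (f.prod fun v n => qv v ^ n)) := rfl
  have h2 : ∀ v, FractionalIdeal.count M v ((f.prod fun v n => qv v ^ n : (FractionalIdeal (nonZeroDivisors (𝓞 M)) M)ˣ) : FractionalIdeal (nonZeroDivisors (𝓞 M)) M) = f v := by
    intro v
    rw [← FractionalIdeal.count_finsuppProd M v f]
    congr 1
    rw [Finsupp.prod, Units.coe_prod, Finsupp.prod]
    simp [qv]
  rw [h1, ofMul_eq_zero, ClassGroup.mk_eq_one_iff] at hf
  obtain ⟨x, hx⟩ := hf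
  have hx' : ((f.prod fun v n => qv v ^ n : (FractionalIdeal (nonZeroDivisors (𝓞 M)) M)ˣ) : FractionalIdeal (nonZeroDivisors (𝓞 M)) M) = FractionalIdeal.spanSingleton _ x := by
    rw [← FractionalIdeal.coeToSubmodule_inj, hx, FractionalIdeal.coe_spanSingleton]
  have hx0 : x ≠ 0 := by
    rintro rfl
    rw [FractionalIdeal.spanSingleton_zero] at hx'
    exact Units.ne_zero _ hx'
  refine ⟨Units.mk0 x hx0, fun v => ?_⟩
  rw [← ord_count, Units.val_mk0, ← hx', h2]
theorem dv_index : (dv (M := M)).range.index ≠ 0 := by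
  let c : Multiplicative (Dv M) →* ClassGroup (𝓞 M) := AddMonoidHom.toMultiplicativeLeft cls
  have h : c.ker ≤ (dv (M := M)).range := by
    intro f hf
    obtain ⟨x, hx⟩ := cls_ker f.toAdd hf
    refine ⟨x, ?_⟩
    apply Multiplicative.toAdd.injective
    ext v
    exact hx v
  have h2 : c.ker.index ≠ 0 := by
    rw [Subgroup.index_ker]; exact Nat.card_pos.ne'
  exact fun h0 => h2 (Nat.eq_zero_of_zero_dvd (h0 ▸ Subgroup.index_dvd_of_le h))
end
end NF
end
section
set_option linter.unusedSectionVars false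
namespace NF
open NumberField IsDedekindDomain
open scoped Pointwise
section act
variable {K L : Type*} [Field K] [Field L] [NumberField L] [Algebra K L]
noncomputable instance : MulAction (L ≃ₐ[K] L) (S L) where
  smul σ v := ⟨σ • v.asIdeal, inferInstance, fun h => v.ne_bot (by
    have := congrArg (fun I => σ⁻¹ • I) h
    simpa using this)⟩
  one_smul v := HeightOneSpectrum.ext (one_smul _ v.asIdeal)
  mul_smul σ τ v := HeightOneSpectrum.ext (mul_smul σ τ v.asIdeal)
theorem smul_asIdeal (σ : L ≃ₐ[K] L) (v : S L) : (σ • v).asIdeal = σ • v.asIdeal := rfl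
theorem intval_smul (σ : L ≃ₐ[K] L) (v : S L) (x : 𝓞 L) :
    (σ • v).intValuation (σ • x) = v.intValuation x := by
  have key : ∀ (σ : L ≃ₐ[K] L) (v : S L) (x : 𝓞 L),
      (σ • v).intValuation (σ • x) ≤ v.intValuation x := by
    intro σ v x
    rcases eq_or_ne x 0 with rfl | hx
    · simp
    · obtain ⟨n, hn⟩ : ∃ n : ℕ, v.intValuation x = WithZero.exp (-(n : ℤ)) := by
        rw [HeightOneSpectrum.intValuation_if_neg _ hx]; exact ⟨_, rfl⟩
      rw [hn, HeightOneSpectrum.intValuation_le_pow_iff_mem, smul_asIdeal, ← smul_pow',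
        Ideal.smul_mem_pointwise_smul_iff, ← HeightOneSpectrum.intValuation_le_pow_iff_mem, hn]
  refine le_antisymm (key σ v x) ?_
  simpa using key σ⁻¹ (σ • v) (σ • x)
theorem val_smul (σ : L ≃ₐ[K] L) (v : S L) (x : L) :
    (σ • v).valuation L (σ x) = v.valuation L x := by
  obtain ⟨a, b, hb, rfl⟩ := IsFractionRing.div_surjective (A := 𝓞 L) x
  have h : ∀ a : 𝓞 L, σ (algebraMap (𝓞 L) L a) = algebraMap (𝓞 L) L (σ • a) := fun _ => rfl
  rw [map_div₀, map_div₀, map_div₀, h, h, HeightOneSpectrum.valuation_of_algebraMap,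
    HeightOneSpectrum.valuation_of_algebraMap, HeightOneSpectrum.valuation_of_algebraMap,
    HeightOneSpectrum.valuation_of_algebraMap, intval_smul, intval_smul]
theorem ord_smul (σ : L ≃ₐ[K] L) (v : S L) (x : Lˣ) : ord (σ • v) (σ • x) = ord v x := by
  have := val_smul σ v (x : L)
  simp only [ord]
  rw [← this]; rfl
theorem ord_smul' (σ : L ≃ₐ[K] L) (v : S L) (x : Lˣ) : ord v (σ • x) = ord (σ⁻¹ • v) x := by
  rw [← ord_smul σ (σ⁻¹ • v), smul_inv_smul]
noncomputable instance : DistribMulAction (L ≃ₐ[K] L) (Dv L) where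
  smul σ f := Finsupp.mapDomain (fun v => σ • v) f
  one_smul f := by
    show Finsupp.mapDomain _ f = f
    simp only [one_smul]; exact Finsupp.mapDomain_id
  mul_smul σ τ f := by
    show Finsupp.mapDomain _ f = Finsupp.mapDomain _ (Finsupp.mapDomain _ f)
    rw [← Finsupp.mapDomain_comp]
    congr 1; ext v; simp [mul_smul]
  smul_zero σ := Finsupp.mapDomain_zero
  smul_add σ f g := Finsupp.mapDomain_add
theorem dsmul_apply (σ : L ≃ₐ[K] L) (f : Dv L) (v : S L) : (σ • f) v = f (σ⁻¹ • v) := by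
  have := Finsupp.mapDomain_apply (MulAction.injective σ) f (σ⁻¹ • v)
  rw [smul_inv_smul] at this
  exact this
theorem dv_smul (σ : L ≃ₐ[K] L) (x : Lˣ) : (dv (σ • x)).toAdd = σ • (dv x).toAdd := by
  ext v
  rw [dsmul_apply, dv_apply, dv_apply, ord_smul']
end act
section ext
variable {M N : Type*} [Field M] [NumberField M] [Field N] [NumberField N] [Algebra M N]
noncomputable def bel (M : Type*) [Field M] [NumberField M] [Algebra M N] (w : S N) : S M :=
  ⟨w.asIdeal.under (𝓞 M), inferInstance, by
    intro h
    exact w.ne_bot (Ideal.eq_bot_of_comap_eq_bot h)⟩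
instance (w : S N) : w.asIdeal.LiesOver (bel M w).asIdeal := ⟨rfl⟩
noncomputable def ram (M : Type*) [Field M] [NumberField M] [Algebra M N] (w : S N) : ℕ :=
  (bel M w).asIdeal.ramificationIdx' w.asIdeal
theorem val_bel (w : S N) (x : M) :
    w.valuation N (algebraMap M N x) = (bel M w).valuation M x ^ ram M w :=
  (HeightOneSpectrum.valuation_liesOver (A := 𝓞 M) (B := 𝓞 N) N (bel M w) w x).symm
theorem ram_ne_zero (w : S N) : ram M w ≠ 0 := by
  intro h
  obtain ⟨π, hπ, hv⟩ := exists_unif (bel M w)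
  have h1 := val_bel (M := M) w (π : M)
  rw [h, pow_zero] at h1
  have h2 : (w.valuation N (algebraMap M N π)) < 1 := by
    have : algebraMap M N π = algebraMap (𝓞 N) N (algebraMap (𝓞 M) (𝓞 N) π) := by
      rw [← IsScalarTower.algebraMap_apply (𝓞 M) (𝓞 N) N, IsScalarTower.algebraMap_apply (𝓞 M) M N]
    rw [this, HeightOneSpectrum.valuation_lt_one_iff_mem]
    have h3 : π ∈ (bel M w).asIdeal := by
      rw [← HeightOneSpectrum.valuation_lt_one_iff_mem (K := M)]
      change (bel M w).valuation M (π : M) < 1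
      rw [hv, ← WithZero.exp_zero, WithZero.exp_lt_exp]; norm_num
    exact h3
  rw [h1] at h2
  exact lt_irrefl _ h2
noncomputable abbrev inc (M N : Type*) [Field M] [Field N] [Algebra M N] : Mˣ →* Nˣ :=
  Units.map (algebraMap M N).toMonoidHom
theorem ord_bel (w : S N) (x : Mˣ) : ord w (inc M N x) = ram M w * ord (bel M w) x := by
  have := val_bel (M := M) w (x : M)
  simp only [ord]
  change -WithZero.log (w.valuation N (algebraMap M N x)) = _
  rw [this, WithZero.log_pow]
  simp
theorem exists_above (v : S M) : ∃ w : S N, bel M w = v := by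
  have : v.asIdeal.IsMaximal := v.isMaximal
  obtain ⟨P, hP, hl⟩ := Ideal.exists_maximal_ideal_liesOver_of_isIntegral (S := 𝓞 N) v.asIdeal
  refine ⟨⟨P, hP.isPrime, ?_⟩, HeightOneSpectrum.ext hl.over.symm⟩
  rintro rfl
  apply v.ne_bot
  rw [hl.over]
  exact Ideal.comap_bot_of_injective _ (FaithfulSMul.algebraMap_injective (𝓞 M) (𝓞 N))
theorem bel_fiber (v : S M) : {w : S N | bel M w = v}.Finite := by
  obtain ⟨π, hπ, hv⟩ := exists_unif v
  have hπ' : (π : M) ≠ 0 := by simpa using hπ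
  refine (ord_finite (inc M N (Units.mk0 (π : M) hπ'))).subset ?_
  rintro w rfl
  rw [Function.mem_support, ord_bel]
  have : ord (bel M w) (Units.mk0 (π : M) hπ') = 1 := by
    rw [ord, Units.val_mk0, hv]; simp
  rw [this]
  simpa using ram_ne_zero w
theorem ext_finite (f : Dv M) : (Function.support fun w : S N => (ram M w : ℤ) * f (bel M w)).Finite := by
  refine (Set.Finite.biUnion f.support.finite_toSet fun v _ => bel_fiber (N := N) v).subset ?_
  intro w hw
  simp only [Set.mem_iUnion]
  refine ⟨bel M w, ?_, rfl⟩
  rw [Function.mem_support] at hw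
  exact Finsupp.mem_support_iff.2 (right_ne_zero_of_mul hw)
noncomputable def exd (M N : Type*) [Field M] [NumberField M] [Field N] [NumberField N] [Algebra M N] :
    Dv M →+ Dv N where
  toFun f := Finsupp.ofSupportFinite _ (ext_finite f)
  map_zero' := by ext w; simp [Finsupp.ofSupportFinite_coe]
  map_add' f g := by ext w; simp [Finsupp.ofSupportFinite_coe, mul_add]
theorem exd_apply (f : Dv M) (w : S N) : exd M N f w = ram M w * f (bel M w) := rfl
theorem dv_inc (x : Mˣ) : (dv (inc M N x)).toAdd = exd M N (dv x).toAdd := by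
  refine Finsupp.ext fun w => ?_
  rw [dv_apply, exd_apply, dv_apply]
  exact ord_bel w x
theorem bel_smul (σ : N ≃ₐ[M] N) (w : S N) : bel M (σ • w) = bel M w := by
  apply HeightOneSpectrum.ext
  ext x
  show algebraMap (𝓞 M) (𝓞 N) x ∈ σ • w.asIdeal ↔ algebraMap (𝓞 M) (𝓞 N) x ∈ w.asIdeal
  rw [Ideal.mem_pointwise_smul_iff_inv_smul_mem]
  have : σ⁻¹ • algebraMap (𝓞 M) (𝓞 N) x = algebraMap (𝓞 M) (𝓞 N) x := by
    apply RingOfIntegers.ext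
    exact (σ⁻¹).commutes (x : M)
  rw [this]
theorem bel_trans [IsGalois M N] (w w' : S N) (h : bel M w = bel M w') : ∃ σ : N ≃ₐ[M] N, σ • w = w' := by
  have : w'.asIdeal.LiesOver (bel M w).asIdeal := by rw [h]; infer_instance
  obtain ⟨σ, hσ⟩ := Ideal.exists_smul_eq_of_isGaloisGroup (bel M w).asIdeal w.asIdeal w'.asIdeal (N ≃ₐ[M] N)
  exact ⟨σ, HeightOneSpectrum.ext hσ⟩
def Unr (M N : Type*) [Field M] [NumberField M] [Field N] [NumberField N] [Algebra M N] : Prop :=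
  differentIdeal (𝓞 M) (𝓞 N) = ⊤
theorem ram_one (h : Unr M N) (w : S N) : ram M w = 1 := by
  have hle : w.asIdeal ^ ram M w ∣ Ideal.map (algebraMap (𝓞 M) (𝓞 N)) (bel M w).asIdeal := by
    rw [Ideal.dvd_iff_le]; exact Ideal.le_pow_ramificationIdx'
  have : (bel M w).asIdeal.IsMaximal := (bel M w).isMaximal
  have h1 := pow_sub_one_dvd_differentIdeal (𝓞 M) w.asIdeal _ (bel M w).ne_bot hle
  rw [h, Ideal.dvd_iff_le] at h1
  have h2 : ram M w - 1 = 0 := by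
    by_contra h3
    exact w.isPrime.ne_top (top_le_iff.1 (h1.trans (Ideal.pow_le_self h3)))
  have := ram_ne_zero (M := M) w
  omega
theorem exd_inj : Function.Injective (exd M N) := by
  intro f g h
  ext v
  obtain ⟨w, rfl⟩ := exists_above (N := N) v
  have := DFunLike.congr_fun h w
  rw [exd_apply, exd_apply] at this
  exact mul_left_cancel₀ (by simpa using ram_ne_zero (M := M) w) this
theorem mem_exd [IsGalois M N] (f : Dv N) (hf : ∀ σ : N ≃ₐ[M] N, σ • f = f) (hr : ∀ w, (ram M w : ℤ) ∣ f w) :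
    ∃ g, exd M N g = f := by
  choose a ha using fun v : S M => exists_above (N := N) v
  have hinv : ∀ w, f w = f (a (bel M w)) := by
    intro w
    obtain ⟨σ, hσ⟩ := bel_trans (a (bel M w)) w (ha _)
    rw [← hσ]
    have := dsmul_apply σ⁻¹ f (a (bel M w))
    rw [hf, inv_inv] at this
    rw [hσ] at this ⊢
    rw [this]
  have hfin : (Function.support fun v => f (a v) / (ram M (a v) : ℤ)).Finite := by
    refine (f.support.finite_toSet.image (bel (N := N) M)).subset ?_
    intro v hv
    refine ⟨a v, Finset.mem_coe.2 (Finsupp.mem_support_iff.2 ?_), ha v⟩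
    intro h0
    apply hv
    simp [h0]
  have hram : ∀ w : S N, ram M (a (bel M w)) = ram M w := by
    intro w
    obtain ⟨σ, hσ⟩ := bel_trans (a (bel M w)) w (ha _)
    obtain ⟨π, hπ, hv⟩ := exists_unif (bel M w)
    have hπ' : (π : M) ≠ 0 := by simpa using hπ
    have h1 := ord_bel (N := N) (a (bel M w)) (Units.mk0 (π : M) hπ')
    have h2 := ord_bel (N := N) w (Units.mk0 (π : M) hπ')
    have h3 : ord (bel M w) (Units.mk0 (π : M) hπ') = 1 := by
      rw [ord, Units.val_mk0, hv]; simp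
    rw [ha, h3] at h1
    rw [h3] at h2
    have h4 := ord_smul σ (a (bel M w)) (inc M N (Units.mk0 (π : M) hπ'))
    have h5 : σ • (inc M N (Units.mk0 (π : M) hπ')) = inc M N (Units.mk0 (π : M) hπ') := by
      ext; exact σ.commutes _
    rw [h5, hσ, h1, h2] at h4
    simpa using h4.symm
  refine ⟨Finsupp.ofSupportFinite _ hfin, ?_⟩
  ext w
  rw [exd_apply, Finsupp.ofSupportFinite_coe, ← hram, Int.mul_ediv_cancel' (hr _), ← hinv]
theorem exd_smul (σ : N ≃ₐ[M] N) (f : Dv M) : σ • exd M N f = exd M N f := by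
  ext w
  rw [dsmul_apply, exd_apply, exd_apply, bel_smul]
  congr 2
  obtain ⟨π, hπ, hv⟩ := exists_unif (bel M w)
  have hπ' : (π : M) ≠ 0 := by simpa using hπ
  have h1 := ord_bel (N := N) (σ⁻¹ • w) (Units.mk0 (π : M) hπ')
  have h2 := ord_bel (N := N) w (Units.mk0 (π : M) hπ')
  have h3 : ord (bel M w) (Units.mk0 (π : M) hπ') = 1 := by
    rw [ord, Units.val_mk0, hv]; simp
  rw [bel_smul, h3] at h1
  rw [h3] at h2
  have h5 : σ • (inc M N (Units.mk0 (π : M) hπ')) = inc M N (Units.mk0 (π : M) hπ') := by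
    ext; exact σ.commutes _
  rw [← ord_smul', h5] at h1
  rw [h1] at h2
  simpa using h2
end ext
end NF
end
section
set_option linter.unusedSectionVars false
namespace NF
open NumberField Amb
theorem sq_idx_aux {A F T : Type*} [AddCommGroup A] [Module.Finite ℤ A] [AddCommGroup F] [AddCommGroup T]
    [Module.Finite ℤ F] [Module.Free ℤ F] [Finite T] (φ : A ≃+ F × T) :
    (nsmulAddMonoidHom (α := A) 2).range.index = 2 ^ Module.finrank ℤ A *
      Nat.card {a : A // a + a = 0} := by
  have e1 : Module.finrank ℤ A = Module.finrank ℤ F := by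
    have hT : Module.finrank ℤ T = 0 := by
      rw [Module.finrank_eq_zero_iff_isTorsion]
      intro x
      exact ⟨⟨(Nat.card T : ℤ), by simp [Nat.card_pos.ne']⟩, by
        change (Nat.card T : ℤ) • x = 0
        rw [natCast_zsmul, card_nsmul_eq_zero']⟩
    have h1 := Submodule.finrank_quotient_add_finrank (LinearMap.ker (LinearMap.fst ℤ F T))
    have h2 := LinearMap.finrank_range_of_inj (f := LinearMap.inr ℤ F T) LinearMap.inr_injective
    rw [(LinearMap.fst ℤ F T).quotKerEquivRange.finrank_eq, LinearMap.ker_fst, h2, hT,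
      LinearMap.range_eq_top.2 LinearMap.fst_surjective, finrank_top] at h1
    rw [φ.toIntLinearEquiv.finrank_eq, ← h1, add_zero]
  have e2 : Nat.card {a : A // a + a = 0} = Nat.card {a : T // a + a = 0} := by
    refine Nat.card_congr ⟨fun a => ⟨(φ a.1).2, ?_⟩, fun t => ⟨φ.symm (0, t.1), ?_⟩, ?_, ?_⟩
    · rw [← Prod.snd_add, ← map_add, a.2, map_zero]; rfl
    · rw [← map_add, Prod.mk_add_mk, t.2, add_zero]; exact map_zero _
    · intro a
      apply Subtype.ext
      change φ.symm (0, (φ a.1).2) = a.1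
      rw [AddEquiv.symm_apply_eq]
      refine Prod.ext ?_ rfl
      have : (φ a.1).1 + (φ a.1).1 = 0 := by rw [← Prod.fst_add, ← map_add, a.2, map_zero]; rfl
      rw [← two_nsmul] at this
      have hF : Module.IsTorsionFree ℤ F := inferInstance
      have h7 : (2 : ℤ) • (φ a.1).1 = 0 := by rw [← this]; exact natCast_zsmul _ 2
      exact ((smul_eq_zero.1 h7).resolve_left (by norm_num)).symm
    · intro t; simp
  have e3 : (nsmulAddMonoidHom (α := A) 2).range.map φ.toAddMonoidHom =
      (nsmulAddMonoidHom (α := F) 2).range.prod (nsmulAddMonoidHom (α := T) 2).range := by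
    ext ⟨x, y⟩
    simp only [AddSubgroup.mem_map, AddMonoidHom.mem_range, AddSubgroup.mem_prod]
    constructor
    · rintro ⟨_, ⟨a, rfl⟩, h⟩
      have h' : (2 : ℕ) • φ a = (x, y) := by rw [← h]; simp
      exact ⟨⟨(φ a).1, congrArg Prod.fst h'⟩, ⟨(φ a).2, congrArg Prod.snd h'⟩⟩
    · rintro ⟨⟨a, rfl⟩, ⟨b, rfl⟩⟩
      exact ⟨_, ⟨φ.symm (a, b), rfl⟩, by simp⟩
  have e4 : ((nsmulAddMonoidHom (α := A) 2).range.map φ.toAddMonoidHom).index =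
    (nsmulAddMonoidHom (α := A) 2).range.index := AddSubgroup.index_map_equiv _ φ
  have e5 : (nsmulAddMonoidHom (α := T) 2).range.index = Nat.card {a : T // a + a = 0} := by
    have h1 := (nsmulAddMonoidHom (α := T) 2).range.index_mul_card
    have h2 := (nsmulAddMonoidHom (α := T) 2).ker.index_mul_card
    rw [AddSubgroup.index_ker, ← h1, mul_comm] at h2
    have h3 : Nat.card (nsmulAddMonoidHom (α := T) 2).ker = Nat.card {a : T // a + a = 0} :=
      Nat.card_congr (Equiv.subtypeEquivRight fun a => by simp [AddMonoidHom.mem_ker, two_nsmul])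
    rw [← h3]
    exact (Nat.eq_of_mul_eq_mul_right Nat.card_pos h2).symm
  rw [← e4, e3, AddSubgroup.index_prod, AddSubgroup.index_range_nsmul, e5, e1, e2]
theorem sq_idx_add (A : Type*) [AddCommGroup A] [Module.Finite ℤ A] :
    (nsmulAddMonoidHom (α := A) 2).range.index = 2 ^ Module.finrank ℤ A *
      Nat.card {a : A // a + a = 0} := by
  have : AddGroup.FG A := Module.Finite.iff_addGroup_fg.1 inferInstance
  obtain ⟨n, ι, hι, p, hp, e, ⟨φ⟩⟩ := AddCommGroup.equiv_free_prod_directSum_zmod A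
  classical
  have : ∀ i, NeZero (p i ^ e i) := fun i => ⟨pow_ne_zero _ (hp i).ne_zero⟩
  have : Finite (DirectSum ι fun i => ZMod (p i ^ e i)) :=
    Finite.of_equiv _ (DirectSum.addEquivProd fun i => ZMod (p i ^ e i)).symm.toEquiv
  exact sq_idx_aux φ
theorem sq_idx {E : Type*} [CommGroup E] [Module.Finite ℤ (Additive E)] (A : Subgroup E) :
    (A.map (powMonoidHom 2)).relIndex A = 2 ^ Module.finrank ℤ (Additive A) *
      Nat.card {a : A // a * a = 1} := by
  have : Module.Finite ℤ (Additive A) :=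
    inferInstanceAs (Module.Finite ℤ (Subgroup.toAddSubgroup A).toIntSubmodule)
  have key := sq_idx_add (Additive A)
  have : (A.map (powMonoidHom 2)).subgroupOf A = (powMonoidHom 2 : A →* A).range := by
    ext x
    simp only [Subgroup.mem_subgroupOf, Subgroup.mem_map, MonoidHom.mem_range]
    constructor
    · rintro ⟨y, hy, h⟩; exact ⟨⟨y, hy⟩, Subtype.ext h⟩
    · rintro ⟨y, rfl⟩; exact ⟨y, y.2, rfl⟩
  rw [Subgroup.relIndex, this]
  exact key
theorem rank_split {E : Type*} [CommGroup E] [Module.Finite ℤ (Additive E)] (σ : E →* E)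
    (hσ : ∀ x, σ (σ x) = x) :
    Module.finrank ℤ (Additive E) = Module.finrank ℤ (Additive (fx σ)) + Module.finrank ℤ (Additive (nu σ).ker) := by
  let f : Additive E →ₗ[ℤ] Additive E := (MonoidHom.toAdditive (nu σ)).toIntLinearMap
  let F : Submodule ℤ (Additive E) := (Subgroup.toAddSubgroup (fx σ)).toIntSubmodule
  have h1 := Submodule.finrank_quotient_add_finrank (LinearMap.ker f)
  rw [f.quotKerEquivRange.finrank_eq] at h1
  have h2 : Module.finrank ℤ (LinearMap.range f) = Module.finrank ℤ F := by
    apply le_antisymm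
    · apply Submodule.finrank_mono
      rintro _ ⟨x, rfl⟩
      change nu σ x.toMul ∈ fx σ
      rw [mem_fx, nu_apply, map_mul, hσ, mul_comm]
    · let g : F →ₗ[ℤ] F := (2 : ℤ) • LinearMap.id
      have h5 := Submodule.finrank_quotient_add_finrank (LinearMap.ker g)
      rw [g.quotKerEquivRange.finrank_eq] at h5
      have h6 : Module.finrank ℤ (LinearMap.ker g) = 0 := by
        rw [Module.finrank_eq_zero_iff_isTorsion]
        rintro ⟨x, hx⟩
        exact ⟨⟨2, by simp⟩, Subtype.ext hx⟩
      rw [← h5, h6, add_zero, ← LinearMap.finrank_range_of_inj (f := F.subtype ∘ₗ (LinearMap.range g).subtype)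
        (F.injective_subtype.comp (Submodule.injective_subtype _))]
      apply Submodule.finrank_mono
      rintro _ ⟨⟨_, ⟨x, hx⟩, rfl⟩, rfl⟩
      refine ⟨x, ?_⟩
      have : σ x.toMul = x.toMul := (mem_fx ..).1 hx
      change nu σ x.toMul = (Additive.toMul ((2 : ℤ) • x))
      rw [nu_apply, this, toMul_zsmul]
      exact (zpow_two _).symm
  have h3 : Module.finrank ℤ F = Module.finrank ℤ (Additive (fx σ)) := rfl
  have h4 : Module.finrank ℤ (LinearMap.ker f) = Module.finrank ℤ (Additive (nu σ).ker) := rfl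
  omega
section
variable {M N : Type*} [Field M] [NumberField M] [Field N] [NumberField N] [Algebra M N]
noncomputable def sg (σ : N ≃ₐ[M] N) : Nˣ →* Nˣ := MulDistribMulAction.toMonoidHom Nˣ σ
theorem sg_apply (σ : N ≃ₐ[M] N) (x : Nˣ) : sg σ x = σ • x := rfl
noncomputable def ui (N : Type*) [Field N] : (𝓞 N)ˣ →* Nˣ := Units.map (algebraMap (𝓞 N) N).toMonoidHom
theorem ui_inj : Function.Injective (ui N) :=
  Units.map_injective (FaithfulSMul.algebraMap_injective (𝓞 N) N)
noncomputable def su (σ : N ≃ₐ[M] N) : (𝓞 N)ˣ →* (𝓞 N)ˣ := Units.map (MulSemiringAction.toRingHom _ (𝓞 N) σ).toMonoidHom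
theorem su_apply (σ : N ≃ₐ[M] N) (x : (𝓞 N)ˣ) : ui N (su σ x) = sg σ (ui N x) := by
  ext; rfl
theorem two_tor (A : Subgroup (𝓞 N)ˣ) (h : -1 ∈ A) : Nat.card {a : A // a * a = 1} = 2 := by
  have e : {a : A // a * a = 1} ≃ ({1, -1} : Set (𝓞 N)ˣ) :=
    ⟨fun a => ⟨a.1.1, by
      have := congrArg Subtype.val a.2
      have h2 : ((a.1.1 : 𝓞 N)) * a.1.1 = 1 := congrArg Units.val this
      rcases mul_self_eq_one_iff.1 h2 with h | h
      · left; exact Units.ext h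
      · right; exact Units.ext h⟩,
      fun a => ⟨⟨a.1, by rcases a.2 with h' | h' <;> rw [h']; exacts [A.one_mem, h]⟩,
        Subtype.ext (by
          rcases a.2 with h' | h'
          · simp [h']
          · simp [Set.mem_singleton_iff.1 h'])⟩,
      fun a => rfl, fun a => rfl⟩
  rw [Nat.card_congr e, Nat.card_coe_set_eq, Set.ncard_pair]
  intro h
  have h2 : (1 : 𝓞 N) = -1 := congrArg Units.val h
  have := congrArg (algebraMap (𝓞 N) N) h2
  rw [map_one, map_neg, map_one] at this
  norm_num at this
theorem tr_rank [IsTotallyReal N] : Units.rank N + 1 = Module.finrank ℚ N := by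
  rw [IsTotallyReal.finrank, Units.rank, InfinitePlace.card_eq_nrRealPlaces_add_nrComplexPlaces,
    IsTotallyReal.nrComplexPlaces_eq_zero, add_zero]
  have : 0 < InfinitePlace.nrRealPlaces N := by
    rw [← IsTotallyReal.finrank]; exact Module.finrank_pos
  omega
theorem fixed_two [IsGalois M N] (σ : N ≃ₐ[M] N) (hG : ∀ τ : N ≃ₐ[M] N, τ = 1 ∨ τ = σ) (x : N)
    (h : σ x = x) : ∃ y, algebraMap M N y = x := by
  have := IsGalois.mem_bot_iff_fixed (F := M) x |>.2 (fun τ => by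
    rcases hG τ with rfl | rfl; exacts [rfl, h])
  exact IntermediateField.mem_bot.1 this
theorem unit_idx [IsTotallyReal N] [IsTotallyReal M] [IsGalois M N] (h2 : Module.finrank M N = 2) (σ : N ≃ₐ[M] N)
    (hσ : ∀ x, σ (σ x) = x) (hG : ∀ τ : N ≃ₐ[M] N, τ = 1 ∨ τ = σ) :
    (((dv (M := N)).ker ⊓ fx (sg σ)).map (powMonoidHom 2)).relIndex ((dv (M := N)).ker ⊓ fx (sg σ)) = 2 ^ Module.finrank ℚ M ∧
    (((dv (M := N)).ker ⊓ (nu (sg σ)).ker).map (powMonoidHom 2)).relIndex ((dv (M := N)).ker ⊓ (nu (sg σ)).ker)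
      = 2 ^ (Module.finrank ℚ M + 1) := by
  have tr : ∀ A : Subgroup (𝓞 N)ˣ, ((A.map (ui N)).map (powMonoidHom 2)).relIndex (A.map (ui N)) =
      (A.map (powMonoidHom 2)).relIndex A := by
    intro A
    have : (A.map (ui N)).map (powMonoidHom 2) = (A.map (powMonoidHom 2)).map (ui N) := by
      rw [Subgroup.map_map, Subgroup.map_map]; congr 1
    rw [this, Subgroup.relIndex_map_map_of_injective _ _ ui_inj]
  have hs : ∀ x, su σ (su σ x) = x := by
    intro x; apply ui_inj; rw [su_apply, su_apply]; ext; exact hσ _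
  have e1 : (dv (M := N)).ker ⊓ fx (sg σ) = (fx (su σ)).map (ui N) := by
    rw [dv_ker]
    ext x
    constructor
    · rintro ⟨⟨y, rfl⟩, h⟩
      refine ⟨y, (mem_fx ..).2 (ui_inj ?_), rfl⟩
      rw [su_apply]; exact (mem_fx ..).1 h
    · rintro ⟨y, h, rfl⟩
      refine ⟨⟨y, rfl⟩, (mem_fx ..).2 ?_⟩
      rw [← su_apply, (mem_fx ..).1 h]
  have e2 : (dv (M := N)).ker ⊓ (nu (sg σ)).ker = (nu (su σ)).ker.map (ui N) := by
    rw [dv_ker]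
    ext x
    have : ∀ y, ui N (nu (su σ) y) = nu (sg σ) (ui N y) := fun y => by
      rw [nu_apply, nu_apply, map_mul, su_apply]
    constructor
    · rintro ⟨⟨y, rfl⟩, h⟩
      refine ⟨y, ui_inj ?_, rfl⟩
      rw [this, map_one]; exact h
    · rintro ⟨y, h, rfl⟩
      refine ⟨⟨y, rfl⟩, ?_⟩
      change nu (sg σ) (ui N y) = 1
      rw [← this, show nu (su σ) y = 1 from h, map_one]
  have hm : su σ (-1) = -1 := by apply ui_inj; rw [su_apply]; ext; simp [sg_apply, ui]
  rw [e1, e2, tr, tr, sq_idx, sq_idx, two_tor _ ((mem_fx ..).2 hm), two_tor _ (by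
    rw [MonoidHom.mem_ker, nu_apply, hm]; simp)]
  have r1 := rank_split (su σ) hs
  have r2 : Module.finrank ℤ (Additive (fx (su σ))) = Module.finrank ℤ (Additive (𝓞 M)ˣ) := by
    let j : (𝓞 M)ˣ →* (𝓞 N)ˣ := Units.map (algebraMap (𝓞 M) (𝓞 N)).toMonoidHom
    have hj : Function.Injective j := Units.map_injective (FaithfulSMul.algebraMap_injective (𝓞 M) (𝓞 N))
    have hr : j.range = fx (su σ) := by
      ext x
      rw [mem_fx]
      constructor
      · rintro ⟨y, rfl⟩
        apply ui_inj; rw [su_apply]; ext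
        exact σ.commutes _
      · intro h
        have hx : sg σ (ui N x) = ui N x := by rw [← su_apply, h]
        have hx' : σ ((ui N x : Nˣ) : N) = ui N x := congrArg Units.val hx
        obtain ⟨y, hy⟩ := fixed_two σ hG _ hx'
        have hy0 : y ≠ 0 := by rintro rfl; rw [map_zero] at hy; exact (ui N x).ne_zero hy.symm
        have hyu : inc M N (Units.mk0 y hy0) = ui N x := Units.ext hy
        have : Units.mk0 y hy0 ∈ (dv (M := M)).ker := by
          rw [MonoidHom.mem_ker]
          apply Multiplicative.toAdd.injective
          apply exd_inj (M := M) (N := N)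
          rw [← dv_inc, hyu]
          have : ui N x ∈ (dv (M := N)).ker := by rw [dv_ker]; exact ⟨x, rfl⟩
          rw [MonoidHom.mem_ker] at this
          rw [this, toAdd_one, toAdd_one, map_zero]
        rw [dv_ker] at this
        obtain ⟨z, hz⟩ := this
        refine ⟨z, ui_inj ?_⟩
        rw [← hyu, ← hz]; rfl
    have e := ((MonoidHom.ofInjective hj).trans (MulEquiv.subgroupCongr hr)).toAdditive
    exact e.toIntLinearEquiv.finrank_eq.symm
  rw [r2, Units.finrank_eq, Units.finrank_eq] at r1
  rw [r2, Units.finrank_eq]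
  have t1 := tr_rank (N := N)
  have t2 := tr_rank (N := M)
  have t3 := Module.finrank_mul_finrank ℚ M N
  rw [h2] at t3
  constructor
  · rw [← pow_succ, t2]
  · rw [← pow_succ]; congr 1; omega
end
end NF
end
section
set_option linter.unusedSectionVars false
namespace NF
open NumberField Amb IsDedekindDomain
section
variable {M N : Type*} [Field M] [NumberField M] [Field N] [NumberField N] [Algebra M N]
theorem approx_nn (T : Finset (S M)) (f : S M → ℕ) : ∃ x : Mˣ, (∀ v ∈ T, ord v x = f v) ∧ ∀ v, 0 ≤ ord v x := by
  rcases T.eq_empty_or_nonempty with rfl | ⟨v0, hv0⟩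
  · exact ⟨1, by simp, fun v => by rw [ord_one]⟩
  choose π hπ hv using fun v : S M => exists_unif v
  obtain ⟨y, hy⟩ := IsDedekindDomain.exists_forall_sub_mem_ideal (s := T) (fun v => v.asIdeal)
    (fun v => f v + 1) (fun v _ => v.prime) (fun v _ w _ h h' => h (HeightOneSpectrum.ext h'))
    (fun v => π v.1 ^ f v.1)
  have key : ∀ v ∈ T, v.valuation M (y : M) = WithZero.exp (-(f v : ℤ)) := by
    intro v hvT
    have h1 := (v.intValuation_le_pow_iff_mem _ _).2 (hy v hvT)
    rw [← HeightOneSpectrum.valuation_of_algebraMap (K := M)] at h1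
    change v.valuation M (algebraMap (𝓞 M) M (y - π v ^ f v)) ≤ _ at h1
    rw [map_sub (algebraMap (𝓞 M) M), map_pow (algebraMap (𝓞 M) M)] at h1
    have h2 : v.valuation M ((π v : M) ^ f v) = WithZero.exp (-(f v : ℤ)) := by
      rw [map_pow, hv, ← WithZero.exp_nsmul]; simp
    have h3 : v.valuation M ((y : M) - (π v : M) ^ f v) < v.valuation M ((π v : M) ^ f v) := by
      rw [h2]
      refine lt_of_le_of_lt h1 (WithZero.exp_lt_exp.2 ?_)
      push_cast; omega
    rw [← h2, ← Valuation.map_add_eq_of_lt_left _ h3, add_comm]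
    congr 1; ring
  have hy0 : (y : M) ≠ 0 := by
    intro h
    have := key v0 hv0
    rw [h, map_zero] at this
    exact WithZero.exp_ne_zero this.symm
  refine ⟨Units.mk0 (y : M) hy0, fun v hvT => ?_, fun v => by
    rw [ord_nonneg_iff]; exact v.valuation_le_one _⟩
  have := val_eq v (Units.mk0 (y : M) hy0)
  rw [Units.val_mk0, key v hvT] at this
  have := WithZero.exp_injective this
  omega
theorem approx (T : Finset (S M)) (f : S M → ℤ) : ∃ x : Mˣ, ∀ v ∈ T, ord v x = f v := by
  obtain ⟨x, hx, -⟩ := approx_nn T fun v => (f v).toNat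
  obtain ⟨y, hy, -⟩ := approx_nn T fun v => (-f v).toNat
  refine ⟨x * y⁻¹, fun v hv => ?_⟩
  rw [ord_mul, ord_inv, hx v hv, hy v hv]
  exact Int.toNat_sub_toNat_neg (f v)
structure Qd (σ : N ≃ₐ[M] N) : Prop where
  inv : ∀ x, σ (σ x) = x
  all : ∀ τ : N ≃ₐ[M] N, τ = 1 ∨ τ = σ
  ne : σ ≠ 1
  deg : Module.finrank M N = 2
theorem Qd.mul_self {σ : N ≃ₐ[M] N} (q : Qd σ) : σ * σ = 1 := by
  ext x; exact q.inv x
theorem Qd.inv_eq {σ : N ≃ₐ[M] N} (q : Qd σ) : σ⁻¹ = σ := inv_eq_of_mul_eq_one_left q.mul_self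
theorem Qd.smul_smul {σ : N ≃ₐ[M] N} (q : Qd σ) {X : Type*} [MulAction (N ≃ₐ[M] N) X] (x : X) :
    σ • σ • x = x := by rw [← mul_smul, q.mul_self, one_smul]
theorem Qd.h90 {σ : N ≃ₐ[M] N} (q : Qd σ) : (nu (sg σ)).ker ≤ (di (sg σ)).range := by
  intro x hx
  have hx' : (x : N) * σ x = 1 := congrArg Units.val (show nu (sg σ) x = 1 from hx)
  have hz : ∃ z : N, z + x * σ z ≠ 0 := by
    by_contra! h
    have h1 := h 1
    rw [map_one, mul_one] at h1
    apply q.ne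
    ext z
    have h2 := h z
    have h3 : (x : N) = -1 := by linear_combination h1
    rw [h3] at h2
    change σ z = z
    linear_combination -h2
  obtain ⟨z, hz⟩ := hz
  have e : (x : N) * σ (z + x * σ z) = z + x * σ z := by
    rw [map_add, map_mul, q.inv]
    linear_combination z * hx'
  refine ⟨Units.mk0 _ hz, ?_⟩
  rw [di_apply, div_eq_iff_eq_mul]
  ext
  exact e.symm
theorem Qd.ram_dvd [IsGalois M N] {σ : N ≃ₐ[M] N} (q : Qd σ) (w : S N) :
    (ram M w : ℤ) ∣ 2 ∧ (σ • w ≠ w → ram M w = 1) := by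
  classical
  obtain ⟨π, hπ⟩ := approx {w, σ • w} (fun v => if v = w then 1 else 0)
  have h1 : ord w π = 1 := by rw [hπ w (by simp)]; simp
  have h2 : ord (σ • w) π = if σ • w = w then 1 else 0 := hπ _ (by simp)
  have hf : σ ((π * σ • π : Nˣ) : N) = (π * σ • π : Nˣ) := by
    change σ ((π : N) * σ (π : N)) = (π : N) * σ (π : N)
    rw [map_mul, q.inv, mul_comm]
  obtain ⟨y, hy⟩ := fixed_two σ q.all _ hf
  have hy0 : y ≠ 0 := by
    rintro rfl; rw [map_zero] at hy; exact Units.ne_zero _ hy.symm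
  have hyu : inc M N (Units.mk0 y hy0) = π * σ • π := Units.ext hy
  have h3 := ord_bel (M := M) w (Units.mk0 y hy0)
  rw [hyu, ord_mul, ord_smul', q.inv_eq, h1, h2] at h3
  constructor
  · split_ifs at h3
    · exact ⟨_, h3⟩
    · have h4 : (ram M w : ℤ) ∣ 1 := ⟨_, h3⟩
      exact h4.trans (by norm_num)
  · intro h
    rw [if_neg h] at h3
    have : (ram M w : ℤ) ∣ 1 := ⟨_, h3⟩
    exact_mod_cast Int.eq_one_of_dvd_one (by positivity) this
noncomputable def td (σ : N ≃ₐ[M] N) : Multiplicative (Dv N) →* Multiplicative (Dv N) :=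
  AddMonoidHom.toMultiplicative (DistribSMul.toAddMonoidHom (Dv N) σ)
theorem td_apply (σ : N ≃ₐ[M] N) (f : Multiplicative (Dv N)) : (td σ f).toAdd = σ • f.toAdd := rfl
noncomputable def xd (M N : Type*) [Field M] [NumberField M] [Field N] [NumberField N] [Algebra M N] :
    Multiplicative (Dv M) →* Multiplicative (Dv N) := AddMonoidHom.toMultiplicative (exd M N)
theorem Qd.hI {σ : N ≃ₐ[M] N} (_ : Qd σ) : (nu (td σ)).ker ≤ (di (td σ)).range := by
  intro f hf
  have hf' : f.toAdd + σ • f.toAdd = 0 := congrArg Multiplicative.toAdd (show nu (td σ) f = 1 from hf)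
  let g : Dv N := f.toAdd.mapRange (fun n => max n 0) (by simp)
  refine ⟨Multiplicative.ofAdd g, ?_⟩
  apply Multiplicative.toAdd.injective
  change g - σ • g = f.toAdd
  ext w
  have h1 := DFunLike.congr_fun hf' w
  rw [Finsupp.add_apply, dsmul_apply, Finsupp.zero_apply] at h1
  rw [Finsupp.sub_apply, dsmul_apply]
  change max (f.toAdd w) 0 - max (f.toAdd (σ⁻¹ • w)) 0 = f.toAdd w
  omega
theorem Qd.nu_le [IsGalois M N] {σ : N ≃ₐ[M] N} (q : Qd σ) : (nu (td σ)).range ≤ (xd M N).range := by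
  rintro _ ⟨f, rfl⟩
  obtain ⟨g, hg⟩ := mem_exd (M := M) (f.toAdd + σ • f.toAdd) (by
    intro τ
    rcases q.all τ with rfl | rfl
    · rw [one_smul]
    · rw [smul_add, q.smul_smul, add_comm]) (by
    intro w
    rw [Finsupp.add_apply, dsmul_apply, q.inv_eq]
    obtain ⟨h1, h2⟩ := q.ram_dvd w
    by_cases h : σ • w = w
    · rw [h, ← two_mul]; exact h1.mul_right _
    · rw [h2 h]; simp)
  exact ⟨Multiplicative.ofAdd g, Multiplicative.toAdd.injective hg⟩
theorem Qd.amb [IsGalois M N] [IsTotallyReal M] [IsTotallyReal N] {σ : N ≃ₐ[M] N} (q : Qd σ) :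
    2 * (nu (sg σ)).range.relIndex (fx (sg σ) ⊓ (nu (td σ)).range.comap dv) =
      (xd M N).range.relIndex (fx (td σ)) *
        ((nu (td σ)).range ⊔ (fx (sg σ)).map dv).relIndex (xd M N).range := by
  obtain ⟨hE, hE'⟩ := unit_idx q.deg σ q.inv q.all
  refine ambiguous (sg σ) (td σ) (fun x => q.smul_smul x) (fun x => ?_) dv ?_ q.h90 q.hI dv_index
    (xd M N).range q.nu_le ?_ ?_ _ hE hE'
  · apply Multiplicative.toAdd.injective
    rw [td_apply, td_apply, q.smul_smul]
  · intro x
    apply Multiplicative.toAdd.injective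
    rw [td_apply, sg_apply, dv_smul]
  · rintro _ ⟨x, hx, rfl⟩
    have hx' : σ (x : N) = x := congrArg Units.val ((mem_fx (sg σ) x).1 hx)
    obtain ⟨y, hy⟩ := fixed_two σ q.all _ hx'
    have hy0 : y ≠ 0 := by
      rintro rfl; rw [map_zero] at hy; exact Units.ne_zero _ hy.symm
    have hyu : inc M N (Units.mk0 y hy0) = x := Units.ext hy
    refine ⟨dv (Units.mk0 y hy0), ?_⟩
    rw [← hyu]
    exact Multiplicative.toAdd.injective (dv_inc _).symm
  · rintro _ ⟨f, rfl⟩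
    rw [mem_fx]
    exact Multiplicative.toAdd.injective (exd_smul σ f.toAdd)
theorem idx_le {G T : Type*} [CommGroup G] [Finite T] (A B : Subgroup G) (c : G → T)
    (h : ∀ y ∈ B, ∀ z ∈ B, c y = c z → y / z ∈ A) :
    A.relIndex B ≤ Nat.card T ∧ A.relIndex B ≠ 0 := by
  let g : (B ⧸ A.subgroupOf B) → T := fun x => c x.out
  have hg : Function.Injective g := by
    intro x y hxy
    have := h _ x.out.2 _ y.out.2 hxy
    rw [← QuotientGroup.out_eq' x, ← QuotientGroup.out_eq' y, eq_comm, QuotientGroup.eq,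
      Subgroup.mem_subgroupOf]
    rw [mul_comm]
    rwa [div_eq_mul_inv] at this
  have : Finite (B ⧸ A.subgroupOf B) := Finite.of_injective g hg
  exact ⟨Nat.card_le_card_of_injective g hg, Nat.card_pos.ne'⟩
theorem Qd.par [IsGalois M N] {σ : N ≃ₐ[M] N} (q : Qd σ) (T : Finset (S M))
    (hT : ∀ w : S N, bel M w ∉ T → ram M w = 1) :
    (xd M N).range.relIndex (fx (td σ)) ≤ 2 ^ T.card ∧ (xd M N).range.relIndex (fx (td σ)) ≠ 0 := by
  choose a ha using fun v : S M => exists_above (N := N) v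
  have := (idx_le (T := T → ZMod 2) (xd M N).range (fx (td σ)) (fun f v => ((f.toAdd (a v.1) : ℤ) : ZMod 2)) ?_)
  · refine ⟨this.1.trans (le_of_eq ?_), this.2⟩
    rw [Nat.card_fun]; simp
  intro f hf g hg hfg
  have inv : ∀ f ∈ fx (td σ), ∀ τ : N ≃ₐ[M] N, τ • f.toAdd = f.toAdd := by
    intro f hf τ
    rcases q.all τ with rfl | rfl
    · rw [one_smul]
    · exact congrArg Multiplicative.toAdd ((mem_fx _ _).1 hf)
  have hfg' := inv _ ((fx (td σ)).div_mem hf hg)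
  obtain ⟨k, hk⟩ := mem_exd (M := M) (f / g).toAdd hfg' (by
    intro w
    by_cases hw : bel M w ∈ T
    · refine (q.ram_dvd w).1.trans ?_
      obtain ⟨τ, hτ⟩ := bel_trans (M := M) (a (bel M w)) w (ha _)
      have h1 := DFunLike.congr_fun (hfg' τ) w
      rw [dsmul_apply, ← hτ, inv_smul_smul, hτ] at h1
      rw [← h1]
      have h2 := congrFun hfg ⟨_, hw⟩
      have h3 : (((f / g).toAdd (a (bel M w)) : ℤ) : ZMod 2) = 0 := by
        rw [toAdd_div, Finsupp.sub_apply, Int.cast_sub]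
        exact sub_eq_zero.2 h2
      exact_mod_cast (ZMod.intCast_zmod_eq_zero_iff_dvd _ 2).1 h3
    · rw [hT w hw]; simp)
  exact ⟨Multiplicative.ofAdd k, Multiplicative.toAdd.injective hk⟩
end
end NF
end
section
set_option linter.unusedSectionVars false
namespace NF
open NumberField Amb IsDedekindDomain
section
variable {M : Type*} [Field M] [NumberField M]
def sq (M : Type*) [Field M] : Subgroup Mˣ := (powMonoidHom 2).range
theorem mem_sq (x : Mˣ) : x ∈ sq M ↔ ∃ y, y ^ 2 = x := Iff.rfl
def VT (T : Set (S M)) : Subgroup Mˣ where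
  carrier := {x | ∀ v, v ∉ T → Even (ord v x)}
  one_mem' v _ := by rw [ord_one]; exact Even.zero
  mul_mem' hx hy v hv := by rw [ord_mul]; exact (hx v hv).add (hy v hv)
  inv_mem' hx v hv := by rw [ord_inv]; exact (hx v hv).neg
theorem mem_VT (T : Set (S M)) (x : Mˣ) : x ∈ VT T ↔ ∀ v, v ∉ T → Even (ord v x) := Iff.rfl
theorem sq_le_VT (T : Set (S M)) : sq M ≤ VT T := by
  rintro _ ⟨y, rfl⟩ v _
  rw [powMonoidHom_apply, ord_pow]; exact ⟨ord v y, by push_cast; ring⟩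
noncomputable def I2P (M : Type*) [Field M] [NumberField M] : Subgroup (Multiplicative (Dv M)) :=
  (dv (M := M)).range ⊔ (powMonoidHom 2).range
theorem card_V [IsTotallyReal M] : (sq M).relIndex (VT (∅ : Set (S M))) = 2 ^ Module.finrank ℚ M * (I2P M).index := by
  rw [split_idx dv _ _ (sq_le_VT _), mul_comm]
  congr 1
  · have e1 : VT (∅ : Set (S M)) ⊓ (dv (M := M)).ker = Subgroup.map (ui M) ⊤ := by
      rw [← MonoidHom.range_eq_map, show (ui M).range = (dv (M := M)).ker from dv_ker.symm, inf_eq_right]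
      intro x hx v _
      rw [← dv_apply, show dv x = 1 from hx]; simp
    have e2 : (sq M).relIndex (Subgroup.map (ui M) ⊤) = (((⊤ : Subgroup (𝓞 M)ˣ).map (powMonoidHom 2)).map (ui M)).relIndex (Subgroup.map (ui M) ⊤) := by
      rw [← Subgroup.inf_relIndex_right]
      congr 1
      ext x
      constructor
      · rintro ⟨⟨y, rfl⟩, ⟨z, -, hz⟩⟩
        have : y ∈ (dv (M := M)).ker := by
          have h1 : ui M z ∈ (dv (M := M)).ker := by rw [dv_ker]; exact ⟨z, rfl⟩
          rw [hz] at h1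
          rw [powMonoidHom_apply, MonoidHom.mem_ker] at h1
          apply Multiplicative.toAdd.injective
          ext v
          have h2 := DFunLike.congr_fun (congrArg Multiplicative.toAdd h1) v
          rw [dv_apply, ord_pow] at h2
          rw [dv_apply]
          rw [toAdd_one, Finsupp.zero_apply] at h2 ⊢
          push_cast at h2; omega
        rw [dv_ker] at this
        obtain ⟨u, rfl⟩ := this
        exact ⟨u ^ 2, ⟨u, trivial, rfl⟩, map_pow _ _ _⟩
      · rintro ⟨_, ⟨u, -, rfl⟩, rfl⟩
        exact ⟨⟨ui M u, (map_pow (ui M) u 2).symm⟩, ⟨_, trivial, rfl⟩⟩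
    rw [e1, e2, Subgroup.relIndex_map_map_of_injective _ _ ui_inj, sq_idx, two_tor _ (Subgroup.mem_top _), ← pow_succ]
    congr 1
    rw [← tr_rank (N := M), ← Units.finrank_eq]
    exact congrArg (· + 1) ((Subgroup.topEquiv (G := (𝓞 M)ˣ)).toAdditive.toIntLinearEquiv.finrank_eq)
  · have h := card_coinv (invMonoidHom : Multiplicative (Dv M) →* Multiplicative (Dv M)) (dv (M := M)).range dv_index
      (by intro x hx; exact inv_mem hx)
    have e : di (invMonoidHom : Multiplicative (Dv M) →* Multiplicative (Dv M)) = powMonoidHom 2 := by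
      ext x; simp [di_apply, pow_two]
    rw [e] at h
    rw [I2P, h]
    have hinj : Function.Injective (powMonoidHom 2 : Multiplicative (Dv M) →* Multiplicative (Dv M)) := by
      intro x y hxy
      apply Multiplicative.toAdd.injective
      ext v
      have h2 : 2 • x.toAdd = 2 • y.toAdd := hxy
      have := DFunLike.congr_fun h2 v
      simpa using this
    rw [← Subgroup.relIndex_map_map_of_injective (dv (M := M)).range _ hinj]
    congr 1
    · rw [sq, ← MonoidHom.range_comp, ← MonoidHom.range_comp]
      congr 1
      refine MonoidHom.ext fun x => ?_
      rw [MonoidHom.comp_apply, MonoidHom.comp_apply, powMonoidHom_apply, powMonoidHom_apply, map_pow]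
    · ext f
      constructor
      · rintro ⟨x, hx, rfl⟩
        choose g hg using fun v => hx v (by simp)
        have hfin : (Function.support g).Finite := by
          refine (ord_finite x).subset fun v hv h0 => hv ?_
          have := hg v; simp only at h0; omega
        have : powMonoidHom 2 (Multiplicative.ofAdd (Finsupp.ofSupportFinite g hfin)) = dv x := by
          apply Multiplicative.toAdd.injective
          ext v
          rw [dv_apply, hg v]
          change (2 • Finsupp.ofSupportFinite g hfin) v = _
          rw [two_smul]; rfl
        exact ⟨_, ⟨x, this.symm⟩, this⟩
      · rintro ⟨g, ⟨x, hx⟩, rfl⟩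
        refine ⟨x, fun v _ => ?_, hx⟩
        rw [← dv_apply, hx]
        exact ⟨g.toAdd v, by change (2 • g.toAdd) v = _; rw [two_smul]; rfl⟩
def TP (M : Type*) [Field M] : Subgroup Mˣ where
  carrier := {x | ∀ φ : M →+* ℝ, 0 < φ x}
  one_mem' φ := by simp
  mul_mem' hx hy φ := by simpa using mul_pos (hx φ) (hy φ)
  inv_mem' hx φ := by simpa using hx φ
theorem sq_le_TP : sq M ≤ TP M := by
  rintro _ ⟨y, rfl⟩ φ
  change 0 < φ ((y ^ 2 : Mˣ) : M)
  rw [Units.val_pow_eq_pow_val, map_pow]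
  have : φ y ≠ 0 := by simp
  positivity
theorem TP_idx (H : Subgroup Mˣ) : (TP M).relIndex H ≤ 2 ^ Module.finrank ℚ M ∧ (TP M).relIndex H ≠ 0 := by
  have hinj : Function.Injective fun φ : M →+* ℝ => Complex.ofRealHom.comp φ := by
    intro a b h; ext x
    exact Complex.ofReal_injective (RingHom.congr_fun h x)
  have : Finite (M →+* ℝ) := Finite.of_injective _ hinj
  obtain ⟨h1, h2⟩ := idx_le (T := (M →+* ℝ) → Prop) (TP M) H (fun x φ => 0 < φ x) (by
    intro y _ z _ h φ
    have h3 : (0 < φ y) = (0 < φ z) := congrFun h φ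
    rw [Units.val_div_eq_div_val, map_div₀]
    have hy : φ y ≠ 0 := by simp
    have hz : φ z ≠ 0 := by simp
    rcases lt_or_gt_of_ne hy with h | h
    · refine div_pos_of_neg_of_neg h (lt_of_le_of_ne ?_ hz)
      rw [← not_lt, ← h3]; exact h.not_gt
    · exact div_pos h (h3 ▸ h))
  refine ⟨h1.trans ?_, h2⟩
  rw [Nat.card_fun, Nat.card_eq_fintype_card (α := Prop), Fintype.card_prop]
  refine Nat.pow_le_pow_right (by norm_num) ?_
  refine (Nat.card_le_card_of_injective _ hinj).trans (le_of_eq ?_)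
  rw [Nat.card_eq_fintype_card, NumberField.Embeddings.card]
def Loc (P : Submonoid M) : Subgroup Mˣ where
  carrier := {y | ∃ s : Mˣ, (y : M) * s ^ 2 ∈ P}
  one_mem' := ⟨1, by simp⟩
  mul_mem' := by
    rintro a b ⟨s, hs⟩ ⟨t, ht⟩
    refine ⟨s * t, ?_⟩
    convert P.mul_mem hs ht using 1
    push_cast; ring
  inv_mem' := by
    rintro a ⟨s, hs⟩
    refine ⟨a * s, ?_⟩
    convert hs using 1
    have := a.ne_zero
    push_cast; field_simp
theorem sq_le_Loc (P : Submonoid M) : sq M ≤ Loc P := by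
  rintro _ ⟨y, rfl⟩
  refine ⟨y⁻¹, ?_⟩
  convert P.one_mem
  simp
theorem div_mem_of_mul {A : Subgroup Mˣ} (h : sq M ≤ A) {y z : Mˣ} (hyz : y * z ∈ A) : y / z ∈ A := by
  have : y / z = y * z * (z⁻¹) ^ 2 := by rw [div_eq_mul_inv, pow_two, mul_assoc]; simp
  rw [this]
  exact A.mul_mem hyz (h ⟨_, rfl⟩)
def P4 (M : Type*) [Field M] : Submonoid M where
  carrier := {x | ∃ c : 𝓞 M, x = 1 + 4 * c}
  one_mem' := ⟨0, by simp⟩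
  mul_mem' := by
    rintro _ _ ⟨c, rfl⟩ ⟨d, rfl⟩
    exact ⟨c + d + (c * d + c * d + (c * d + c * d)), by push_cast; ring⟩
def P1 (w : S M) : Submonoid M where
  carrier := {x | w.valuation M (x - 1) < 1}
  one_mem' := by simp
  mul_mem' := by
    intro a b ha hb
    have hb1 : w.valuation M b ≤ 1 := by
      have : b = (b - 1) + 1 := by ring
      rw [this]
      exact (Valuation.map_add _ _ _).trans (max_le (le_of_lt hb) (by simp))
    have : a * b - 1 = (a - 1) * b + (b - 1) := by ring
    change w.valuation M (a * b - 1) < 1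
    rw [this]
    refine Valuation.map_add_lt _ ?_ hb
    rw [map_mul]
    exact lt_of_le_of_lt (mul_le_of_le_one_right' hb1) ha
theorem scale (w : S M) (y : Mˣ) (h : Even (ord w y)) : ∃ s : Mˣ, ord w (y * s ^ 2) = 0 := by
  obtain ⟨k, hk⟩ := h
  obtain ⟨s, hs⟩ := approx {w} fun _ => -k
  refine ⟨s, ?_⟩
  rw [ord_mul, ord_pow, hs w (by simp), hk]; push_cast; ring
theorem near (w : S M) (y : M) (h : w.valuation M y ≤ 1) : ∃ a : 𝓞 M, w.valuation M (y - a) < 1 := by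
  obtain ⟨a, ha⟩ := w.exists_valuation_sub_lt_of_integer h 1
  exact ⟨a, by rw [Valuation.map_sub_swap]; exact ha⟩
theorem lt_iff (w : S M) (a : 𝓞 M) : w.valuation M (a : M) < 1 ↔ Ideal.Quotient.mk w.asIdeal a = 0 := by
  rw [Ideal.Quotient.eq_zero_iff_mem]
  exact HeightOneSpectrum.valuation_lt_one_iff_mem w a
noncomputable instance (w : S M) : Field (𝓞 M ⧸ w.asIdeal) :=
  haveI := w.isMaximal
  Ideal.Quotient.field _
instance (w : S M) : Finite (𝓞 M ⧸ w.asIdeal) := Ideal.finiteQuotientOfFreeOfNeBot _ w.ne_bot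
theorem loc_of_sq (w : S M) (y : Mˣ) (a : 𝓞 M) (hy : w.valuation M (y : M) = 1)
    (ha : w.valuation M ((y : M) - a) < 1) (hs : IsSquare (Ideal.Quotient.mk w.asIdeal a)) : y ∈ Loc (P1 w) := by
  obtain ⟨b, hb⟩ := hs
  obtain ⟨b, rfl⟩ := Ideal.Quotient.mk_surjective b
  have h1 : w.valuation M ((a : M) - b * b) < 1 := by
    have := (lt_iff w (a - b * b)).2 (by rw [map_sub, map_mul, hb, sub_self])
    simpa using this
  have h2 : w.valuation M ((y : M) - b * b) < 1 := by
    have : (y : M) - b * b = (y - a) + (a - b * b) := by ring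
    rw [this]; exact Valuation.map_add_lt _ ha h1
  have h3 : w.valuation M ((b : M) * b) = 1 := by
    rw [← hy]
    have : (b : M) * b = y + -(y - b * b) := by ring
    rw [this, Valuation.map_add_eq_of_lt_left]
    rw [Valuation.map_neg, hy]; exact h2
  have h4 : (b : M) ≠ 0 := by intro h; rw [h] at h3; simp at h3
  refine ⟨(Units.mk0 _ h4)⁻¹, ?_⟩
  have : (y : M) * (((Units.mk0 (b : M) h4)⁻¹ : Mˣ) : M) ^ 2 - 1 = (y - b * b) * ((b : M) * b)⁻¹ := by
    simp only [Units.val_inv_eq_inv_val, Units.val_mk0]; field_simp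
  change w.valuation M _ < 1
  rw [this, map_mul, map_inv₀, h3, inv_one, mul_one]
  exact h2
theorem sq_ff {k : Type*} [Field k] [Finite k] (a b : k) (ha : ¬ IsSquare a) (hb : ¬ IsSquare b) : IsSquare (a * b) := by
  classical
  have := Fintype.ofFinite k
  by_cases h2 : ringChar k = 2
  · exact FiniteField.isSquare_of_char_two h2 _
  have ha0 : a ≠ 0 := by rintro rfl; exact ha (by simp)
  have hb0 : b ≠ 0 := by rintro rfl; exact hb (by simp)
  rw [← quadraticChar_one_iff_isSquare (mul_ne_zero ha0 hb0), map_mul,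
    quadraticChar_neg_one_iff_not_isSquare.2 ha, quadraticChar_neg_one_iff_not_isSquare.2 hb]
  norm_num
theorem loc_mul (w : S M) (y z : Mˣ) (hy : Even (ord w y)) (hz : Even (ord w z)) (hy' : y ∉ Loc (P1 w))
    (hz' : z ∉ Loc (P1 w)) : y * z ∈ Loc (P1 w) := by
  have red : ∀ y s : Mˣ, y * s ^ 2 ∈ Loc (P1 w) ↔ y ∈ Loc (P1 w) := fun y s =>
    Subgroup.mul_mem_cancel_right _ (sq_le_Loc _ ⟨s, rfl⟩)
  obtain ⟨s, hs⟩ := scale w y hy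
  obtain ⟨t, ht⟩ := scale w z hz
  rw [← red y s] at hy'
  rw [← red z t] at hz'
  rw [← red (y * z) (s * t), show y * z * (s * t) ^ 2 = (y * s ^ 2) * (z * t ^ 2) by rw [mul_pow, mul_mul_mul_comm]]
  generalize y * s ^ 2 = y at *
  generalize z * t ^ 2 = z at *
  rw [ord_eq_zero_iff] at hs ht
  obtain ⟨a, ha⟩ := near w y hs.le
  obtain ⟨b, hb⟩ := near w z ht.le
  have ha' := fun h => hy' (loc_of_sq w y a hs ha h)
  have hb' := fun h => hz' (loc_of_sq w z b ht hb h)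
  refine loc_of_sq w _ (a * b) (by rw [Units.val_mul, map_mul, hs, ht, one_mul]) ?_ (by rw [map_mul]; exact sq_ff _ _ ha' hb')
  have : ((y * z : Mˣ) : M) - ((a * b : 𝓞 M) : M) = y * (z - b) + (y - a) * b := by push_cast; ring
  rw [this]
  refine Valuation.map_add_lt _ ?_ ?_
  · rw [map_mul, hs, one_mul]; exact hb
  · rw [map_mul]; exact lt_of_le_of_lt (mul_le_of_le_one_right' (HeightOneSpectrum.valuation_le_one w b)) ha
theorem loc_idx (w : S M) (H : Subgroup Mˣ) (hH : ∀ y ∈ H, Even (ord w y)) :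
    (Loc (P1 w)).relIndex H ≤ 2 ∧ (Loc (P1 w)).relIndex H ≠ 0 := by
  have := idx_le (T := Prop) (Loc (P1 w)) H (fun y => y ∈ Loc (P1 w)) (by
    intro y hy z hz h
    simp only [eq_iff_iff] at h
    apply div_mem_of_mul (sq_le_Loc _)
    by_cases h1 : y ∈ Loc (P1 w)
    · exact mul_mem h1 (h.1 h1)
    · exact loc_mul w y z (hH y hy) (hH z hz) h1 (fun h2 => h1 (h.2 h2)))
  rwa [Nat.card_eq_fintype_card (α := Prop), Fintype.card_prop] at this
end
end NF
end
section
set_option linter.unusedSectionVars false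
namespace NF
open NumberField Amb IsDedekindDomain
section
variable {M N : Type*} [Field M] [NumberField M] [Field N] [NumberField N] [Algebra M N]
def tw (M : Type*) [Field M] [NumberField M] : Mˣ := Units.mk0 2 two_ne_zero
theorem tw_val : ((tw M : Mˣ) : M) = ((2 : 𝓞 M) : M) := rfl
def SqF2 (M : Type*) [Field M] [NumberField M] : Prop := ∀ v : S M, ord v (tw M) ≤ 1
def odd (M : Type*) [Field M] [NumberField M] : Set (S M) := {v | ord v (tw M) = 0}
theorem card_two : Nat.card (𝓞 M ⧸ Ideal.span {(2 : 𝓞 M)}) = 2 ^ Module.finrank ℚ M := by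
  have h : Ideal.absNorm (Ideal.span {(2 : 𝓞 M)}) = 2 ^ Module.finrank ℚ M := by
    rw [Ideal.absNorm_span_singleton, show (2 : 𝓞 M) = algebraMap ℤ (𝓞 M) 2 by simp, Algebra.norm_algebraMap,
      RingOfIntegers.rank]
    simp
  rw [← h, Ideal.absNorm_apply]; rfl
theorem ord_tw_nonneg (v : S M) : 0 ≤ ord v (tw M) := by
  rw [ord_nonneg_iff, tw_val]; exact v.valuation_le_one _
theorem exists_even : ∃ v : S M, 0 < ord v (tw M) := by
  have h : Ideal.span {(2 : 𝓞 M)} ≠ ⊤ := by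
    intro h
    have := card_two (M := M)
    rw [h] at this
    have h2 : Nat.card (𝓞 M ⧸ (⊤ : Ideal (𝓞 M))) = 1 := by
      rw [Nat.card_eq_one_iff_unique]; exact ⟨inferInstance, ⟨0⟩⟩
    rw [h2] at this
    exact absurd this (Nat.one_lt_two_pow Module.finrank_pos.ne').ne
  obtain ⟨P, hP, hle⟩ := Ideal.exists_le_maximal _ h
  have hm : (2 : 𝓞 M) ∈ P := hle (Ideal.mem_span_singleton_self _)
  refine ⟨⟨P, hP.isPrime, fun h => ?_⟩, ?_⟩
  · rw [h] at hm; exact two_ne_zero ((Submodule.mem_bot _).1 hm)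
  · rw [ord_pos_iff, tw_val]
    exact (HeightOneSpectrum.valuation_lt_one_iff_mem _ _).2 hm
theorem even_finite : {v : S M | 0 < ord v (tw M)}.Finite :=
  (ord_finite (tw M)).subset fun _ hv => ne_of_gt hv
theorem ff_two (v : S M) (hv : 0 < ord v (tw M)) (a : 𝓞 M ⧸ v.asIdeal) (ha : a ≠ 0) :
    ∃ r, r * r * a = 1 := by
  have h2 : ringChar (𝓞 M ⧸ v.asIdeal) = 2 := by
    apply @ringChar.eq _ _ _ ?_
    refine CharTwo.of_one_ne_zero_of_two_eq_zero one_ne_zero ?_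
    rw [ord_pos_iff, tw_val, lt_iff] at hv
    rw [← hv, map_ofNat]
  obtain ⟨r, hr⟩ := FiniteField.isSquare_of_char_two h2 a⁻¹
  exact ⟨r, by rw [← hr, inv_mul_cancel₀ ha]⟩
theorem two_red (h2 : SqF2 M) (y : Mˣ) (hy : y ∈ VT (odd M)) :
    ∃ (s : Mˣ) (u : 𝓞 M), ((y * s ^ 2 : Mˣ) : M) = 1 + 2 * u := by
  classical
  obtain ⟨s, hs⟩ := approx (even_finite (M := M)).toFinset (fun v => -(ord v y / 2))
  have hs' : ∀ v : S M, 0 < ord v (tw M) → ord v (y * s ^ 2) = 0 := by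
    intro v hv
    have h1 : Even (ord v y) := hy v (fun h => by have h' : ord v (tw M) = 0 := h; omega)
    obtain ⟨k, hk⟩ := h1
    rw [ord_mul, ord_pow, hs v (by simpa using hv), hk]; push_cast; omega
  suffices H : ∃ (r : Mˣ) (u : 𝓞 M), ((y * s ^ 2 * r ^ 2 : Mˣ) : M) = 1 + 2 * u by
    obtain ⟨r, u, h⟩ := H
    exact ⟨s * r, u, by rw [← h, mul_pow, mul_assoc]⟩
  generalize y * s ^ 2 = y at *
  have hr : ∀ v : S M, ∃ r : 𝓞 M, 0 < ord v (tw M) → v.valuation M ((r * r * y : M) - 1) < 1 := by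
    intro v
    by_cases hv : 0 < ord v (tw M)
    swap
    · exact ⟨0, fun h => absurd h hv⟩
    have h1 := (ord_eq_zero_iff v y).1 (hs' v hv)
    obtain ⟨a, ha⟩ := near v y h1.le
    have ha0 : Ideal.Quotient.mk v.asIdeal a ≠ 0 := by
      intro h0
      rw [← lt_iff] at h0
      have : (y : M) = (y - a) + a := by ring
      have h3 := Valuation.map_add_lt _ ha h0
      rw [← this, h1] at h3
      exact lt_irrefl _ h3
    obtain ⟨r, hr⟩ := ff_two v hv _ ha0
    obtain ⟨r, rfl⟩ := Ideal.Quotient.mk_surjective r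
    refine ⟨r, fun _ => ?_⟩
    have h4 := (lt_iff v (r * r * a - 1)).2 (by rw [map_sub, map_mul, map_mul, hr, map_one, sub_self])
    have : (r * r * y : M) - 1 = (r * r) * (y - a) + ((r * r * a - 1 : 𝓞 M) : M) := by push_cast; ring
    rw [this]
    refine Valuation.map_add_lt _ ?_ h4
    rw [map_mul]
    refine lt_of_le_of_lt (mul_le_of_le_one_left' ?_) ha
    have := v.valuation_le_one (K := M) (r * r)
    simpa using this
  choose r hr using hr
  obtain ⟨z, hz⟩ := IsDedekindDomain.exists_forall_sub_mem_ideal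
    (s := (even_finite (M := M)).toFinset ∪ (ord_finite y).toFinset) (fun v => v.asIdeal)
    (fun v => if 0 < ord v (tw M) then 1 else (-ord v y).toNat) (fun v _ => v.prime)
    (fun v _ w _ h h' => h (HeightOneSpectrum.ext h'))
    (fun v => if 0 < ord v.1 (tw M) then r v.1 else 0)
  have hE : ∀ v : S M, 0 < ord v (tw M) → v.valuation M ((z * z * y : M) - 1) < 1 := by
    intro v hv
    have h1 := hz v (by simp [hv])
    simp only [hv, if_true, pow_one] at h1
    rw [← HeightOneSpectrum.valuation_lt_one_iff_mem (K := M)] at h1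
    have h5 : (algebraMap (𝓞 M) M) (z - r v) = (z : M) - r v := by rw [map_sub]
    replace h1 : v.valuation M (algebraMap (𝓞 M) M (z - r v)) < 1 := h1
    rw [h5] at h1
    have : (z * z * y : M) - 1 = (z - r v) * ((z + r v : 𝓞 M) : M) * y + (r v * r v * y - 1) := by push_cast; ring
    rw [this]
    refine Valuation.map_add_lt _ ?_ (hr v hv)
    rw [map_mul, map_mul, (ord_eq_zero_iff v y).1 (hs' v hv), mul_one]
    exact lt_of_le_of_lt (mul_le_of_le_one_right' (v.valuation_le_one _)) h1
  have hO : ∀ v : S M, v.valuation M (z * z * y : M) ≤ 1 := by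
    intro v
    by_cases hv : 0 < ord v (tw M)
    · have h1 := (ord_eq_zero_iff v y).1 (hs' v hv)
      have := v.valuation_le_one (K := M) (z * z)
      rw [map_mul, h1, mul_one]; simpa using this
    by_cases hy0 : 0 ≤ ord v y
    · have h1 := (ord_nonneg_iff v y).1 hy0
      have := v.valuation_le_one (K := M) (z * z)
      rw [map_mul]
      exact mul_le_one' (by simpa using this) h1
    have h1 := hz v (by simp; right; omega)
    simp only [hv, if_false, sub_zero] at h1
    have h2 := (v.intValuation_le_pow_iff_mem _ _).2 h1
    rw [← HeightOneSpectrum.valuation_of_algebraMap (K := M)] at h2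
    have h3 : v.valuation M (z : M) ≤ WithZero.exp (ord v y) := by
      refine h2.trans (WithZero.exp_le_exp.2 ?_)
      omega
    rw [mul_assoc, map_mul, map_mul, val_eq]
    calc v.valuation M (z : M) * (v.valuation M (z : M) * WithZero.exp (-ord v y)) ≤ 1 * (WithZero.exp (ord v y) * WithZero.exp (-ord v y)) := by
          gcongr
          exact v.valuation_le_one _
      _ = 1 := by rw [one_mul, ← WithZero.exp_add]; simp
  have hz0 : (z : M) ≠ 0 := by
    intro h
    obtain ⟨v, hv⟩ := exists_even (M := M)
    have := hE v hv
    rw [h] at this; simp at this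
  have hint : ∃ u : 𝓞 M, (u : M) = ((z * z * y : M) - 1) / 2 := by
    apply int_of
    intro v
    by_cases ht : (z * z * y : M) - 1 = 0
    · rw [ht]; simp
    have h1 : ((Units.mk0 _ ht / tw M : Mˣ) : M) = ((z * z * y : M) - 1) / 2 := by
      rw [Units.val_div_eq_div_val]; rfl
    rw [← h1, ← ord_nonneg_iff, div_eq_mul_inv, ord_mul, ord_inv]
    have h3 := ord_tw_nonneg v
    by_cases hv : 0 < ord v (tw M)
    · have h4 := (ord_pos_iff v (Units.mk0 _ ht)).2 (hE v hv)
      have := h2 v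
      omega
    · have h4 : 0 ≤ ord v (Units.mk0 _ ht) := by
        rw [ord_nonneg_iff, Units.val_mk0]
        exact (Valuation.map_sub _ _ _).trans (max_le (hO v) (by simp))
      omega
  obtain ⟨u, hu⟩ := hint
  refine ⟨Units.mk0 _ hz0, u, ?_⟩
  rw [hu]; push_cast; rw [Units.val_mk0]; ring
theorem P4_idx (h2 : SqF2 M) (H : Subgroup Mˣ) (hH : H ≤ VT (odd M)) :
    (Loc (P4 M)).relIndex H ≤ 2 ^ Module.finrank ℚ M ∧ (Loc (P4 M)).relIndex H ≠ 0 := by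
  classical
  have hex : ∀ y : Mˣ, ∃ (u : 𝓞 M), y ∈ VT (odd M) → ∃ s : Mˣ, ((y * s ^ 2 : Mˣ) : M) = 1 + 2 * u := by
    intro y
    by_cases h : y ∈ VT (odd M)
    · obtain ⟨s, u, hu⟩ := two_red h2 y h
      exact ⟨u, fun _ => ⟨s, hu⟩⟩
    · exact ⟨0, fun h' => absurd h' h⟩
  choose u hu using hex
  have : Finite (𝓞 M ⧸ Ideal.span {(2 : 𝓞 M)}) :=
    Ideal.finiteQuotientOfFreeOfNeBot _ (by simp)
  have := idx_le (T := 𝓞 M ⧸ Ideal.span {(2 : 𝓞 M)}) (Loc (P4 M)) H (fun y => Ideal.Quotient.mk _ (u y)) (by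
    intro y hy z hz h
    apply div_mem_of_mul (sq_le_Loc _)
    obtain ⟨s, hs⟩ := hu y (hH hy)
    obtain ⟨t, ht⟩ := hu z (hH hz)
    rw [Ideal.Quotient.eq, Ideal.mem_span_singleton] at h
    obtain ⟨c, hc⟩ := h
    have hc' : (u y : M) = u z + 2 * c := by
      have : u y = u z + 2 * c := by rw [← hc]; ring
      rw [this]; push_cast; rfl
    refine ⟨s * t, u z + c + u z * u z + (u z * c + u z * c), ?_⟩
    have e : ((y * z : Mˣ) : M) * ((s * t : Mˣ) : M) ^ 2 = ((y * s ^ 2 : Mˣ) : M) * ((z * t ^ 2 : Mˣ) : M) := by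
      push_cast; ring
    rw [e, hs, ht, hc']
    push_cast; ring)
  rwa [card_two] at this
theorem SqF2.up (h2 : SqF2 M) (hu : Unr M N) : SqF2 N := by
  intro w
  have h := ord_bel (M := M) w (tw M)
  have e : inc M N (tw M) = tw N := by
    ext; simp [inc, tw]; exact map_ofNat _ 2
  rw [e, ram_one (M := M) hu w] at h
  rw [h]
  have := h2 (bel M w)
  push_cast; omega
end
end NF
end
section
set_option linter.unusedSectionVars false
namespace NF
open NumberField Amb IsDedekindDomain Polynomial
section
variable {M N : Type*} [Field M] [NumberField M] [Field N] [NumberField N] [Algebra M N]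
theorem Qd.gal {σ : N ≃ₐ[M] N} (q : Qd σ) : IsGalois M N := by
  have : FiniteDimensional M N := FiniteDimensional.of_finrank_pos (by rw [q.deg]; norm_num)
  refine IsGalois.of_card_aut_eq_finrank _ _ ?_
  rw [q.deg]
  have e : (Set.univ : Set (N ≃ₐ[M] N)) = {1, σ} := by
    ext τ; simpa using q.all τ
  have := Set.ncard_univ (N ≃ₐ[M] N)
  rw [e, Set.ncard_pair q.ne.symm] at this
  exact this.symm
structure Qe (σ : N ≃ₐ[M] N) (x : Mˣ) (η : N) : Prop where
  q : Qd σ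
  sq : η ^ 2 = algebraMap M N x
  neg : σ η = -η
variable {σ : N ≃ₐ[M] N} {x : Mˣ} {η : N}
theorem Qe.ne_zero (e : Qe σ x η) : η ≠ 0 := by
  rintro rfl
  have := e.sq
  rw [zero_pow two_ne_zero] at this
  exact x.ne_zero ((map_eq_zero _).1 this.symm)
theorem Qe.decomp (e : Qe σ x η) (β : N) : ∃ a b : M, β = algebraMap M N a + algebraMap M N b * η := by
  have := e.q.gal
  have h0 := e.ne_zero
  obtain ⟨a, ha⟩ := fixed_two σ e.q.all ((β + σ β) / 2) (by
    rw [map_div₀, map_add, e.q.inv, map_ofNat, add_comm])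
  obtain ⟨b, hb⟩ := fixed_two σ e.q.all ((β - σ β) / (2 * η)) (by
    rw [map_div₀, map_sub, e.q.inv, map_mul, map_ofNat, e.neg]; field_simp; ring)
  refine ⟨a, b, ?_⟩
  rw [ha, hb]; field_simp; ring
theorem Qd.exists_eta (q : Qd σ) : ∃ (x : Mˣ) (η : N), Qe σ x η ∧ x ∉ NF.sq M := by
  have := q.gal
  obtain ⟨y, hy⟩ : ∃ y, σ y ≠ y := by
    by_contra! h
    exact q.ne (AlgEquiv.ext h)
  have hn : σ (y - σ y) = -(y - σ y) := by rw [map_sub, q.inv]; ring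
  obtain ⟨x, hx⟩ := fixed_two σ q.all ((y - σ y) ^ 2) (by rw [map_pow, hn, neg_sq])
  have h0 : y - σ y ≠ 0 := sub_ne_zero.2 hy.symm
  have hx0 : x ≠ 0 := by
    rintro rfl
    rw [map_zero] at hx
    exact h0 (pow_eq_zero_iff two_ne_zero |>.1 hx.symm)
  refine ⟨Units.mk0 x hx0, y - σ y, ⟨q, hx.symm, hn⟩, ?_⟩
  rintro ⟨z, hz⟩
  have hz' : (z : M) ^ 2 = x := by
    rw [powMonoidHom_apply] at hz
    have := congrArg Units.val hz
    simpa using this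
  have h2 : (y - σ y) ^ 2 = (algebraMap M N z) ^ 2 := by rw [← map_pow, hz', hx]
  have h3 : σ (y - σ y) = y - σ y := by
    rcases sq_eq_sq_iff_eq_or_eq_neg.1 h2 with h | h <;> rw [h] <;> simp
  rw [hn] at h3
  exact h0 (self_eq_neg.1 h3.symm)
theorem Qd.diff_mem (q : Qd σ) (θ : 𝓞 N) (a b : 𝓞 M)
    (h : θ ^ 2 - algebraMap (𝓞 M) (𝓞 N) a * θ + algebraMap (𝓞 M) (𝓞 N) b = 0) (hθ : σ (θ : N) ≠ θ) :
    2 * θ - algebraMap (𝓞 M) (𝓞 N) a ∈ differentIdeal (𝓞 M) (𝓞 N) := by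
  have hP : (X ^ 2 - C a * X + C b : (𝓞 M)[X]) = minpoly (𝓞 M) θ := by
    have hd : (X ^ 2 - C a * X + C b : (𝓞 M)[X]).degree = 2 := by compute_degree!
    apply IsIntegrallyClosed.minpoly.unique
    · monicity!
    · simpa using h
    · intro Q hQ hQ0
      rw [hd]
      by_contra hlt
      rw [not_le] at hlt
      have h1 : Q.degree ≤ 1 := Order.le_of_lt_succ hlt
      have h2 := eq_X_add_C_of_degree_le_one h1
      by_cases h3 : Q.coeff 1 = 0
      · rw [h3] at h2
        simp only [map_zero, zero_mul, zero_add] at h2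
        rw [h2] at hQ hQ0
        have h4 : Q.coeff 0 = 1 := by simpa [Monic] using hQ
        rw [h4] at hQ0
        simp at hQ0
      · have h4 : Q.natDegree = 1 := by
          have h1' : Q.natDegree ≤ 1 := natDegree_le_of_degree_le h1
          have := le_natDegree_of_ne_zero h3
          omega
        have h5 : Q.coeff 1 = 1 := by rw [← h4]; exact hQ
        rw [h5] at h2
        rw [h2] at hQ0
        simp only [map_one, one_mul, map_add, aeval_X, aeval_C] at hQ0
        have h6 : (θ : N) = algebraMap M N (-(Q.coeff 0 : M)) := by
          have := congrArg (fun t : 𝓞 N => (t : N)) (eq_neg_of_add_eq_zero_left hQ0)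
          rw [map_neg]
          exact this
        apply hθ
        rw [h6, σ.commutes]
  have hadj : Algebra.adjoin M {algebraMap (𝓞 N) N θ} = ⊤ := by
    have := Subalgebra.isSimpleOrder_of_finrank q.deg
    refine (eq_bot_or_eq_top _).resolve_left fun hb => hθ ?_
    have hm : algebraMap (𝓞 N) N θ ∈ Algebra.adjoin M {algebraMap (𝓞 N) N θ} := Algebra.subset_adjoin rfl
    rw [hb] at hm
    obtain ⟨y, hy⟩ := Algebra.mem_bot.1 hm
    change algebraMap M N y = (θ : N) at hy
    rw [← hy, σ.commutes]
  have := aeval_derivative_mem_differentIdeal (𝓞 M) M N θ hadj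
  rw [← hP] at this
  have e2 : (2 : 𝓞 N) = 1 + 1 := one_add_one_eq_two.symm
  rw [e2]
  simpa using this
theorem mem_w_iff (w : S N) (a : 𝓞 M) : algebraMap (𝓞 M) (𝓞 N) a ∈ w.asIdeal ↔ a ∈ (bel M w).asIdeal := Iff.rfl
theorem notMem_of_ord (v : S M) (x : Mˣ) (a : 𝓞 M) (h : (x : M) = a) (ho : ord v x = 0) : a ∉ v.asIdeal := by
  rw [ord_eq_zero_iff, h] at ho
  exact (HeightOneSpectrum.valuation_eq_one_iff_notMem v).1 ho
theorem Qe.diff_away (e : Qe σ x η) (T : Set (S M)) (hT : x ∈ VT T) (h4 : x ∈ Loc (P4 M)) (w : S N)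
    (hw : bel M w ∉ T) : ¬ differentIdeal (𝓞 M) (𝓞 N) ≤ w.asIdeal := by
  classical
  have := e.q.gal
  intro hle
  have hη := e.ne_zero
  by_cases hv : ord (bel M w) (tw M) = 0
  · obtain ⟨s, hs⟩ := scale _ _ (hT _ hw)
    obtain ⟨m, hm, hm0⟩ := approx_nn ((ord_finite (x * s ^ 2)).toFinset ∪ {bel M w})
      (fun v => (-ord v (x * s ^ 2)).toNat)
    have hint : ∃ a : 𝓞 M, (a : M) = ((x * (s * m) ^ 2 : Mˣ) : M) := by
      apply int_of
      intro v
      rw [← ord_nonneg_iff, mul_pow, ← mul_assoc, ord_mul, ord_pow]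
      have := hm0 v
      by_cases h0 : ord v (x * s ^ 2) = 0
      · rw [h0]; push_cast; omega
      · rw [hm v (by simp [h0])]; push_cast; omega
    have hv0 : ord (bel M w) (x * (s * m) ^ 2) = 0 := by
      rw [mul_pow, ← mul_assoc, ord_mul, ord_pow, hm _ (by simp), hs]; simp
    obtain ⟨a, ha⟩ := hint
    have hθ2 : (η * algebraMap M N (s * m)) ^ 2 = algebraMap M N a := by
      rw [ha, mul_pow, e.sq, ← map_pow, ← map_mul]; push_cast; rfl
    have hi : IsIntegral ℤ (η * algebraMap M N (s * m)) := by
      refine IsIntegral.of_pow (n := 2) two_pos ?_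
      rw [hθ2]
      exact (RingOfIntegers.isIntegral_coe a).map (Algebra.algHom ℤ M N)
    let θ : 𝓞 N := ⟨_, hi⟩
    have hθ : θ ^ 2 = algebraMap (𝓞 M) (𝓞 N) a := RingOfIntegers.ext hθ2
    have h := e.q.diff_mem θ 0 (-a) (by rw [hθ]; simp) (by
      show σ (η * algebraMap M N (s * m)) ≠ η * algebraMap M N (s * m)
      rw [map_mul, σ.commutes, e.neg, neg_mul]
      intro h
      have : η * algebraMap M N (s * m) ≠ 0 := mul_ne_zero hη (by simp)
      exact this (self_eq_neg.1 h.symm))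
    have h := hle h
    rw [map_zero, sub_zero] at h
    rcases w.isPrime.mem_or_mem h with h | h
    · rw [← map_ofNat (algebraMap (𝓞 M) (𝓞 N)) 2, mem_w_iff] at h
      exact notMem_of_ord _ _ _ tw_val hv h
    · have := Ideal.pow_mem_of_mem _ h 2 two_pos
      rw [hθ, mem_w_iff] at this
      exact notMem_of_ord _ _ _ ha.symm hv0 this
  · obtain ⟨s, c, hc⟩ := h4
    have hθ2 : ((1 + η * algebraMap M N s) / 2) ^ 2 = (1 + η * algebraMap M N s) / 2 + algebraMap M N c := by
      have : (η * algebraMap M N s) ^ 2 = 1 + 4 * algebraMap M N c := by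
        rw [mul_pow, e.sq, ← map_pow, ← map_mul, hc, map_add, map_mul, map_one, map_ofNat]
      linear_combination this / 4
    have hi : IsIntegral ℤ ((1 + η * algebraMap M N s) / 2) := by
      have : IsIntegral (𝓞 M) ((1 + η * algebraMap M N s) / 2) := by
        refine ⟨X ^ 2 - X - C c, by monicity!, ?_⟩
        simp only [eval₂_sub, eval₂_X_pow, eval₂_X, eval₂_C]
        rw [hθ2]
        have : (algebraMap (𝓞 M) N) c = algebraMap M N c := rfl
        rw [this]; ring
      exact isIntegral_trans _ this
    let θ : 𝓞 N := ⟨_, hi⟩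
    have hθ : θ ^ 2 = θ + algebraMap (𝓞 M) (𝓞 N) c := RingOfIntegers.ext hθ2
    have h := e.q.diff_mem θ 1 (-c) (by rw [hθ]; simp) (by
      show σ ((1 + η * algebraMap M N s) / 2) ≠ (1 + η * algebraMap M N s) / 2
      rw [map_div₀, map_add, map_one, map_mul, σ.commutes, e.neg, neg_mul, map_ofNat]
      intro h
      have : η * algebraMap M N s ≠ 0 := mul_ne_zero hη (by simp)
      exact this (by linear_combination -h))
    have h := hle h
    have h2 : (2 : 𝓞 N) ∈ w.asIdeal := by
      rw [← map_ofNat (algebraMap (𝓞 M) (𝓞 N)) 2, mem_w_iff]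
      by_contra h5
      apply hv
      rw [ord_eq_zero_iff]
      exact (HeightOneSpectrum.valuation_eq_one_iff_notMem _).2 h5
    apply w.isPrime.ne_top
    rw [Ideal.eq_top_iff_one]
    have := w.asIdeal.sub_mem (w.asIdeal.mul_mem_right θ h2) h
    simpa using this
theorem ram_of_diff (w : S N) (h : ¬ differentIdeal (𝓞 M) (𝓞 N) ≤ w.asIdeal) : ram M w = 1 := by
  have hle : w.asIdeal ^ ram M w ∣ Ideal.map (algebraMap (𝓞 M) (𝓞 N)) (bel M w).asIdeal := by
    rw [Ideal.dvd_iff_le]; exact Ideal.le_pow_ramificationIdx'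
  have : (bel M w).asIdeal.IsMaximal := (bel M w).isMaximal
  have h1 := pow_sub_one_dvd_differentIdeal (𝓞 M) w.asIdeal _ (bel M w).ne_bot hle
  rw [Ideal.dvd_iff_le] at h1
  have h2 : ram M w - 1 = 0 := by
    by_contra h3
    exact h (h1.trans (Ideal.pow_le_self h3))
  have := ram_ne_zero (M := M) w
  omega
theorem Qe.unr (e : Qe σ x η) (hT : x ∈ VT (∅ : Set (S M))) (h4 : x ∈ Loc (P4 M)) : Unr M N := by
  have := e.q.gal
  by_contra h
  obtain ⟨P, hP, hle⟩ := Ideal.exists_le_maximal _ h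
  refine e.diff_away ∅ hT h4 ⟨P, hP.isPrime, ?_⟩ (by simp) hle
  rintro rfl
  exact differentIdeal_ne_bot (le_bot_iff.1 hle)
end
end NF
end
section
set_option linter.unusedSectionVars false
namespace NF
open NumberField Amb IsDedekindDomain
section
variable {M N : Type*} [Field M] [NumberField M] [Field N] [NumberField N] [Algebra M N]
variable {σ : N ≃ₐ[M] N} {x : Mˣ} {η : N}
theorem val_two (v : S M) (hv : v ∈ odd M) : v.valuation M 2 = 1 :=
  (ord_eq_zero_iff v (tw M)).1 hv
theorem Qe.split (e : Qe σ x η) (w : S N) (hv : bel M w ∈ odd M) (hx : x ∈ Loc (P1 (bel M w))) : σ • w ≠ w := by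
  intro hw
  obtain ⟨s, hs⟩ := hx
  have hs : (bel M w).valuation M ((x : M) * (s : M) ^ 2 - 1) < 1 := hs
  set t := η * algebraMap M N s with ht
  have h1 : w.valuation N ((t - 1) * (t + 1)) < 1 := by
    have : (t - 1) * (t + 1) = algebraMap M N ((x : M) * (s : M) ^ 2 - 1) := by
      rw [map_sub, map_mul, ← e.sq, map_pow, map_one, ht]; ring
    rw [this, val_bel (M := M)]
    exact pow_lt_one' hs (ram_ne_zero w)
  have hσ : ∀ y, w.valuation N (σ y) = w.valuation N y := by
    intro y
    have := val_smul σ w y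
    rwa [hw] at this
  have hst : σ t = -t := by rw [ht, map_mul, e.neg, σ.commutes]; ring
  have h2 : w.valuation N (t + 1) = w.valuation N (t - 1) := by
    rw [← hσ (t - 1), map_sub, hst, map_one, ← Valuation.map_neg]
    congr 1; ring
  have h3 : w.valuation N (t - 1) < 1 := by
    rw [map_mul, h2] at h1
    by_contra h
    rw [not_lt] at h
    exact absurd h1 (not_lt.2 (one_le_mul h h))
  have h4 : w.valuation N 2 < 1 := by
    have : (2 : N) = (t + 1) - (t - 1) := by ring
    rw [this]
    exact lt_of_le_of_lt (Valuation.map_sub _ _ _) (max_lt (by rwa [h2]) h3)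
  have h5 := val_bel (M := M) w 2
  rw [val_two _ hv, one_pow, map_ofNat] at h5
  exact h4.ne h5
theorem Qd.split_mem (q : Qd σ) (w : S N) (hw : σ • w ≠ w) :
    Multiplicative.ofAdd (exd M N (Finsupp.single (bel M w) 1)) ∈ (nu (td σ)).range := by
  classical
  have := q.gal
  refine ⟨Multiplicative.ofAdd (Finsupp.single w 1), ?_⟩
  rw [nu_apply]
  apply Multiplicative.toAdd.injective
  change Finsupp.single w (1 : ℤ) + σ • Finsupp.single w (1 : ℤ) = exd M N (Finsupp.single (bel M w) 1)
  ext w'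
  rw [Finsupp.add_apply, dsmul_apply, exd_apply, q.inv_eq, Finsupp.single_apply, Finsupp.single_apply, Finsupp.single_apply]
  have hr := (q.ram_dvd w).2 hw
  by_cases h : bel M w = bel M w'
  · obtain ⟨τ, hτ⟩ := bel_trans w w' h
    rcases q.all τ with rfl | rfl
    · rw [one_smul] at hτ; subst hτ
      rw [if_pos rfl, if_neg hw.symm, if_pos rfl, hr]; simp
    · subst hτ
      have hr' := (q.ram_dvd (τ • w)).2 (by rw [q.smul_smul]; exact hw.symm)
      rw [if_neg hw.symm, if_pos (by rw [q.smul_smul]), if_pos h, hr']; simp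
  · rw [if_neg, if_neg, if_neg h]
    · simp
    · rintro rfl; exact h (bel_smul _ _)
    · rintro rfl; exact h rfl
theorem Qe.norm_loc (e : Qe σ x η) (v : S M) (hx : ¬ Even (ord v x)) (b : Mˣ) (hb : Even (ord v b)) (β : N)
    (h : algebraMap M N b = β * σ β) : b ∈ Loc (P1 v) := by
  obtain ⟨p, r, hβ⟩ := e.decomp β
  have hb1 : (b : M) = p ^ 2 - x * r ^ 2 := by
    apply (algebraMap M N).injective
    rw [h, hβ, map_add, map_mul, σ.commutes, σ.commutes, e.neg, map_sub, map_pow, map_mul, map_pow, ← e.sq]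
    ring
  by_cases hr : r = 0
  · have hp : p ≠ 0 := by rintro rfl; simp [hr] at hb1
    apply sq_le_Loc
    exact ⟨Units.mk0 p hp, Units.ext (by rw [powMonoidHom_apply]; simp [hb1, hr])⟩
  by_cases hp : p = 0
  · exfalso
    have : b = -1 * (x * (Units.mk0 r hr) ^ 2) := Units.ext (by simp [hb1, hp])
    have h1 : ord v (-1 : Mˣ) = 0 := by rw [ord_eq_zero_iff]; simp [Valuation.map_neg]
    rw [this, ord_mul, ord_mul, ord_pow, h1, zero_add, Int.even_add] at hb
    exact hx (hb.2 ⟨ord v (Units.mk0 r hr), by push_cast; ring⟩)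
  obtain ⟨p, rfl⟩ : ∃ p' : Mˣ, (p' : M) = p := ⟨Units.mk0 p hp, rfl⟩
  obtain ⟨r, rfl⟩ : ∃ p' : Mˣ, (p' : M) = r := ⟨Units.mk0 r hr, rfl⟩
  have hlt : 0 < ord v (x * r ^ 2 * p⁻¹ ^ 2) := by
    by_contra hn
    have h0 : ord v (x * r ^ 2 * p⁻¹ ^ 2) = ord v x + 2 * ord v r - 2 * ord v p := by
      rw [ord_mul, ord_mul, ord_pow, ord_pow, ord_inv]; push_cast; ring
    have hlt : ord v (x * r ^ 2) < ord v (p ^ 2) := by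
      rw [ord_mul, ord_pow, ord_pow]
      rw [Int.not_even_iff_odd] at hx
      obtain ⟨k, hk⟩ := hx
      push_cast
      omega
    have h2 : v.valuation M ((p : M) ^ 2) < v.valuation M ((x : M) * (r : M) ^ 2) := by
      have h3 := val_eq v (p ^ 2)
      have h4 := val_eq v (x * r ^ 2)
      push_cast at h3 h4
      rw [h3, h4]
      exact WithZero.exp_lt_exp.2 (by omega)
    have h5 : v.valuation M (b : M) = v.valuation M ((x : M) * (r : M) ^ 2) := by
      rw [hb1, sub_eq_add_neg, Valuation.map_add_eq_of_lt_right, Valuation.map_neg]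
      rwa [Valuation.map_neg]
    have h6 : ord v b = ord v (x * r ^ 2) := by
      have h4 := val_eq v (x * r ^ 2)
      push_cast at h4
      rw [val_eq, h4] at h5
      have := WithZero.exp_injective h5
      omega
    rw [h6, ord_mul, ord_pow, Int.even_add] at hb
    exact hx (hb.2 ⟨ord v r, by push_cast; ring⟩)
  refine ⟨p⁻¹, ?_⟩
  change v.valuation M _ < 1
  rw [ord_pos_iff] at hlt
  convert hlt using 1
  rw [← Valuation.map_neg]
  congr 1
  rw [hb1]
  have := p.ne_zero
  push_cast
  field_simp
  ring
end
section
variable {M N : Type} [Field M] [NumberField M] [Field N] [NumberField N] [Algebra M N]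
theorem qa1 (a r : M) : star (algebraMap M (QuadraticAlgebra M a 0) r) = algebraMap M _ r := by
  apply QuadraticAlgebra.ext <;> simp
theorem qa2 (a : M) : (⟨0, 1⟩ : QuadraticAlgebra M a 0) ^ 2 = algebraMap M _ a := by
  apply QuadraticAlgebra.ext <;> simp [pow_two]
theorem qa3 (a : M) : star (⟨0, 1⟩ : QuadraticAlgebra M a 0) = - ⟨0, 1⟩ := by
  apply QuadraticAlgebra.ext <;> simp
theorem qa4 (a : M) (y : QuadraticAlgebra M a 0) : y = algebraMap M _ y.re + algebraMap M _ y.im * ⟨0, 1⟩ := by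
  apply QuadraticAlgebra.ext <;> simp
theorem exists_quad (x : Mˣ) (hx : x ∉ sq M) : ∃ (N : Type) (_ : Field N) (_ : NumberField N) (_ : Algebra M N)
    (σ : N ≃ₐ[M] N) (η : N), Qe σ x η := by
  have : Fact (∀ r : M, r ^ 2 ≠ (x : M) + 0 * r) := ⟨fun r h => hx (by
    rw [zero_mul, add_zero] at h
    have hr : r ≠ 0 := by rintro rfl; exact x.ne_zero (by simpa using h.symm)
    exact ⟨Units.mk0 r hr, Units.ext (by rw [powMonoidHom_apply]; simpa using h)⟩)⟩
  let N := QuadraticAlgebra M (x : M) 0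
  have : CharZero N := charZero_of_injective_algebraMap (algebraMap M N).injective
  have hf : Module.finrank M N = 2 := QuadraticAlgebra.finrank_eq_two _ _
  have : FiniteDimensional M N := FiniteDimensional.of_finrank_pos (by rw [hf]; norm_num)
  have : FiniteDimensional ℚ N := FiniteDimensional.trans ℚ M N
  have : NumberField N := ⟨⟩
  let η : N := ⟨0, 1⟩
  let σ : N ≃ₐ[M] N := AlgEquiv.ofRingEquiv (f := starRingAut) (qa1 _)
  have h2 : η ^ 2 = algebraMap M N x := by
    exact qa2 _
  have hs : σ η = -η := by
    change star η = -η
    exact qa3 _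
  have h0 : η ≠ 0 := by
    intro h
    have := congrArg QuadraticAlgebra.im h
    simp [η] at this
  have hg : ∀ y : N, y = algebraMap M N y.re + algebraMap M N y.im * η := by
    exact qa4 _
  refine ⟨N, inferInstance, inferInstance, inferInstance, σ, η, ⟨⟨fun y => ?_, fun τ => ?_, fun h => ?_, hf⟩, h2, hs⟩⟩
  · exact star_star y
  · have : τ η ^ 2 = η ^ 2 := by rw [← map_pow, h2, τ.commutes]
    rcases sq_eq_sq_iff_eq_or_eq_neg.1 this with h | h
    · left; ext1 y; rw [hg y, map_add, map_mul, τ.commutes, τ.commutes, h]; rfl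
    · right; ext1 y; rw [hg y, map_add, map_mul, τ.commutes, τ.commutes, h, map_add, map_mul, σ.commutes, σ.commutes, hs]
  · rw [h] at hs
    exact h0 (self_eq_neg.1 hs)
theorem Qe.real [IsTotallyReal M] {σ : N ≃ₐ[M] N} {x : Mˣ} {η : N} (e : Qe σ x η) (hx : x ∈ TP M) : IsTotallyReal N := by
  rw [isTotallyReal_iff]
  intro w
  rw [InfinitePlace.isReal_iff, ComplexEmbedding.isReal_iff]
  set φ := w.embedding
  have hr : ComplexEmbedding.IsReal (φ.comp (algebraMap M N)) := IsTotallyReal.complexEmbedding_isReal _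
  have h1 : ∀ y : M, (starRingEnd ℂ) (φ (algebraMap M N y)) = φ (algebraMap M N y) := fun y =>
    RingHom.congr_fun (ComplexEmbedding.isReal_iff.1 hr) y
  have h2 : (0 : ℝ) < hr.embedding x := hx _
  have h3 : φ η ^ 2 = (hr.embedding (x : M) : ℂ) := by
    rw [← map_pow, e.sq]
    exact (ComplexEmbedding.IsReal.coe_embedding_apply hr x).symm
  have h4 : (starRingEnd ℂ) (φ η) = φ η := by
    have : φ η ^ 2 = ((Real.sqrt (hr.embedding (x : M)) : ℝ) : ℂ) ^ 2 := by
      rw [h3, ← Complex.ofReal_pow, Real.sq_sqrt h2.le]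
    rcases sq_eq_sq_iff_eq_or_eq_neg.1 this with h | h <;> rw [h] <;> simp
  ext1 y
  obtain ⟨a, b, rfl⟩ := e.decomp y
  rw [ComplexEmbedding.conjugate_coe_eq, map_add, map_mul, map_add, map_mul, h1, h1, h4]
end
end NF
end
section
set_option linter.unusedSectionVars false
namespace NF
open NumberField Amb IsDedekindDomain Filter Topology
open scoped ENNReal
noncomputable def ZX {X : Type*} (q : X → ℝ≥0∞) : ℝ≥0∞ := ∑' D : X →₀ ℕ, D.prod fun x n => q x ^ n
theorem ZX_mono {X : Type*} {p q : X → ℝ≥0∞} (h : ∀ x, p x ≤ q x) : ZX p ≤ ZX q := by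
  refine ENNReal.tsum_le_tsum fun D => ?_
  exact Finset.prod_le_prod' fun x _ => pow_le_pow_left' (h x) _
theorem ZX_inj {X Y : Type*} (i : X → Y) (hi : Function.Injective i) (q : Y → ℝ≥0∞) : ZX (q ∘ i) ≤ ZX q := by
  have := ENNReal.tsum_comp_le_tsum_of_injective (Finsupp.mapDomain_injective (M := ℕ) hi)
    (fun D : Y →₀ ℕ => D.prod fun x n => q x ^ n)
  refine le_trans (le_of_eq ?_) this
  refine tsum_congr fun D => ?_
  rw [Finsupp.prod_mapDomain_index_inj hi]
  rfl
theorem ZX_sum {X Y : Type*} (p : X → ℝ≥0∞) (q : Y → ℝ≥0∞) : ZX (Sum.elim p q) = ZX p * ZX q := by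
  unfold ZX
  rw [← Finsupp.sumFinsuppEquivProdFinsupp.symm.tsum_eq, ENNReal.tsum_prod', ← ENNReal.tsum_mul_right]
  refine tsum_congr fun D => ?_
  rw [← ENNReal.tsum_mul_left]
  refine tsum_congr fun E => ?_
  change (Finsupp.sumElim D E).prod _ = _
  rw [Finsupp.prod_sumElim]
  rfl
theorem ZX_fin (X : Type) [Finite X] : ∃ C : ℕ, ∀ q : X → ℝ≥0∞, (∀ x, q x ≤ 2⁻¹) → ZX q ≤ C := by
  induction X using Finite.induction_empty_option with
  | of_equiv e ih =>
    obtain ⟨C, hC⟩ := ih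
    refine ⟨C, fun q hq => ?_⟩
    have h : q = (q ∘ e) ∘ e.symm := by ext; simp
    rw [h]
    exact (ZX_inj _ e.symm.injective _).trans (hC _ fun x => hq _)
  | h_empty =>
    refine ⟨1, fun q _ => ?_⟩
    unfold ZX
    rw [tsum_eq_single 0 (fun D hD => absurd (Subsingleton.elim _ _) hD)]
    simp
  | @h_option α _ ih =>
    obtain ⟨C, hC⟩ := ih
    refine ⟨C * 2, fun q hq => ?_⟩
    let e := Equiv.optionEquivSumPUnit.{0} α
    have h : q = (Sum.elim (q ∘ some) (fun _ : PUnit.{1} => q none)) ∘ e := by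
      ext x; cases x <;> simp [e]
    rw [h]
    refine (ZX_inj _ (Equiv.injective _) _).trans ?_
    rw [ZX_sum]
    push_cast
    refine mul_le_mul' (hC _ fun x => hq _) ?_
    unfold ZX
    rw [← (Finsupp.uniqueEquiv PUnit.unit).symm.tsum_eq]
    have : ∀ n : ℕ, ((Finsupp.uniqueEquiv PUnit.unit).symm n).prod (fun (_ : PUnit.{1}) n => q none ^ n) = q none ^ n := by
      intro n
      rw [Finsupp.uniqueEquiv_symm_apply, Finsupp.prod_single_index (by simp)]
    simp_rw [this]
    rw [ENNReal.tsum_geometric, ENNReal.inv_le_iff_inv_le]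
    refine ENNReal.le_sub_of_add_le_right (ne_top_of_le_ne_top (by simp) (hq none)) ?_
    calc (2⁻¹ : ℝ≥0∞) + q none ≤ 2⁻¹ + 2⁻¹ := by gcongr; exact hq none
      _ = 1 := ENNReal.inv_two_add_inv_two
noncomputable def rp (s : ℝ) : ℕ →* ℝ≥0∞ where
  toFun n := ENNReal.ofReal ((n : ℝ) ^ (-s))
  map_one' := by simp
  map_mul' a b := by
    rw [Nat.cast_mul, Real.mul_rpow (by positivity) (by positivity), ENNReal.ofReal_mul (by positivity)]
theorem rp_apply (s : ℝ) (n : ℕ) : rp s n = ENNReal.ofReal ((n : ℝ) ^ (-s)) := rfl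
section
variable {M N : Type*} [Field M] [NumberField M] [Field N] [NumberField N] [Algebra M N]
noncomputable def idl (D : S M →₀ ℕ) : Ideal (𝓞 M) := D.prod fun v n => v.asIdeal ^ n
theorem idl_inj : Function.Injective (idl (M := M)) := by
  intro D E h
  have key : ∀ (D : S M →₀ ℕ) v, FractionalIdeal.count M v (idl D : FractionalIdeal (nonZeroDivisors (𝓞 M)) M) = D v := by
    intro D v
    have := FractionalIdeal.count_finsuppProd M v (D.mapRange (Nat.cast : ℕ → ℤ) (by simp))
    rw [Finsupp.mapRange_apply] at this
    rw [← this, Finsupp.prod_mapRange_index (by simp)]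
    congr 1
    simp only [idl, Finsupp.prod, zpow_natCast]
    rw [← FractionalIdeal.coeIdealHom_apply, map_prod]
    simp only [FractionalIdeal.coeIdealHom_apply, FractionalIdeal.coeIdeal_pow]
  ext v
  have h1 := key D v
  rw [h, key E v] at h1
  exact_mod_cast h1.symm
theorem idl_surj (I : Ideal (𝓞 M)) (hI : I ≠ 0) : ∃ D, idl D = I := by
  induction I using UniqueFactorizationMonoid.induction_on_prime with
  | h₁ => exact absurd rfl hI
  | h₂ I h => exact ⟨0, by rw [Ideal.isUnit_iff] at h; simp [idl, h]⟩
  | h₃ J P hJ hP ih =>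
    obtain ⟨D, hD⟩ := ih hJ
    let v : S M := ⟨P, Ideal.isPrime_of_prime hP, hP.ne_zero⟩
    refine ⟨Finsupp.single v 1 + D, ?_⟩
    rw [idl, Finsupp.prod_add_index' (by simp) (fun _ _ _ => pow_add _ _ _), Finsupp.prod_single_index (by simp)]
    rw [show (D.prod fun v n => v.asIdeal ^ n) = J from hD, pow_one]
theorem idl_ne (D : S M →₀ ℕ) : idl D ≠ 0 := by
  unfold idl Finsupp.prod
  exact Finset.prod_ne_zero_iff.2 fun v _ => pow_ne_zero _ v.ne_bot
noncomputable def zt (M : Type*) [Field M] [NumberField M] (s : ℝ) : ℝ≥0∞ :=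
  ZX fun v : S M => rp s (Ideal.absNorm v.asIdeal)
theorem zt_eq (s : ℝ) : zt M s = ∑' n : ℕ, ENNReal.ofReal ‖LSeries.term (fun n ↦ (Nat.card {I : Ideal (𝓞 M) // Ideal.absNorm I = n} : ℂ)) s n‖ := by
  have h1 : ∀ D : S M →₀ ℕ, (D.prod fun v n => rp s (Ideal.absNorm v.asIdeal) ^ n) = rp s (Ideal.absNorm (idl D)) := by
    intro D
    rw [idl, map_finsuppProd, map_finsuppProd]
    simp
  unfold zt ZX
  simp_rw [h1]
  rw [← (Equiv.sigmaFiberEquiv fun D : S M →₀ ℕ => Ideal.absNorm (idl D)).tsum_eq, ENNReal.tsum_sigma']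
  refine tsum_congr fun n => ?_
  have h2 : ∀ D : {D : S M →₀ ℕ // Ideal.absNorm (idl D) = n}, rp s (Ideal.absNorm (idl ((Equiv.sigmaFiberEquiv fun D : S M →₀ ℕ => Ideal.absNorm (idl D)) ⟨n, D⟩))) = rp s n := by
    intro D
    rw [Equiv.sigmaFiberEquiv_apply]
    congr 1
    exact D.2
  simp_rw [h2]
  rw [ENNReal.tsum_const]
  rcases Nat.eq_zero_or_pos n with rfl | hn
  · have : IsEmpty {D : S M →₀ ℕ // Ideal.absNorm (idl D) = 0} := ⟨fun D => by
      have := D.2; rw [Ideal.absNorm_eq_zero_iff] at this; exact idl_ne _ this⟩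
    simp [ENat.card_eq_zero_iff_empty, this]
  · have e : {D : S M →₀ ℕ // Ideal.absNorm (idl D) = n} ≃ {I : Ideal (𝓞 M) // Ideal.absNorm I = n} :=
      Equiv.ofBijective (fun D => ⟨idl D.1, D.2⟩) ⟨fun D E h => Subtype.ext (idl_inj (congrArg Subtype.val h)), fun I => by
        obtain ⟨D, hD⟩ := idl_surj I.1 (fun h => by
          have := I.2; rw [h] at this; simp at this; omega)
        exact ⟨⟨D, by rw [hD]; exact I.2⟩, Subtype.ext hD⟩⟩
    have hf : Finite {I : Ideal (𝓞 M) // Ideal.absNorm I = n} := Ideal.finite_setOfPred_absNorm_eq n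
    rw [ENat.card_congr e, ENat.card_eq_coe_natCard, LSeries.term_of_ne_zero hn.ne', norm_div, Complex.norm_natCast,
      Complex.norm_natCast_cpow_of_pos hn, Complex.ofReal_re, ENNReal.ofReal_div_of_pos (by positivity), rp_apply,
      Real.rpow_neg (by positivity), ENNReal.ofReal_inv_of_pos (by positivity), ENNReal.ofReal_natCast, div_eq_mul_inv]
    simp
theorem zt_lim : ∃ r : ℝ, 0 < r ∧ Tendsto (fun s : ℝ => (s - 1) * (zt M s).toReal) (𝓝[>] 1) (𝓝 r) ∧
    ∀ᶠ s in 𝓝[>] (1 : ℝ), zt M s ≠ ⊤ := by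
  refine ⟨dedekindZeta_residue M, dedekindZeta_residue_pos M, ?_⟩
  have h := tendsto_sub_one_mul_dedekindZeta_nhdsGT M
  have hev : ∀ᶠ s : ℝ in 𝓝[>] (1 : ℝ), ((s : ℂ) - 1) * dedekindZeta M s = ((s - 1) * (zt M s).toReal : ℝ) ∧ zt M s ≠ ⊤ := by
    have hne := h.eventually (isOpen_ne.mem_nhds (show ((dedekindZeta_residue M : ℝ) : ℂ) ≠ 0 by exact_mod_cast (dedekindZeta_residue_pos M).ne'))
    filter_upwards [hne] with s hs
    have hz : dedekindZeta M s ≠ 0 := fun h0 => hs (by rw [h0, mul_zero])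
    unfold dedekindZeta at *
    have hsum : Summable (LSeries.term (fun n ↦ (Nat.card {I : Ideal (𝓞 M) // Ideal.absNorm I = n} : ℂ)) s) := by
      by_contra hn
      exact hz (tsum_eq_zero_of_not_summable hn)
    have hz2 := zt_eq (M := M) s
    rw [← ENNReal.ofReal_tsum_of_nonneg (fun _ => norm_nonneg _) hsum.norm] at hz2
    refine ⟨?_, by rw [hz2]; exact ENNReal.ofReal_ne_top⟩
    rw [hz2, ENNReal.toReal_ofReal (tsum_nonneg fun _ => norm_nonneg _), LSeries]
    push_cast
    congr 1
    refine tsum_congr fun n => ?_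
    rcases Nat.eq_zero_or_pos n with rfl | hn
    · simp
    · rw [LSeries.term_of_ne_zero hn.ne', norm_div, Complex.norm_natCast,
      Complex.norm_natCast_cpow_of_pos hn, Complex.ofReal_re]
      rw [Complex.ofReal_div, Complex.ofReal_cpow (by positivity)]
      simp
  refine ⟨?_, hev.mono fun s hs => hs.2⟩
  have h2 := h.congr' (hev.mono fun s hs => hs.1)
  have h3 := (Complex.continuous_re.tendsto _).comp h2
  simpa only [Function.comp_def, Complex.ofReal_re] using h3
end
end NF
end
section
set_option linter.unusedSectionVars false
namespace NF
open NumberField Amb IsDedekindDomain Filter Topology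
open scoped ENNReal Pointwise
section
variable {M N : Type*} [Field M] [NumberField M] [Field N] [NumberField N] [Algebra M N]
theorem norm_smul (σ : N ≃ₐ[M] N) (w : S N) : Ideal.absNorm (σ • w).asIdeal = Ideal.absNorm w.asIdeal := by
  rw [smul_asIdeal, Ideal.absNorm_apply, Ideal.absNorm_apply, Submodule.cardQuot_apply, Submodule.cardQuot_apply]
  refine Nat.card_congr (Ideal.quotientEquiv _ _ (MulSemiringAction.toRingEquiv _ (𝓞 N) σ) ?_).symm.toEquiv
  rfl
theorem Qd.norm_le {σ : N ≃ₐ[M] N} (q : Qd σ) (w : S N) (h : σ • w ≠ w) :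
    Ideal.absNorm w.asIdeal ≤ Ideal.absNorm (bel M w).asIdeal := by
  have h0 : IsCoprime w.asIdeal (σ • w).asIdeal := by
    rw [Ideal.isCoprime_iff_sup_eq]
    refine Ideal.IsMaximal.coprime_of_ne w.isMaximal (σ • w).isMaximal fun h' => h ?_
    exact HeightOneSpectrum.ext h'.symm
  have hd (u : S N) : u.asIdeal ∣ (bel M u).asIdeal.map (algebraMap (𝓞 M) (𝓞 N)) := by
    rw [Ideal.dvd_iff_le]
    exact Ideal.map_comap_le
  have h1 := h0.mul_dvd (hd w) (by
    have := hd (σ • w)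
    rwa [bel_smul] at this)
  have h2 := map_dvd Ideal.absNorm h1
  have hdeg : Module.finrank (𝓞 M) (𝓞 N) = 2 := by
    rw [← q.deg]
    exact (Algebra.IsAlgebraic.finrank_of_isFractionRing (𝓞 M) M (𝓞 N) N).symm
  rw [map_mul, norm_smul, Ideal.absNorm_algebraMap, hdeg, ← pow_two] at h2
  have h3 := Nat.le_of_dvd (pow_pos (Nat.pos_of_ne_zero (by
    rw [Ne, Ideal.absNorm_eq_zero_iff]; exact (bel M w).ne_bot)) 2) h2
  exact (Nat.pow_le_pow_iff_left two_ne_zero).1 h3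
theorem rp_anti {s : ℝ} (hs : 0 ≤ s) {a b : ℕ} (ha : a ≠ 0) (h : a ≤ b) : rp s b ≤ rp s a := by
  rw [rp_apply, rp_apply]
  refine ENNReal.ofReal_le_ofReal (Real.rpow_le_rpow_of_nonpos (by positivity) (by exact_mod_cast h) (by linarith))
theorem rp_half {s : ℝ} (hs : 1 ≤ s) {a : ℕ} (ha : 2 ≤ a) : rp s a ≤ 2⁻¹ := by
  refine (rp_anti (by linarith) (by norm_num) ha).trans ?_
  rw [rp_apply]
  have : ENNReal.ofReal (2⁻¹ : ℝ) = 2⁻¹ := by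
    rw [ENNReal.ofReal_inv_of_pos (by norm_num)]; simp
  rw [← this]
  refine ENNReal.ofReal_le_ofReal ?_
  calc ((2 : ℕ) : ℝ) ^ (-s) ≤ (2 : ℝ) ^ (-1 : ℝ) := by
        push_cast; exact Real.rpow_le_rpow_of_exponent_le (by norm_num) (by linarith)
    _ = 2⁻¹ := by rw [Real.rpow_neg_one]
theorem norm_two (w : S M) : 2 ≤ Ideal.absNorm w.asIdeal := by
  have h0 : Ideal.absNorm w.asIdeal ≠ 0 := by rw [Ne, Ideal.absNorm_eq_zero_iff]; exact w.ne_bot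
  have h1 : Ideal.absNorm w.asIdeal ≠ 1 := by rw [Ne, Ideal.absNorm_eq_one_iff]; exact w.isPrime.ne_top
  omega
end
theorem nonsplit {F : Type} [Field F] [NumberField F] (v : Fˣ) (hv : v ∉ sq F) (B : Set (S F)) (hB : B.Finite) :
    ∃ P : S F, P ∉ B ∧ P ∈ odd F ∧ v ∉ Loc (P1 P) := by
  by_contra! hcon
  classical
  obtain ⟨N, _, _, _, σ, η, e⟩ := exists_quad v hv
  have := e.q.gal
  let A : Set (S F) := B ∪ {v | 0 < ord v (tw F)}
  have hA : A.Finite := hB.union even_finite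
  have hsplit : ∀ P : {P : S F // P ∉ A}, ∃ w : S N, bel F w = P.1 ∧ σ • w ≠ w := by
    rintro ⟨P, hP⟩
    obtain ⟨w, hw⟩ := exists_above (N := N) P
    have hodd : P ∈ odd F := by
      have h1 := ord_tw_nonneg P
      have h2 : ¬ 0 < ord P (tw F) := fun h => hP (Or.inr h)
      change ord P (tw F) = 0
      omega
    refine ⟨w, hw, e.split w (by rw [hw]; exact hodd) ?_⟩
    rw [hw]
    exact hcon P (fun h => hP (Or.inl h)) hodd
  choose w hw hσ using hsplit
  let X := {P : S F // P ∉ A}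
  let i : X ⊕ X → S N := Sum.elim w (fun P => σ • w P)
  have hi : Function.Injective i := by
    have hb : ∀ P, bel F (σ • w P) = P.1 := fun P => by rw [bel_smul, hw]
    rintro (P | P) (Q | Q) h
    · have := congrArg (bel F) h
      simp only [i, Sum.elim_inl, hw] at this
      rw [Subtype.ext this]
    · have := congrArg (bel F) h
      simp only [i, Sum.elim_inl, Sum.elim_inr, hw, hb] at this
      obtain rfl := Subtype.ext this
      exact absurd h.symm (hσ P)
    · have := congrArg (bel F) h
      simp only [i, Sum.elim_inl, Sum.elim_inr, hw, hb] at this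
      obtain rfl := Subtype.ext this
      exact absurd h (hσ P)
    · have := congrArg (bel F) h
      simp only [i, Sum.elim_inr, hb] at this
      rw [Subtype.ext this]
  have : Finite {P : S F // P ∈ A} := hA
  obtain ⟨C, hC⟩ := ZX_fin {P : S F // P ∈ A}
  have key : ∀ s : ℝ, 1 < s → zt F s ^ 2 ≤ C ^ 2 * zt N s := by
    intro s hs
    let p : X → ℝ≥0∞ := fun P => rp s (Ideal.absNorm P.1.asIdeal)
    have h1 : zt F s ≤ C * ZX p := by
      have e1 := Equiv.sumCompl (fun P : S F => P ∈ A)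
      have h2 := ZX_inj (Equiv.sumCompl (fun P : S F => P ∈ A)).symm (Equiv.injective _)
        (Sum.elim (fun P : {P : S F // P ∈ A} => rp s (Ideal.absNorm P.1.asIdeal)) p)
      rw [ZX_sum] at h2
      refine le_trans (le_of_eq ?_) (h2.trans (mul_le_mul' (hC _ fun P => rp_half hs.le (norm_two _)) le_rfl))
      unfold zt
      congr 1
      ext P
      obtain ⟨y, rfl⟩ := (Equiv.sumCompl (fun P : S F => P ∈ A)).surjective P
      simp only [Function.comp, Equiv.symm_apply_apply]
      rcases y with y | y <;> simp [p]
    have h2 : ZX p ^ 2 ≤ zt N s := by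
      have h3 := ZX_inj i hi (fun v : S N => rp s (Ideal.absNorm v.asIdeal))
      refine le_trans ?_ h3
      rw [pow_two, ← ZX_sum]
      refine ZX_mono ?_
      have hn : ∀ P : X, rp s (Ideal.absNorm P.1.asIdeal) ≤ rp s (Ideal.absNorm (w P).asIdeal) := by
        intro P
        refine rp_anti (by linarith) (by have := norm_two (w P); omega) ?_
        have := e.q.norm_le (w P) (hσ P)
        rwa [hw] at this
      rintro (P | P)
      · exact hn P
      · simp only [i, Sum.elim_inr, Function.comp, norm_smul]
        exact hn P
    calc zt F s ^ 2 ≤ (C * ZX p) ^ 2 := by gcongr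
      _ = C ^ 2 * ZX p ^ 2 := by ring
      _ ≤ _ := by gcongr
  obtain ⟨r, hr, hl, hf⟩ := zt_lim (M := F)
  obtain ⟨r', hr', hl', hf'⟩ := zt_lim (M := N)
  have hs1 : Tendsto (fun s : ℝ => s - 1) (𝓝[>] 1) (𝓝 0) := by
    have : Tendsto (fun s : ℝ => s - 1) (𝓝 1) (𝓝 (1 - 1)) := (continuous_id.sub continuous_const).tendsto _
    rw [sub_self] at this
    exact this.mono_left nhdsWithin_le_nhds
  have h1 := hl.pow 2
  have h2 := (hs1.mul hl').const_mul ((C : ℝ) ^ 2)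
  have h3 : r ^ 2 ≤ (C : ℝ) ^ 2 * (0 * r') := by
    refine le_of_tendsto_of_tendsto h1 h2 ?_
    filter_upwards [hf, hf', self_mem_nhdsWithin] with s a b c
    have h4 := ENNReal.toReal_mono (ENNReal.mul_ne_top (by simp) b) (key s c)
    rw [ENNReal.toReal_pow, ENNReal.toReal_mul, ENNReal.toReal_pow, ENNReal.toReal_natCast] at h4
    calc _ = (s - 1) ^ 2 * (zt F s).toReal ^ 2 := by ring
      _ ≤ (s - 1) ^ 2 * ((C : ℝ) ^ 2 * (zt N s).toReal) := by gcongr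
      _ = _ := by ring
  have : 0 < r ^ 2 := by positivity
  simp at h3
  linarith
end NF
end
section
set_option linter.unusedSectionVars false
namespace NF
open NumberField Amb IsDedekindDomain
open scoped Pointwise
section
variable {M N : Type*} [Field M] [NumberField M] [Field N] [NumberField N] [Algebra M N]
def VL (T : Finset (S M)) : Subgroup Mˣ where
  carrier := {x | ∀ w ∈ T, x ∈ Loc (P1 w)}
  one_mem' w _ := one_mem _
  mul_mem' hx hy w hw := mul_mem (hx w hw) (hy w hw)
  inv_mem' hx w hw := inv_mem (hx w hw)
theorem mem_VL (T : Finset (S M)) (x : Mˣ) : x ∈ VL T ↔ ∀ w ∈ T, x ∈ Loc (P1 w) := Iff.rfl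
theorem sq_le_VL (T : Finset (S M)) : sq M ≤ VL T := fun _ hx _ _ => sq_le_Loc _ hx
theorem VL_idx (T : Finset (S M)) (H : Subgroup Mˣ) (hH : ∀ w ∈ T, ∀ y ∈ H, Even (ord w y)) :
    (VL T).relIndex H ≤ 2 ^ T.card ∧ (VL T).relIndex H ≠ 0 := by
  classical
  induction T using Finset.induction_on with
  | empty =>
    have : VL (∅ : Finset (S M)) = ⊤ := by
      ext x; simp [mem_VL]
    rw [this]; simp
  | insert w T hw ih =>
    have h1 := ih fun v hv => hH v (Finset.mem_insert_of_mem hv)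
    have h2 := loc_idx w H (hH w (Finset.mem_insert_self _ _))
    have : VL (insert w T) = Loc (P1 w) ⊓ VL T := by
      ext x; simp [mem_VL]
    rw [this, Finset.card_insert_of_notMem hw, pow_succ']
    exact ⟨(Subgroup.relIndex_inf_le ..).trans (Nat.mul_le_mul h2.1 h1.1), Subgroup.relIndex_inf_ne_zero h2.2 h1.2⟩
theorem Vs_idx [IsTotallyReal M] : (sq M).relIndex (VT (∅ : Set (S M))) ≠ 0 := by
  rw [card_V]
  refine mul_ne_zero (by positivity) fun h => dv_index (M := M) ?_
  exact Nat.eq_zero_of_zero_dvd (h ▸ Subgroup.index_dvd_of_le (le_sup_left))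
noncomputable def pd (w : S M) : Multiplicative (Dv M) := Multiplicative.ofAdd (Finsupp.single w 1)
theorem gen (J : Subgroup (Multiplicative (Dv M))) (D : Multiplicative (Dv M))
    (h : ∀ v, D.toAdd v ≠ 0 → pd v ∈ J) : D ∈ J := by
  have : D = ∏ v ∈ D.toAdd.support, pd v ^ (D.toAdd v) := by
    apply Multiplicative.toAdd.injective
    rw [toAdd_prod]
    conv_lhs => rw [← Finsupp.sum_single D.toAdd]
    refine Finset.sum_congr rfl fun v _ => ?_
    rw [toAdd_zpow]
    change _ = _ • Finsupp.single v 1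
    simp
  rw [this]
  refine Subgroup.prod_mem _ fun v hv => Subgroup.zpow_mem _ (h v ?_) _
  exact Finsupp.mem_support_iff.1 hv
theorem exists_odd (J : Subgroup (Multiplicative (Dv M))) (hJ : (dv (M := M)).range ≤ J) (hne : J ≠ ⊤) :
    ∃ v ∈ odd M, pd v ∉ J := by
  by_contra! hcon
  refine hne ((Subgroup.eq_top_iff' _).2 fun D => ?_)
  obtain ⟨x, hx⟩ := approx (even_finite (M := M)).toFinset D.toAdd
  have : D = (D / dv x) * dv x := by simp
  rw [this]
  refine mul_mem (gen J _ fun v hv => ?_) (hJ ⟨x, rfl⟩)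
  refine hcon v ?_
  by_contra h
  have h0 : 0 < ord v (tw M) := lt_of_le_of_ne (ord_tw_nonneg v) (Ne.symm h)
  apply hv
  rw [toAdd_div, Finsupp.sub_apply, dv_apply, hx v (by simpa using h0), sub_self]
theorem exists_Q (J : Subgroup (Multiplicative (Dv M))) (hJ : (dv (M := M)).range ≤ J) :
    ∃ Q : Finset (S M), (∀ v ∈ Q, v ∈ odd M) ∧ 2 ^ Q.card ≤ J.index ∧
      ∀ J' : Subgroup (Multiplicative (Dv M)), J ≤ J' → (∀ v ∈ Q, pd v ∈ J') → J' = ⊤ := by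
  classical
  have hi : ∀ J : Subgroup (Multiplicative (Dv M)), (dv (M := M)).range ≤ J → J.index ≠ 0 := fun J hJ h =>
    dv_index (M := M) (Nat.eq_zero_of_zero_dvd (h ▸ Subgroup.index_dvd_of_le hJ))
  induction hn : J.index using Nat.strong_induction_on generalizing J with
  | _ n ih =>
  by_cases hne : J = ⊤
  · refine ⟨∅, by simp, ?_, fun J' h _ => top_le_iff.1 (hne ▸ h)⟩
    rw [← hn, hne]; simp
  · obtain ⟨v, hv, hvJ⟩ := exists_odd J hJ hne
    let J1 := J ⊔ Subgroup.zpowers (pd v)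
    have h1 : J ≤ J1 := le_sup_left
    have hv1 : pd v ∈ J1 := (le_sup_right : _ ≤ J1) (Subgroup.mem_zpowers _)
    have h2 := Subgroup.relIndex_mul_index h1
    have h3 : J.relIndex J1 ≠ 1 := fun h => hvJ (Subgroup.relIndex_eq_one.1 h hv1)
    have h4 : J.relIndex J1 ≠ 0 := fun h => hi J hJ (by rw [← h2, h, zero_mul])
    have h5 := hi J1 (hJ.trans h1)
    have h6 : 2 * J1.index ≤ J.index := by
      rw [← h2]; exact Nat.mul_le_mul_right _ (by omega)
    obtain ⟨Q, hQ, hc, hg⟩ := ih J1.index (by omega) J1 (hJ.trans h1) rfl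
    refine ⟨insert v Q, ?_, ?_, ?_⟩
    · intro u hu
      rcases Finset.mem_insert.1 hu with rfl | hu
      · exact hv
      · exact hQ u hu
    · calc 2 ^ (insert v Q).card ≤ 2 ^ (Q.card + 1) := Nat.pow_le_pow_right (by norm_num) (Finset.card_insert_le _ _)
        _ = 2 * 2 ^ Q.card := pow_succ' _ _
        _ ≤ _ := by omega
    · intro J' hJ' hv'
      refine hg J' (sup_le hJ' ?_) fun u hu => hv' u (Finset.mem_insert_of_mem hu)
      rw [Subgroup.zpowers_le]
      exact hv' v (Finset.mem_insert_self _ _)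
def ET (T : Finset (S M)) : Subgroup (Multiplicative (Dv M)) where
  carrier := {D | ∀ v, v ∉ T → Even (D.toAdd v)}
  one_mem' v _ := by simp
  mul_mem' {a b} hx hy v hv := by rw [toAdd_mul, Finsupp.add_apply]; exact (hx v hv).add (hy v hv)
  inv_mem' {a} hx v hv := by rw [toAdd_inv, Finsupp.neg_apply]; exact (hx v hv).neg
theorem mem_ET (T : Finset (S M)) (D : Multiplicative (Dv M)) : D ∈ ET T ↔ ∀ v, v ∉ T → Even (D.toAdd v) := Iff.rfl
theorem comap_ET (T : Finset (S M)) : (ET T).comap dv = VT (T : Set (S M)) := by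
  ext x
  rw [Subgroup.mem_comap, mem_ET, mem_VT]
  simp only [dv_apply, Finset.mem_coe]
theorem ET_empty : ET (∅ : Finset (S M)) = (powMonoidHom 2).range := by
  ext D
  constructor
  · intro h
    refine ⟨Multiplicative.ofAdd (D.toAdd.mapRange (fun n => n / 2) (by simp)), ?_⟩
    apply Multiplicative.toAdd.injective
    rw [powMonoidHom_apply, toAdd_pow, toAdd_ofAdd]
    ext v
    rw [Finsupp.smul_apply, Finsupp.mapRange_apply]
    obtain ⟨k, hk⟩ := h v (by simp)
    rw [hk]; simp; omega
  · rintro ⟨E, rfl⟩ v _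
    rw [powMonoidHom_apply, toAdd_pow, Finsupp.smul_apply]
    exact ⟨E.toAdd v, by simp [two_mul]⟩
theorem ET_mono {T T' : Finset (S M)} (h : T ⊆ T') : ET T ≤ ET T' := fun _ hD v hv => hD v fun h' => hv (h h')
theorem ET_le (T : Finset (S M)) (J : Subgroup (Multiplicative (Dv M))) (h2 : (powMonoidHom 2).range ≤ J)
    (hT : ∀ v ∈ T, pd v ∈ J) : ET T ≤ J := by
  classical
  intro D hD
  let E : Multiplicative (Dv M) := Multiplicative.ofAdd (D.toAdd.filter (· ∈ T))
  have : D = (D / E) * E := by simp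
  rw [this]
  refine mul_mem (h2 ?_) (gen J _ fun v hv => ?_)
  · rw [← ET_empty]
    intro v _
    rw [toAdd_div, Finsupp.sub_apply]
    by_cases hv : v ∈ T
    · simp [E, hv]
    · simpa [E, hv] using hD v hv
  · apply hT
    by_contra h
    exact hv (by simp [E, h])
theorem ET_idx (T : Finset (S M)) : 2 ^ T.card ≤ (ET (∅ : Finset (S M))).relIndex (ET T) ∧
    (ET (∅ : Finset (S M))).relIndex (ET T) ≠ 0 := by
  classical
  have hsub : ∀ D ∈ ET T, ∀ E ∈ ET T, (∀ v ∈ T, ((D.toAdd v : ℤ) : ZMod 2) = (E.toAdd v : ℤ)) → D / E ∈ ET (∅ : Finset (S M)) := by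
    intro D hD E hE h v _
    rw [toAdd_div, Finsupp.sub_apply]
    by_cases hv : v ∈ T
    · rw [← ZMod.intCast_zmod_eq_zero_iff_dvd .. |>.trans even_iff_two_dvd.symm]
      push_cast
      exact sub_eq_zero.2 (h v hv)
    · exact (hD v hv).sub (hE v hv)
  have hne := (idx_le (T := T → ZMod 2) (ET ∅) (ET T) (fun D v => ((D.toAdd v.1 : ℤ) : ZMod 2)) (by
    intro D hD E hE h
    exact hsub D hD E hE fun v hv => congrFun h ⟨v, hv⟩)).2
  refine ⟨?_, hne⟩
  have : Finite (ET T ⧸ (ET (∅ : Finset (S M))).subgroupOf (ET T)) := Nat.finite_of_card_ne_zero hne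
  rw [← Finset.card_powerset]
  have hcard : T.powerset.card = Nat.card T.powerset := by rw [Nat.card_eq_fintype_card, Fintype.card_coe]
  rw [hcard]
  let f : T.powerset → Multiplicative (Dv M) := fun A => Multiplicative.ofAdd (∑ v ∈ A.1, Finsupp.single v 1)
  have hf : ∀ A v, (f A).toAdd v = if v ∈ A.1 then 1 else 0 := by
    intro A v
    simp [f, Finsupp.finsetSum_apply, Finsupp.single_apply]
  have hfm : ∀ A, f A ∈ ET T := by
    intro A v hv
    rw [hf, if_neg]
    · exact Even.zero
    · exact fun h => hv (Finset.mem_powerset.1 A.2 h)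
  refine Nat.card_le_card_of_injective (fun A => (QuotientGroup.mk ⟨f A, hfm A⟩ : ET T ⧸ (ET (∅ : Finset (S M))).subgroupOf (ET T))) ?_
  intro A B h
  rw [QuotientGroup.eq, Subgroup.mem_subgroupOf] at h
  apply Subtype.ext
  ext v
  have h1 : Even ((f A)⁻¹ * f B |>.toAdd v) := h v (by simp)
  rw [toAdd_mul, toAdd_inv, Finsupp.add_apply, Finsupp.neg_apply, hf, hf] at h1
  by_cases hA : v ∈ A.1 <;> by_cases hB : v ∈ B.1 <;> simp [hA, hB] at h1 ⊢
theorem VT_idx (T : Finset (S M)) (H : Subgroup (Multiplicative (Dv M))) (hH : I2P M ≤ H)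
    (hT : ∀ v ∈ T, pd v ∈ H) :
    2 ^ T.card ≤ (I2P M).relIndex H * (VT (∅ : Set (S M))).relIndex (VT (T : Set (S M))) ∧
    (VT (∅ : Set (S M))).relIndex (VT (T : Set (S M))) ≠ 0 := by
  have hle : ET T ≤ H := ET_le T H (le_sup_right.trans hH) hT
  have h2 : ET (∅ : Finset (S M)) ≤ I2P M := by rw [ET_empty]; exact le_sup_right
  have hm := ET_mono (Finset.empty_subset T)
  obtain ⟨h3, h4⟩ := ET_idx T
  have h5 := Subgroup.relIndex_mul_relIndex (ET ∅) (I2P M ⊓ ET T) (ET T) (le_inf h2 hm) inf_le_right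
  rw [Subgroup.inf_relIndex_right] at h5
  have h6 : I2P M ⊓ ET T = (VT (T : Set (S M))).map dv ⊔ ET ∅ := by
    apply le_antisymm
    · intro D hD
      obtain ⟨_, ⟨x, rfl⟩, e, he, rfl⟩ := Subgroup.mem_sup.1 (show D ∈ I2P M from hD.1)
      rw [← ET_empty] at he
      refine Subgroup.mem_sup.2 ⟨_, ⟨x, ?_, rfl⟩, e, he, rfl⟩
      rw [← comap_ET]
      have := (Subgroup.mul_mem_cancel_right (ET T) (hm he)).1 hD.2
      exact this
    · refine sup_le ?_ (le_inf h2 hm)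
      rintro _ ⟨x, hx, rfl⟩
      refine ⟨(le_sup_left : _ ≤ I2P M) ⟨x, rfl⟩, ?_⟩
      rw [← comap_ET] at hx
      exact hx
  rw [h6, Subgroup.relIndex_sup_right, ← Subgroup.relIndex_comap, comap_ET] at h5
  simp only [Finset.coe_empty] at h5
  have hI : (I2P M).relIndex H ≠ 0 := fun h => by
    have h7 := Subgroup.relIndex_mul_index hH
    rw [h, zero_mul] at h7
    exact dv_index (M := M) (Nat.eq_zero_of_zero_dvd (h7 ▸ Subgroup.index_dvd_of_le le_sup_left))
  have h8 := Subgroup.relIndex_le_of_le_right hle hI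
  refine ⟨?_, fun h => h4 (by rw [← h5, h, zero_mul])⟩
  calc _ ≤ _ := h3
    _ = _ := h5.symm
    _ ≤ _ := by rw [mul_comm]; exact Nat.mul_le_mul_right _ h8
end
end NF
end
section
set_option linter.unusedSectionVars false
namespace NF
open NumberField Amb IsDedekindDomain
open scoped Pointwise
section
variable {M N : Type*} [Field M] [NumberField M] [Field N] [NumberField N] [Algebra M N]
variable {σ : N ≃ₐ[M] N} {x : Mˣ} {η : N}
noncomputable def Hs (σ : N ≃ₐ[M] N) : Subgroup (Multiplicative (Dv M)) :=
  ((nu (td σ)).range ⊔ (fx (sg σ)).map dv).comap (xd M N)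
theorem Hs_idx (σ : N ≃ₐ[M] N) : (Hs σ).index = ((nu (td σ)).range ⊔ (fx (sg σ)).map dv).relIndex (xd M N).range :=
  Subgroup.index_comap _ _
theorem nu_xd (σ : N ≃ₐ[M] N) (D : Multiplicative (Dv M)) : xd M N (D ^ 2) = nu (td σ) (xd M N D) := by
  apply Multiplicative.toAdd.injective
  rw [nu_apply, toAdd_mul, td_apply, map_pow, toAdd_pow, two_smul]
  congr 1
  exact (exd_smul σ D.toAdd).symm
theorem inc_fx (σ : N ≃ₐ[M] N) (y : Mˣ) : inc M N y ∈ fx (sg σ) := by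
  rw [mem_fx, sg_apply]
  ext
  exact σ.commutes _
theorem xd_dv (y : Mˣ) : xd M N (dv y) = dv (inc M N y) := by
  apply Multiplicative.toAdd.injective
  rw [dv_inc]; rfl
theorem I2P_le (σ : N ≃ₐ[M] N) : I2P M ≤ Hs σ := by
  refine sup_le ?_ ?_
  · rintro _ ⟨y, rfl⟩
    refine (le_sup_right : _ ≤ (nu (td σ)).range ⊔ (fx (sg σ)).map dv) ?_
    rw [xd_dv]
    exact ⟨_, inc_fx σ y, rfl⟩
  · rintro _ ⟨D, rfl⟩
    refine (le_sup_left : _ ≤ (nu (td σ)).range ⊔ (fx (sg σ)).map dv) ?_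
    rw [powMonoidHom_apply, nu_xd σ]
    exact ⟨_, rfl⟩
theorem Qe.pd_mem (e : Qe σ x η) (v : S M) (hv : v ∈ odd M) (hx : x ∈ Loc (P1 v)) : pd v ∈ Hs σ := by
  obtain ⟨w, rfl⟩ := exists_above (N := N) v
  exact (le_sup_left : _ ≤ (nu (td σ)).range ⊔ (fx (sg σ)).map dv) (e.q.split_mem w (e.split w hv hx))
theorem loc_up (w : S N) (y : Mˣ) (h : y ∈ Loc (P1 (bel M w))) : inc M N y ∈ Loc (P1 w) := by
  obtain ⟨s, hs⟩ := h
  refine ⟨inc M N s, ?_⟩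
  change w.valuation N (algebraMap M N y * (algebraMap M N s) ^ 2 - 1) < 1
  rw [← map_pow, ← map_mul, ← map_one (algebraMap M N), ← map_sub, val_bel]
  exact pow_lt_one₀ zero_le hs (ram_ne_zero w)
theorem odd_bel (w : S N) (h : w ∈ odd N) : bel M w ∈ odd M := by
  have h1 := ord_bel (M := M) w (tw M)
  have h2 : inc M N (tw M) = tw N := by
    ext
    change algebraMap M N (tw M : M) = (tw N : N)
    rw [tw_val, tw_val]
    exact (map_ofNat (algebraMap M N) 2)
  rw [h2, show ord w (tw N) = 0 from h] at h1
  have := ram_ne_zero (M := M) w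
  change ord (bel M w) (tw M) = 0
  rcases mul_eq_zero.1 h1.symm with h | h
  · exact absurd (by exact_mod_cast h) this
  · exact h
theorem Qe.sq_up (e : Qe σ x η) (v : Mˣ) (h : inc M N v ∈ NF.sq N) : v ∈ NF.sq M ∨ v * x ∈ NF.sq M := by
  have := e.q.gal
  obtain ⟨β, hβ⟩ := (mem_sq _).1 h
  have hβ : (β : N) ^ 2 = algebraMap M N v := congrArg Units.val hβ
  have h1 : (σ β - β) * (σ β + β) = 0 := by
    have : σ (β : N) ^ 2 = (β : N) ^ 2 := by rw [← map_pow, hβ, AlgEquiv.commutes]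
    linear_combination this
  rcases mul_eq_zero.1 h1 with h2 | h2
  · left
    obtain ⟨y, hy⟩ := fixed_two σ e.q.all (β : N) (sub_eq_zero.1 h2)
    have hy2 : y ^ 2 = v := by apply (algebraMap M N).injective; rw [map_pow, hy, hβ]
    have hy0 : y ≠ 0 := by rintro rfl; exact v.ne_zero (by rw [← hy2]; simp)
    exact (mem_sq _).2 ⟨Units.mk0 y hy0, Units.ext hy2⟩
  · right
    obtain ⟨y, hy⟩ := fixed_two σ e.q.all (β * η : N) (by
      rw [map_mul, e.neg, eq_neg_of_add_eq_zero_left h2]; ring)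
    have hy2 : y ^ 2 = v * x := by apply (algebraMap M N).injective; rw [map_pow, hy, mul_pow, hβ, e.sq, map_mul]
    have hy0 : y ≠ 0 := by rintro rfl; exact (v * x).ne_zero (by rw [Units.val_mul, ← hy2]; simp)
    exact (mem_sq _).2 ⟨Units.mk0 y hy0, Units.ext hy2⟩
end
section
variable {M N : Type} [Field M] [NumberField M] [Field N] [NumberField N] [Algebra M N]
variable {σ : N ≃ₐ[M] N} {a : Mˣ} {η : N}
theorem Qe.find (e : Qe σ a η) (ha : a ∈ VT (∅ : Set (S M))) (v : Mˣ) (hv : v ∈ VT (∅ : Set (S M)))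
    (h1 : v ∉ NF.sq M) (h2 : v * a ∉ NF.sq M) (B : Finset (S M)) :
    ∃ w : S M, w ∉ B ∧ w ∈ odd M ∧ v ∉ Loc (P1 w) ∧ pd w ∈ Hs σ := by
  have hns : inc M N v ∉ NF.sq N := fun h => (e.sq_up v h).elim h1 h2
  have hfin : {w : S N | bel M w ∈ B}.Finite := by
    have : {w : S N | bel M w ∈ B} = ⋃ v ∈ B, {w : S N | bel M w = v} := by ext; simp
    rw [this]
    exact B.finite_toSet.biUnion fun v _ => bel_fiber v
  obtain ⟨P, hPB, hP, hvP⟩ := nonsplit (inc M N v) hns _ hfin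
  have hodd := odd_bel (M := M) P hP
  have hv1 : v ∉ Loc (P1 (bel M P)) := fun h => hvP (loc_up P v h)
  have hv2 : v * a ∉ Loc (P1 (bel M P)) := fun h => hvP (by
    have := loc_up (N := N) P _ h
    rw [map_mul] at this
    refine (Subgroup.mul_mem_cancel_right _ (sq_le_Loc _ ?_)).1 this
    exact (mem_sq _).2 ⟨Units.mk0 η e.ne_zero, Units.ext e.sq⟩)
  refine ⟨bel M P, hPB, hodd, hv1, e.pd_mem _ hodd ?_⟩
  have h3 := loc_mul (bel M P) v (v * a) (hv _ (by simp)) ((mul_mem hv ha) _ (by simp)) hv1 hv2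
  rw [← mul_assoc, ← pow_two] at h3
  exact (Subgroup.mul_mem_cancel_left _ (sq_le_Loc _ ((mem_sq _).2 ⟨v, rfl⟩))).1 h3
theorem Qe.greedy [IsTotallyReal M] (e : Qe σ a η) (ha : a ∈ VT (∅ : Set (S M))) (B : Finset (S M)) :
    ∃ T : Finset (S M), (∀ w ∈ T, w ∉ B ∧ w ∈ odd M ∧ pd w ∈ Hs σ) ∧
      (VL T).relIndex (VT ∅) = 2 ^ T.card ∧ (NF.sq M).relIndex (VT (∅ : Set (S M))) ≤ 2 * 2 ^ T.card := by
  classical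
  have hmain : ∀ m : ℕ, ∀ T : Finset (S M), (∀ w ∈ T, w ∉ B ∧ w ∈ odd M ∧ pd w ∈ Hs σ) →
      (VL T).relIndex (VT ∅) = 2 ^ T.card → (NF.sq M).relIndex (VT (∅ : Set (S M))) ≤ T.card + m →
      ∃ T : Finset (S M), (∀ w ∈ T, w ∉ B ∧ w ∈ odd M ∧ pd w ∈ Hs σ) ∧
      (VL T).relIndex (VT ∅) = 2 ^ T.card ∧ (NF.sq M).relIndex (VT (∅ : Set (S M))) ≤ 2 * 2 ^ T.card := by
    intro m
    induction m with
    | zero =>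
      intro T h1 h2 h3
      exact ⟨T, h1, h2, h3.trans (by have := Nat.lt_two_pow_self (n := T.card); omega)⟩
    | succ m ih =>
      intro T h1 h2 h3
      by_cases hA : ∀ v ∈ VL T ⊓ VT ∅, v ∈ NF.sq M ∨ v * a ∈ NF.sq M
      · refine ⟨T, h1, h2, ?_⟩
        rw [← h2, ← Subgroup.inf_relIndex_right (VL T),
          ← Subgroup.relIndex_mul_relIndex (NF.sq M) (VL T ⊓ VT ∅) (VT ∅) (le_inf (sq_le_VL _) (sq_le_VT _)) inf_le_right]
        refine Nat.mul_le_mul_right _ ?_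
        refine Nat.le_of_dvd (by norm_num) (Subgroup.relIndex_dvd_two_iff.2 ?_)
        by_cases h : ∀ v ∈ VL T ⊓ VT (∅ : Set (S M)), v ∈ NF.sq M
        · exact ⟨1, one_mem _, fun b hb => Or.inr (h b hb)⟩
        · push Not at h
          obtain ⟨c, hc, hcs⟩ := h
          have hca := (hA c hc).resolve_left hcs
          refine ⟨c, hc, fun b hb => (hA b hb).symm.imp_left fun h => ?_⟩
          have := mul_mem h hca
          rw [mul_mul_mul_comm, ← pow_two a] at this
          exact (Subgroup.mul_mem_cancel_right _ ((mem_sq _).2 ⟨a, rfl⟩)).1 this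
      · push Not at hA
        obtain ⟨v, hv, hv1, hv2⟩ := hA
        obtain ⟨w, hw, hodd, hvw, hH⟩ := e.find ha v hv.2 hv1 hv2 (B ∪ T)
        have hwT : w ∉ T := fun h => hw (Finset.mem_union_right _ h)
        refine ih (insert w T) ?_ ?_ ?_
        · intro u hu
          rcases Finset.mem_insert.1 hu with rfl | hu
          · exact ⟨fun h => hw (Finset.mem_union_left _ h), hodd, hH⟩
          · exact h1 u hu
        · have : VL (insert w T) = Loc (P1 w) ⊓ VL T := by
            ext x; simp [mem_VL]
          rw [this, ← Subgroup.relIndex_inf_mul_relIndex, h2, Finset.card_insert_of_notMem hwT, pow_succ']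
          congr 1
          have h4 := loc_idx w (VL T ⊓ VT ∅) fun y hy => hy.2 w (by simp)
          have h5 : (Loc (P1 w)).relIndex (VL T ⊓ VT ∅) ≠ 1 := fun h =>
            hvw (Subgroup.relIndex_eq_one.1 h hv)
          omega
        · rw [Finset.card_insert_of_notMem hwT]; omega
  refine hmain _ ∅ (by simp) ?_ (Nat.le_add_left _ _)
  have : VL (∅ : Finset (S M)) = ⊤ := by
    ext x; simp [mem_VL]
  rw [this]; simp
theorem Qe.second [IsTotallyReal M] (h2 : SqF2 M) (e : Qe σ a η) (ha : a ∈ VT (∅ : Set (S M))) :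
    (Hs σ).index ≤ 2 := by
  classical
  by_contra! hlt
  obtain ⟨Q, hQ, hQc, hQg⟩ := exists_Q (I2P M) le_sup_left
  obtain ⟨T, hT, hTi, hTc⟩ := e.greedy ha Q
  set n := Module.finrank ℚ M
  obtain ⟨hV1, hV2⟩ := VT_idx T (Hs σ) (I2P_le σ) fun v hv => (hT v hv).2.2
  have hI := Subgroup.relIndex_mul_index (I2P_le σ)
  have hI0 : (I2P M).index ≠ 0 := fun h => dv_index (M := M) (Nat.eq_zero_of_zero_dvd (h ▸ Subgroup.index_dvd_of_le (le_sup_left)))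
  have hI1 : (I2P M).relIndex (Hs σ) ≠ 0 := fun h => hI0 (by rw [← hI, h, zero_mul])
  have hle : VT (∅ : Set (S M)) ≤ VT (T : Set (S M)) := fun x hx v _ => hx v (by simp)
  have hmul := Subgroup.relIndex_mul_relIndex (NF.sq M) _ _ (sq_le_VT _) hle
  have hcV := card_V (M := M)
  set G : Subgroup Mˣ := TP M ⊓ (Loc (P4 M) ⊓ VL Q) with hG
  have hb1 := TP_idx (VT (T : Set (S M)))
  have hb2 := P4_idx h2 (VT (T : Set (S M))) (fun x hx v hv => hx v fun h => hv (hT v h).2.1)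
  have hb3 := VL_idx Q (VT (T : Set (S M))) (fun w hw y hy => hy w fun h => (hT w h).1 hw)
  have hGi : G.relIndex (VT (T : Set (S M))) ≤ 2 ^ n * (2 ^ n * 2 ^ Q.card) :=
    (Subgroup.relIndex_inf_le ..).trans (Nat.mul_le_mul hb1.1 ((Subgroup.relIndex_inf_le ..).trans (Nat.mul_le_mul hb2.1 hb3.1)))
  have hG0 : G.relIndex (VT (T : Set (S M))) ≠ 0 :=
    Subgroup.relIndex_inf_ne_zero hb1.2 (Subgroup.relIndex_inf_ne_zero hb2.2 hb3.2)
  obtain ⟨x, hxV, hxG, hxs⟩ : ∃ x ∈ VT (T : Set (S M)), x ∈ G ∧ x ∉ NF.sq M := by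
    by_contra! hcon
    have hle2 : G ⊓ VT (T : Set (S M)) ≤ NF.sq M := fun x hx => hcon x hx.2 hx.1
    have h5 := Subgroup.relIndex_le_of_le_left hle2 (L := VT (T : Set (S M))) (by rwa [Subgroup.inf_relIndex_right])
    rw [Subgroup.inf_relIndex_right, ← hmul] at h5
    have h6 := h5.trans hGi
    set A := (I2P M).relIndex (Hs σ)
    set C := (VT (∅ : Set (S M))).relIndex (VT (T : Set (S M)))
    set E := (NF.sq M).relIndex (VT (∅ : Set (S M)))
    have h7 : E * E ≤ 2 * (A * (E * C)) := by
      calc E * E ≤ E * (2 * 2 ^ T.card) := Nat.mul_le_mul_left _ hTc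
        _ ≤ E * (2 * (A * C)) := by gcongr
        _ = _ := by ring
    have h8 : E * C ≤ 2 ^ n * (2 ^ n * (I2P M).index) := h6.trans (by gcongr)
    have h9 : E * E ≤ 2 * (A * (2 ^ n * (2 ^ n * (I2P M).index))) := h7.trans (by gcongr)
    rw [hcV] at h9
    have hp : 0 < 2 ^ n * (2 ^ n * (I2P M).index) := by positivity
    have h10 : (I2P M).index ≤ 2 * A := by
      refine le_of_mul_le_mul_left (a := 2 ^ n * (2 ^ n * (I2P M).index)) ?_ hp
      calc _ = _ := by ring
        _ ≤ _ := h9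
        _ = _ := by ring
    rw [← hI, mul_comm] at h10
    have h11 := Nat.le_of_mul_le_mul_right h10 (Nat.pos_of_ne_zero hI1)
    omega
  obtain ⟨N', _, _, _, τ, ξ, e'⟩ := exists_quad x hxs
  have hg := e'.q.gal
  have hr := e'.real hxG.1
  let T' := T.filter fun w => ¬ Even (ord w x)
  have hxT' : x ∈ VT (T' : Set (S M)) := by
    intro v hv
    by_cases h : v ∈ T
    · by_contra h'
      exact hv (Finset.mem_coe.2 (Finset.mem_filter.2 ⟨h, h'⟩))
    · exact hxV v h
  have hpar := e'.q.par T' fun w hw => ram_of_diff w (e'.diff_away _ hxT' hxG.2.1 w (by simpa using hw))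
  have hamb := e'.q.amb
  have htop : Hs τ = ⊤ := hQg _ (I2P_le τ) fun v hv => e'.pd_mem v (hQ v hv) (hxG.2.2 v hv)
  rw [← Hs_idx, htop, Subgroup.index_top, mul_one] at hamb
  have hY0 : (nu (sg τ)).range.relIndex (fx (sg τ) ⊓ (nu (td τ)).range.comap dv) ≠ 0 := fun h =>
    hpar.2 (by rw [← hamb, h])
  have hVY : (VT (∅ : Set (S M))).map (inc M N') ≤ fx (sg τ) ⊓ (nu (td τ)).range.comap dv := by
    rintro _ ⟨b, hb, rfl⟩
    refine ⟨inc_fx τ b, ?_⟩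
    change dv (inc M N' b) ∈ (nu (td τ)).range
    rw [← xd_dv]
    have : b ∈ (ET (∅ : Finset (S M))).comap dv := by rw [comap_ET]; simpa using hb
    rw [ET_empty] at this
    obtain ⟨D, hD⟩ := this
    rw [powMonoidHom_apply] at hD
    rw [← hD, nu_xd τ]
    exact ⟨_, rfl⟩
  have h5 := Subgroup.relIndex_le_of_le_right hVY hY0
  have h50 : (nu (sg τ)).range.relIndex ((VT (∅ : Set (S M))).map (inc M N')) ≠ 0 := fun h =>
    hY0 (Subgroup.relIndex_eq_zero_of_le_right hVY h)
  rw [← Subgroup.relIndex_comap] at h5 h50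
  have h6 : (nu (sg τ)).range.comap (inc M N') ⊓ VT ∅ ≤ VL T' := by
    rintro b ⟨hb1, hb⟩ w hw
    obtain ⟨β, hβ⟩ := hb1
    rw [nu_apply] at hβ
    refine e'.norm_loc w (Finset.mem_filter.1 hw).2 b (hb w (by simp)) (β : N') ?_
    exact (congrArg Units.val hβ).symm
  rw [← Subgroup.inf_relIndex_right] at h5 h50
  have h7 := Subgroup.relIndex_le_of_le_left h6 h50
  have h8 : 2 ^ T'.card ≤ (VL T').relIndex (VT ∅) := by
    have hsp : VL T = VL (T \ T') ⊓ VL T' := by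
      ext y
      simp only [mem_VL, Subgroup.mem_inf, Finset.mem_sdiff]
      constructor
      · exact fun h => ⟨fun w hw => h w hw.1, fun w hw => h w (Finset.filter_subset _ _ hw)⟩
      · rintro ⟨h1, h2⟩ w hw
        by_cases h : w ∈ T'
        exacts [h2 w h, h1 w ⟨hw, h⟩]
    have h9 := hTi
    rw [hsp, ← Subgroup.relIndex_inf_mul_relIndex] at h9
    have h10 := (VL_idx (T \ T') (VL T' ⊓ VT ∅) fun w _ y hy => hy.2 w (by simp)).1
    have h11 : (T \ T').card + T'.card = T.card := Finset.card_sdiff_add_card_eq_card (Finset.filter_subset _ _)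
    refine le_of_mul_le_mul_left (a := 2 ^ (T \ T').card) ?_ (by positivity)
    rw [← pow_add, h11, ← h9]
    gcongr
  have h9 := h8.trans (h7.trans h5)
  have h10 : 0 < 2 ^ T'.card := by positivity
  omega
end
end NF
end
section
set_option linter.unusedSectionVars false
namespace NF
open NumberField Amb IsDedekindDomain
open scoped Pointwise
section
variable {M N : Type} [Field M] [NumberField M] [Field N] [NumberField N] [Algebra M N]
variable {σ : N ≃ₐ[M] N}
theorem Qd.hn [IsTotallyReal M] [IsTotallyReal N] (h2 : SqF2 M) (hu : Unr M N) (q : Qd σ) (y : Nˣ) (hy : σ • y = y)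
    (D : Dv N) (hD : (dv y).toAdd = D + σ • D) : ∃ β : Nˣ, β * σ • β = y := by
  have := q.gal
  obtain ⟨a, η, e, -⟩ := q.exists_eta
  have ha : a ∈ VT (∅ : Set (S M)) := by
    intro v _
    obtain ⟨w, rfl⟩ := exists_above (N := N) v
    have h1 := ord_bel (M := M) w a
    rw [ram_one hu, Nat.cast_one, one_mul] at h1
    have h3 : inc M N a = (Units.mk0 η e.ne_zero) ^ 2 := Units.ext e.sq.symm
    rw [← h1, h3, ord_pow]
    exact ⟨ord w (Units.mk0 η e.ne_zero), by push_cast; ring⟩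
  have h3 := e.second h2 ha
  have h4 := q.amb
  have h5 := (q.par ∅ fun w _ => ram_one hu w)
  rw [← Hs_idx] at h4
  rw [Finset.card_empty, pow_zero] at h5
  have h6 : (xd M N).range.relIndex (fx (td σ)) = 1 := by omega
  have h7 : (Hs σ).index ≠ 0 := fun h =>
    dv_index (M := M) (Nat.eq_zero_of_zero_dvd (h ▸ Subgroup.index_dvd_of_le (le_sup_left.trans (I2P_le σ))))
  rw [h6, one_mul] at h4
  have h8 : (nu (sg σ)).range.relIndex (fx (sg σ) ⊓ (nu (td σ)).range.comap dv) = 1 := by omega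
  obtain ⟨β, hβ⟩ := Subgroup.relIndex_eq_one.1 h8 (show y ∈ _ from ⟨(mem_fx _ _).2 hy, by
    refine ⟨Multiplicative.ofAdd D, ?_⟩
    apply Multiplicative.toAdd.injective
    exact hD.symm⟩)
  exact ⟨β, hβ⟩
end
section
variable {K M N : Type*} [Field K] [NumberField K] [Field M] [NumberField M] [Field N] [NumberField N]
  [Algebra K M] [Algebra M N] [Algebra K N] [IsScalarTower K M N]
theorem unr_tower (h : Unr K N) : Unr K M ∧ Unr M N := by
  have h1 : differentIdeal (𝓞 K) (𝓞 N) = differentIdeal (𝓞 M) (𝓞 N) * (differentIdeal (𝓞 K) (𝓞 M)).map (algebraMap (𝓞 M) (𝓞 N)) :=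
    differentIdeal_eq_differentIdeal_mul_differentIdeal (𝓞 K) (𝓞 M) (𝓞 N)
  rw [show differentIdeal (𝓞 K) (𝓞 N) = ⊤ from h] at h1
  have h2 : differentIdeal (𝓞 M) (𝓞 N) = ⊤ := top_le_iff.1 (h1.le.trans Ideal.mul_le_left)
  refine ⟨?_, h2⟩
  by_contra h3
  obtain ⟨P, hP, hle⟩ := Ideal.exists_le_maximal _ h3
  have h4 : P ≠ ⊥ := by
    rintro rfl
    exact differentIdeal_ne_bot (A := 𝓞 K) (B := 𝓞 M) (le_bot_iff.1 hle)
  obtain ⟨w, hw⟩ := exists_above (N := N) (⟨P, hP.isPrime, h4⟩ : S M)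
  have h5 : (differentIdeal (𝓞 K) (𝓞 M)).map (algebraMap (𝓞 M) (𝓞 N)) ≤ w.asIdeal := by
    rw [Ideal.map_le_iff_le_comap]
    refine hle.trans ?_
    have := congrArg HeightOneSpectrum.asIdeal hw
    exact this.ge
  exact w.isPrime.ne_top (top_le_iff.1 (h1.le.trans (Ideal.mul_le_right.trans h5)))
theorem unr_comp (h : Unr K M) (h' : Unr M N) : Unr K N := by
  have h1 : differentIdeal (𝓞 K) (𝓞 N) = differentIdeal (𝓞 M) (𝓞 N) * (differentIdeal (𝓞 K) (𝓞 M)).map (algebraMap (𝓞 M) (𝓞 N)) :=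
    differentIdeal_eq_differentIdeal_mul_differentIdeal (𝓞 K) (𝓞 M) (𝓞 N)
  rw [show differentIdeal (𝓞 M) (𝓞 N) = ⊤ from h', show differentIdeal (𝓞 K) (𝓞 M) = ⊤ from h, Ideal.map_top,
    Ideal.top_mul] at h1
  exact h1
theorem bel_smul2 (g : N ≃ₐ[K] N) (r : M ≃ₐ[K] M) (hr : ∀ m, algebraMap M N (r m) = g (algebraMap M N m)) (w : S N) :
    bel M (g • w) = r • bel M w := by
  apply HeightOneSpectrum.ext
  ext x
  show algebraMap (𝓞 M) (𝓞 N) x ∈ g • w.asIdeal ↔ x ∈ r • (bel M w).asIdeal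
  rw [Ideal.mem_pointwise_smul_iff_inv_smul_mem, Ideal.mem_pointwise_smul_iff_inv_smul_mem]
  have : g⁻¹ • algebraMap (𝓞 M) (𝓞 N) x = algebraMap (𝓞 M) (𝓞 N) (r⁻¹ • x) := by
    rw [inv_smul_eq_iff]
    apply RingOfIntegers.ext
    have := hr (r⁻¹ (x : M))
    rw [show r (r⁻¹ (x : M)) = x from r.apply_symm_apply _] at this
    exact this
  rw [this]
  rfl
theorem exd_smul2 (hu : Unr M N) (g : N ≃ₐ[K] N) (r : M ≃ₐ[K] M) (hr : ∀ m, algebraMap M N (r m) = g (algebraMap M N m))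
    (f : Dv M) : g • exd M N f = exd M N (r • f) := by
  ext w
  rw [dsmul_apply, exd_apply, exd_apply, ram_one hu, ram_one hu, dsmul_apply]
  congr 2
  have := bel_smul2 g r hr (g⁻¹ • w)
  rw [smul_inv_smul] at this
  rw [this, inv_smul_smul]
end
section
variable {K N : Type} [Field K] [NumberField K] [Field N] [NumberField N] [Algebra K N]
theorem exists_mid [IsGalois K N] (z : N ≃ₐ[K] N) (hz : ∀ g, z * g = g * z) (h1 : z ≠ 1) (h2 : z * z = 1) :
    ∃ (M : Type) (_ : Field M) (_ : NumberField M) (_ : Algebra K M) (_ : Algebra M N) (_ : IsScalarTower K M N)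
      (_ : IsGalois K M) (σ : N ≃ₐ[M] N), Qd σ ∧ (∀ x, σ x = z x) ∧ Module.finrank K M * 2 = Module.finrank K N := by
  let H := Subgroup.zpowers z
  have hmem : ∀ g ∈ H, g = 1 ∨ g = z := by
    intro g hg
    have : H ≤ ({ carrier := {1, z}, one_mem' := by simp, mul_mem' := by
                    rintro a b (rfl | rfl) (rfl | rfl) <;> simp [h2], inv_mem' := by
                    rintro a (rfl | rfl) <;> simp [inv_eq_of_mul_eq_one_left h2] } : Subgroup (N ≃ₐ[K] N)) := by
      rw [Subgroup.zpowers_le]; exact Or.inr rfl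
    exact this hg
  have hn : H.Normal := ⟨fun n hn g => by
    rcases hmem n hn with rfl | rfl
    · simpa using H.one_mem
    · rw [← hz, mul_inv_cancel_right]; exact Subgroup.mem_zpowers _⟩
  let M := IntermediateField.fixedField H
  have : NumberField M := NumberField.of_intermediateField M
  have hcard : Nat.card H = 2 := by
    rw [Nat.card_zpowers, orderOf_eq_prime (by rw [pow_two]; exact h2) h1]
  have hd : Module.finrank M N = 2 := by
    rw [IntermediateField.finrank_fixedField_eq_card, hcard]
  have hfix : ∀ τ : N ≃ₐ[M] N, τ.restrictScalars K ∈ H := by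
    intro τ
    rw [← IntermediateField.fixingSubgroup_fixedField H, IntermediateField.mem_fixingSubgroup_iff]
    intro x hx
    exact τ.commutes ⟨x, hx⟩
  let σ : N ≃ₐ[M] N := { z with
    commutes' := fun m => by
      have := m.2
      exact (IntermediateField.mem_fixedField_iff H _).1 this z (Subgroup.mem_zpowers _) }
  have hσ : ∀ x, σ x = z x := fun x => rfl
  refine ⟨M, inferInstance, this, inferInstance, inferInstance, inferInstance, ?_, σ, ⟨?_, ?_, ?_, hd⟩, hσ, ?_⟩
  · exact IsGalois.of_fixedField_normal_subgroup H
  · intro x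
    rw [hσ, hσ]
    exact AlgEquiv.congr_fun h2 x
  · intro τ
    rcases hmem _ (hfix τ) with h | h
    · left; ext x; exact AlgEquiv.congr_fun h x
    · right; ext x; exact AlgEquiv.congr_fun h x
  · intro h
    apply h1
    ext x
    exact AlgEquiv.congr_fun h x
  · rw [← hd]
    exact Module.finrank_mul_finrank K M N
end
end NF
end
section
set_option linter.unusedSectionVars false
namespace NF
open NumberField Amb IsDedekindDomain
open scoped Pointwise
section
variable {K L : Type} [Field K] [NumberField K] [Field L] [NumberField L] [Algebra K L]
structure Ex {E : Type} [Group E] (ι : Lˣ →* E) (π : E →* (L ≃ₐ[K] L)) (φ : E → Dv L) : Prop where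
  inj : Function.Injective ι
  surj : Function.Surjective π
  ex : ι.range = π.ker
  cj : ∀ g x, g * ι x * g⁻¹ = ι (π g • x)
  cr : ∀ g h, φ (g * h) = φ g + π g • φ h
  di : ∀ x, φ (ι x) = (dv x).toAdd
variable {E : Type} [Group E] {ι : Lˣ →* E} {π : E →* (L ≃ₐ[K] L)} {φ : E → Dv L}
theorem Ex.pi (X : Ex ι π φ) (x : Lˣ) : π (ι x) = 1 := by
  have : ι x ∈ π.ker := X.ex ▸ ⟨x, rfl⟩
  exact this
theorem Ex.lift (X : Ex ι π φ) {g : E} (h : π g = 1) : ∃ x, ι x = g := by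
  have : g ∈ ι.range := X.ex ▸ (MonoidHom.mem_ker.2 h)
  exact this
theorem Ex.cj' (X : Ex ι π φ) (g : E) (x : Lˣ) : g * ι x = ι (π g • x) * g := by
  rw [← X.cj, inv_mul_cancel_right]
theorem Ex.one (X : Ex ι π φ) : φ 1 = 0 := by
  have := X.cr 1 1
  rw [mul_one, map_one, one_smul] at this
  exact left_eq_add.1 this
theorem Ex.shift (X : Ex ι π φ) (D : Dv L) : Ex ι π (fun g => φ g - D + π g • D) := by
  refine ⟨X.inj, X.surj, X.ex, X.cj, fun g h => ?_, fun x => ?_⟩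
  · simp only [X.cr, map_mul, mul_smul, smul_add, smul_sub]
    abel
  · simp only [X.di, X.pi, one_smul]
    abel
variable {M : Type} [Field M] [NumberField M] [Algebra K M] [Algebra M L] [IsScalarTower K M L]
variable {σ : L ≃ₐ[M] L} {z : L ≃ₐ[K] L}
theorem dsm (h : ∀ x, σ x = z x) (D : Dv L) : σ • D = z • D := by
  ext w
  rw [dsmul_apply, dsmul_apply]
  congr 1
  apply HeightOneSpectrum.ext
  rw [smul_asIdeal, smul_asIdeal]
  ext x
  rw [Ideal.mem_pointwise_smul_iff_inv_smul_mem, Ideal.mem_pointwise_smul_iff_inv_smul_mem, inv_inv, inv_inv]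
  rw [show σ • x = z • x from RingOfIntegers.ext (h x)]
theorem usm (h : ∀ x, σ x = z x) (x : Lˣ) : σ • x = z • x := Units.ext (h x)
theorem Ex.inv [IsTotallyReal M] [IsTotallyReal L] (X : Ex ι π φ) (h2 : SqF2 M) (hu : Unr M L) (q : Qd σ)
    (hz : ∀ x, σ x = z x) : ∃ y : E, π y = z ∧ y * y = 1 := by
  obtain ⟨g, hg⟩ := X.surj z
  have hzz : z * z = 1 := by
    ext x
    have := q.inv x
    rwa [hz, hz] at this
  obtain ⟨b, hb⟩ := X.lift (g := g * g) (by rw [map_mul, hg, hzz])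
  have h1 : z • b = b := by
    apply X.inj
    rw [← hg, ← X.cj, hb]
    group
  have h3 : (dv b).toAdd = φ g + z • φ g := by rw [← X.di, hb, X.cr, hg]
  obtain ⟨β, hβ⟩ := q.hn h2 hu b ((usm hz b).trans h1) (φ g) (by rw [dsm hz, h3])
  refine ⟨ι β⁻¹ * g, by rw [map_mul, X.pi, one_mul, hg], ?_⟩
  rw [mul_assoc, ← mul_assoc g, X.cj' g, hg, mul_assoc, ← hb, ← map_mul, ← map_mul, ← hβ, ← usm hz, smul_inv', mul_comm β,
    inv_mul_cancel_left, inv_mul_cancel, map_one]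
theorem Ex.triv (X : Ex ι π φ) (q : Qd σ) (hz : ∀ x, σ x = z x) {y : E} (h1 : π y = z) (h2 : y * y = 1) :
    ∃ φ' : E → Dv L, Ex ι π φ' ∧ φ' y = 0 := by
  have h3 := X.cr y y
  rw [h2, X.one, h1, ← dsm hz] at h3
  obtain ⟨D, hD⟩ := q.hI (show Multiplicative.ofAdd (φ y) ∈ _ from by
    rw [MonoidHom.mem_ker]
    apply Multiplicative.toAdd.injective
    exact h3.symm)
  have h4 : D.toAdd - σ • D.toAdd = φ y := congrArg Multiplicative.toAdd hD
  refine ⟨_, X.shift D.toAdd, ?_⟩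
  simp only [h1, ← dsm hz, ← h4]
  abel
theorem Ex.cent (X : Ex ι π φ) (q : Qd σ) (hz : ∀ x, σ x = z x) (hc : ∀ g, z * g = g * z) {y : E} (h1 : π y = z)
    (h2 : y * y = 1) (g : L ≃ₐ[K] L) : ∃ h : E, π h = g ∧ h * y = y * h := by
  obtain ⟨h, rfl⟩ := X.surj g
  obtain ⟨a, ha⟩ := X.lift (g := h * y * h⁻¹ * y⁻¹) (by
    rw [map_mul, map_mul, map_mul, map_inv, map_inv, h1, ← hc]; group)
  have ha' : h * y * h⁻¹ = ι a * y := by rw [ha]; group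
  have h3 : a * z • a = 1 := by
    apply X.inj
    have : (ι a * y) * (ι a * y) = 1 := by
      rw [← ha']
      calc _ = h * (y * y) * h⁻¹ := by group
        _ = 1 := by rw [h2]; group
    rw [mul_assoc, ← mul_assoc y, X.cj', h1, mul_assoc, h2, mul_one, ← map_mul] at this
    rw [this, map_one]
  obtain ⟨u, hu⟩ := q.h90 (show a ∈ _ from by rw [MonoidHom.mem_ker, nu_apply, sg_apply, usm hz, h3])
  rw [di_apply, sg_apply, usm hz] at hu
  refine ⟨ι u⁻¹ * h, by rw [map_mul, X.pi, one_mul], ?_⟩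
  have h4 : h * y = ι a * y * h := by rw [← ha']; group
  rw [mul_assoc, h4, ← mul_assoc y, X.cj', h1, ← hu, ← mul_assoc, ← mul_assoc, ← map_mul]
  congr 3
  rw [smul_inv', div_eq_mul_inv, inv_mul_cancel_left]
end
end NF
end
section
set_option linter.unusedSectionVars false
namespace NF
open NumberField Amb IsDedekindDomain
open scoped Pointwise
section
variable {K L : Type} [Field K] [NumberField K] [Field L] [NumberField L] [Algebra K L]
variable {E : Type} [Group E] {ι : Lˣ →* E} {π : E →* (L ≃ₐ[K] L)} {φ : E → Dv L}
variable {M : Type} [Field M] [NumberField M] [Algebra K M] [Algebra M L] [IsScalarTower K M L]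
variable {σ : L ≃ₐ[M] L} {z : L ≃ₐ[K] L}
theorem Qd.fix_cases (q : Qd σ) (hz : ∀ x, σ x = z x) (g : L ≃ₐ[K] L)
    (h : ∀ m, g (algebraMap M L m) = algebraMap M L m) : g = 1 ∨ g = z := by
  rcases q.all { g with commutes' := h } with h | h
  · left; ext x; exact AlgEquiv.congr_fun h x
  · right; ext x; rw [← hz]; exact AlgEquiv.congr_fun h x
theorem Qd.inc_surj (q : Qd σ) (hz : ∀ x, σ x = z x) (x : Lˣ) (hx : z • x = x) : ∃ m, inc M L m = x := by
  have := q.gal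
  obtain ⟨m, hm⟩ := fixed_two σ q.all x.1 ((hz _).trans (congrArg Units.val hx))
  have h0 : m ≠ 0 := by rintro rfl; rw [map_zero] at hm; exact x.ne_zero hm.symm
  exact ⟨Units.mk0 m h0, Units.ext hm⟩
theorem Ex.down [IsGalois K L] [IsGalois K M] (X : Ex ι π φ) (hu : Unr M L) (q : Qd σ) (hz : ∀ x, σ x = z x)
    (hc : ∀ g, z * g = g * z) {y : E} (h1 : π y = z) (h2 : y * y = 1) (h3 : φ y = 0)
    (ih : ∀ (E : Type) [Group E] (ι : Mˣ →* E) (π : E →* (M ≃ₐ[K] M)) (φ : E → Dv M), Ex ι π φ →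
      ∃ S : Subgroup E, S ⊓ ι.range = ⊥ ∧ S.map π = ⊤) :
    ∃ S : Subgroup E, S ⊓ ι.range = ⊥ ∧ S.map π = ⊤ := by
  have := q.gal
  let E0 : Subgroup E := Subgroup.centralizer {y}
  have hE0 : ∀ g, g ∈ E0 ↔ y * g = g * y := fun g => Subgroup.mem_centralizer_singleton_iff.trans eq_comm
  have hE0' : ∀ g : E0, y * g = g * y := fun g => (hE0 _).1 g.2
  let y0 : E0 := ⟨y, (hE0 y).2 rfl⟩
  have hyy : y0 * y0 = 1 := Subtype.ext h2
  let C : Subgroup E0 := ⟨⟨⟨{1, y0}, by rintro a b (rfl | rfl) (rfl | rfl) <;> simp [hyy]⟩, by simp⟩,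
    by rintro a (rfl | rfl) <;> simp [inv_eq_of_mul_eq_one_left hyy]⟩
  have hC : ∀ c ∈ C, c = 1 ∨ c = y0 := fun c hc => hc
  have hy0 : y0 ∈ C := Or.inr rfl
  have : C.Normal := ⟨fun n hn g => by
    rcases hC n hn with rfl | rfl
    · rw [mul_one, mul_inv_cancel]; exact C.one_mem
    · rw [show g * y0 * g⁻¹ = y0 from by rw [mul_inv_eq_iff_eq_mul]; exact Subtype.ext (hE0' g).symm]
      exact hy0⟩
  let r : (L ≃ₐ[K] L) →* (M ≃ₐ[K] M) := AlgEquiv.restrictNormalHom M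
  have hr : ∀ g m, algebraMap M L (r g m) = g (algebraMap M L m) := fun g m => AlgEquiv.restrictNormal_commutes g M m
  have hrz : r z = 1 := by
    ext m
    apply (algebraMap M L).injective
    rw [hr, ← hz, σ.commutes]; rfl
  have hrk : ∀ g, r g = 1 → g = 1 ∨ g = z := fun g h => q.fix_cases hz g fun m => by rw [← hr, h]; rfl
  have hincz : ∀ m, z • inc M L m = inc M L m := fun m => Units.ext ((hz _).symm.trans (σ.commutes _))
  let i0 : Mˣ →* E0 := (ι.comp (inc M L)).codRestrict E0 fun m => by
    rw [hE0]
    change y * ι (inc M L m) = ι (inc M L m) * y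
    rw [X.cj', h1, hincz]
  have hi0 : ∀ m, (i0 m : E) = ι (inc M L m) := fun m => rfl
  have hiE : ∀ (g : E0) (x : Lˣ), ι x = g → ∃ m, i0 m = g := by
    intro g x hx
    have h4 : z • x = x := by
      apply X.inj
      have h5 := hE0' g
      rw [← hx, X.cj', h1] at h5
      exact mul_right_cancel h5
    obtain ⟨m, hm⟩ := q.inc_surj hz x h4
    exact ⟨m, Subtype.ext (by rw [hi0, hm, hx])⟩
  have hpsi : ∀ g : E0, ∃ D, exd M L D = φ g := by
    intro g
    have h4 : z • φ g = φ g := by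
      have h5 := congrArg φ (hE0' g)
      rw [X.cr, X.cr, h1, h3, smul_zero, zero_add, add_zero] at h5
      exact h5
    refine mem_exd _ (fun τ => ?_) (fun w => by rw [ram_one hu]; simp)
    rcases q.all τ with rfl | rfl
    · rw [one_smul]
    · rw [dsm hz, h4]
  choose ψ hψ using hpsi
  have hψy : ∀ g : E0, ψ (g * y0) = ψ g := by
    intro g
    apply exd_inj (N := L)
    rw [hψ, hψ]
    change φ (g * y) = _
    rw [X.cr, h3, smul_zero, add_zero]
  let π0 : E0 →* (M ≃ₐ[K] M) := r.comp (π.comp E0.subtype)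
  have hπ0 : ∀ g, π0 g = r (π g) := fun g => rfl
  let mk := QuotientGroup.mk' C
  have hmk : Function.Surjective mk := QuotientGroup.mk'_surjective C
  have hmke : ∀ a b, mk a = mk b → b = a ∨ b = a * y0 := by
    intro a b h
    have h5 : a⁻¹ * b ∈ C := QuotientGroup.eq.1 h
    rcases hC _ h5 with h | h
    · left; exact (inv_mul_eq_one.1 h).symm
    · right; rw [← h, mul_inv_cancel_left]
  have hmky : ∀ a, mk (a * y0) = mk a := by
    intro a
    rw [map_mul, show mk y0 = 1 from (QuotientGroup.eq_one_iff _).2 hy0, mul_one]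
  let π1 : E0 ⧸ C →* (M ≃ₐ[K] M) := QuotientGroup.lift C π0 (fun c hc => by
    rcases hC c hc with rfl | rfl
    · exact π0.ker.one_mem
    · change r (π y) = 1; rw [h1, hrz])
  have hπ1 : ∀ g, π1 (mk g) = r (π g) := fun g => rfl
  let ψ1 : E0 ⧸ C → Dv M := fun e => ψ e.out
  have hψ1 : ∀ g, ψ1 (mk g) = ψ g := by
    intro g
    have h5 : mk (Quotient.out (mk g)) = mk g := Quotient.out_eq _
    rcases hmke _ _ h5 with h | h
    · exact congrArg ψ h.symm
    · exact ((congrArg ψ h).trans (hψy _)).symm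
  have hker : ∀ g : E0, r (π g) = 1 → ∃ m, mk (i0 m) = mk g := by
    intro g hg
    rcases hrk _ hg with h | h
    · obtain ⟨x, hx⟩ := X.lift h
      obtain ⟨m, hm⟩ := hiE g x hx
      exact ⟨m, by rw [hm]⟩
    · obtain ⟨x, hx⟩ := X.lift (g := (g * y0 : E0)) (by
        change π (g * y) = 1
        rw [map_mul, h, h1, ← h1, ← map_mul, h2, map_one])
      obtain ⟨m, hm⟩ := hiE _ x hx
      exact ⟨m, by rw [hm, hmky]⟩
  have hzne : z ≠ 1 := by
    rintro rfl
    exact q.ne (by ext x; exact hz x)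
  have hinj : ∀ m, mk (i0 m) = 1 → m = 1 := by
    intro m hm
    rcases hmke 1 (i0 m) (by rw [hm, map_one]) with h | h
    · have h5 : ι (inc M L m) = ι 1 := by rw [map_one]; exact congrArg Subtype.val h
      have h6 := congrArg Units.val (X.inj h5)
      apply Units.ext
      apply (algebraMap M L).injective
      rw [Units.val_one, map_one]
      exact h6
    · exfalso
      have h5 : ι (inc M L m) = y := by rw [one_mul] at h; exact congrArg Subtype.val h
      have h6 := X.pi (inc M L m)
      rw [h5, h1] at h6
      exact hzne h6
  have X1 : Ex (mk.comp i0) π1 ψ1 := by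
    refine ⟨?_, ?_, ?_, ?_, ?_, ?_⟩
    · rw [injective_iff_map_eq_one]
      exact hinj
    · intro τ
      obtain ⟨g, hg⟩ := AlgEquiv.restrictNormalHom_surjective (F := K) (K₁ := M) L τ
      obtain ⟨h, hh, hh'⟩ := X.cent q hz hc h1 h2 g
      exact ⟨mk ⟨h, (hE0 h).2 hh'.symm⟩, by rw [hπ1]; rw [← hg]; exact congrArg r hh⟩
    · ext e
      obtain ⟨g, rfl⟩ := hmk e
      rw [MonoidHom.mem_ker, hπ1]
      constructor
      · rintro ⟨m, hm⟩
        have h5 := congrArg π1 hm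
        rw [hπ1] at h5
        rw [← h5]
        change r (π (ι (inc M L m))) = 1
        rw [X.pi, map_one]
      · intro h
        exact hker g h
    · intro e m
      obtain ⟨g, rfl⟩ := hmk e
      rw [hπ1]
      change mk g * mk (i0 m) * (mk g)⁻¹ = mk (i0 _)
      rw [← map_inv, ← map_mul, ← map_mul]
      congr 1
      apply Subtype.ext
      change (g : E) * ι (inc M L m) * (g : E)⁻¹ = ι (inc M L _)
      rw [X.cj]
      congr 1
      apply Units.ext
      exact (hr _ _).symm
    · intro e e'
      obtain ⟨g, rfl⟩ := hmk e
      obtain ⟨g', rfl⟩ := hmk e'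
      rw [← map_mul, hψ1, hψ1, hψ1, hπ1]
      apply exd_inj (N := L)
      rw [map_add, hψ, hψ, ← exd_smul2 hu (π g) (r (π g)) (hr _), hψ]
      exact X.cr _ _
    · intro m
      change ψ1 (mk (i0 m)) = _
      rw [hψ1]
      apply exd_inj (N := L)
      rw [hψ, ← dv_inc, hi0, X.di]
  obtain ⟨S1, hS1, hS2⟩ := ih _ _ _ _ X1
  refine ⟨(S1.comap mk).map E0.subtype, ?_, ?_⟩
  · rw [eq_bot_iff]
    rintro _ ⟨⟨g, hg, rfl⟩, x, hx⟩
    obtain ⟨m, rfl⟩ := hiE g x hx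
    have h5 : mk (i0 m) ∈ S1 ⊓ (mk.comp i0).range := ⟨hg, m, rfl⟩
    rw [hS1, Subgroup.mem_bot] at h5
    rw [hinj m h5, map_one, map_one]
    exact Subgroup.one_mem _
  · rw [eq_top_iff]
    intro τ _
    have h5 : r τ ∈ S1.map π1 := hS2 ▸ Subgroup.mem_top _
    obtain ⟨e, he, he'⟩ := h5
    obtain ⟨g, rfl⟩ := hmk e
    rw [hπ1] at he'
    have h6 : r ((π g)⁻¹ * τ) = 1 := by rw [map_mul, map_inv, he', inv_mul_cancel]
    rcases hrk _ h6 with h | h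
    · exact ⟨g, ⟨g, he, rfl⟩, inv_mul_eq_one.1 h⟩
    · refine ⟨_, ⟨g * y0, ?_, rfl⟩, ?_⟩
      · change mk (g * y0) ∈ S1
        rw [hmky]; exact he
      · change π (g * y) = τ
        rw [map_mul, h1, ← h, mul_inv_cancel_left]
end
section
variable {K : Type} [Field K] [NumberField K]
theorem split_ext (h2 : SqF2 K) (n : ℕ) : ∀ (L : Type) [Field L] [NumberField L] [Algebra K L] [IsGalois K L] [IsTotallyReal L],
    Module.finrank K L = 2 ^ n → Unr K L → ∀ (E : Type) [Group E] (ι : Lˣ →* E) (π : E →* (L ≃ₐ[K] L)) (φ : E → Dv L),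
    Ex ι π φ → ∃ S : Subgroup E, S ⊓ ι.range = ⊥ ∧ S.map π = ⊤ := by
  induction n with
  | zero =>
    intro L _ _ _ _ _ hn _ E _ ι π φ _
    refine ⟨⊥, bot_inf_eq _, ?_⟩
    have h1 : Nat.card (L ≃ₐ[K] L) = 1 := by rw [IsGalois.card_aut_eq_finrank, hn, pow_zero]
    have := (Nat.card_eq_one_iff_unique.1 h1).1
    exact Subsingleton.elim _ _
  | succ n ih =>
    intro L _ _ _ _ _ hn hu E _ ι π φ X
    have h1 : Nat.card (L ≃ₐ[K] L) = 2 ^ (n + 1) := by rw [IsGalois.card_aut_eq_finrank, hn]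
    have hp : IsPGroup 2 (L ≃ₐ[K] L) := IsPGroup.of_card h1
    have : Fact (Nat.Prime 2) := ⟨Nat.prime_two⟩
    have : Nontrivial (L ≃ₐ[K] L) := Finite.one_lt_card_iff_nontrivial.1 (by rw [h1]; exact Nat.one_lt_two_pow (by omega))
    have := hp.center_nontrivial
    have h3 : 2 ∣ Nat.card (Subgroup.center (L ≃ₐ[K] L)) := by
      obtain ⟨m, hm, hm'⟩ := (hp.to_subgroup (Subgroup.center _)).nontrivial_iff_card.1 this
      rw [hm']
      exact dvd_pow_self 2 (by omega)
    obtain ⟨z, hz⟩ := exists_prime_orderOf_dvd_card' 2 h3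
    have hzz : (z : L ≃ₐ[K] L) * z = 1 := by
      have := pow_orderOf_eq_one z
      rw [hz, pow_two] at this
      exact congrArg Subtype.val this
    have hz1 : (z : L ≃ₐ[K] L) ≠ 1 := by
      intro h
      rw [Subtype.ext (a1 := z) (a2 := 1) h, orderOf_one] at hz
      omega
    have hc : ∀ g, (z : L ≃ₐ[K] L) * g = g * z := fun g => (Subgroup.mem_center_iff.1 z.2 g).symm
    obtain ⟨M, _, _, _, _, _, _, σ, q, hσ, hd⟩ := exists_mid (z : L ≃ₐ[K] L) hc hz1 hzz
    obtain ⟨hu1, hu2⟩ := unr_tower (M := M) hu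
    have : IsTotallyReal M := IsTotallyReal.of_algebra M L
    have h4 : SqF2 M := h2.up hu1
    obtain ⟨y, hy1, hy2⟩ := X.inv h4 hu2 q hσ
    obtain ⟨φ', X', hy3⟩ := X.triv q hσ hy1 hy2
    refine X'.down hu2 q hσ hc hy1 hy2 hy3 ?_
    refine ih M ?_ hu1
    rw [hn, pow_succ] at hd
    omega
end
end NF
end
section
set_option linter.unusedSectionVars false
namespace NF
open NumberField Amb IsDedekindDomain
open scoped Pointwise
section
variable {K L : Type} [Field K] [NumberField K] [Field L] [NumberField L] [Algebra K L]
variable {d : ℕ}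
noncomputable def sn (L : Type) [Field L] : ℤˣ →* Lˣ := Units.map (Int.castRingHom L).toMonoidHom
theorem sn_fix (g : L ≃ₐ[K] L) (u : ℤˣ) : g • sn L u = sn L u := Units.ext (map_intCast g _)
theorem sn_sq (u : ℤˣ) : sn L u * sn L u = 1 := by rw [← map_mul, Int.units_mul_self, map_one]
theorem sn_ne : sn L (-1) ≠ 1 := by
  intro h
  have h1 := congrArg Units.val h
  change (((-1 : ℤ) : L)) = 1 at h1
  norm_num at h1
theorem dv_sn (u : ℤˣ) : (dv (sn L u)).toAdd = 0 := by
  have h := congrArg (fun y => (dv y).toAdd) (sn_sq (L := L) u)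
  simp only [map_mul, map_one, toAdd_mul, toAdd_one] at h
  ext v
  have := DFunLike.congr_fun h v
  simp only [Finsupp.coe_add, Pi.add_apply, Finsupp.coe_zero, Pi.zero_apply] at this ⊢
  omega
theorem crossed [IsGalois K L] [IsTotallyReal L] (h2 : SqF2 K) {n : ℕ} (hn : Module.finrank K L = 2 ^ n) (hu : Unr K L)
    {p : FreeGroup (Fin d) →* (L ≃ₐ[K] L)} (hs : Function.Surjective p) (θ : p.ker →* ℤˣ)
    (hθ : ∀ f r, θ (MulAut.conjNormal f r) = θ r) :
    ∃ l : FreeGroup (Fin d) → Lˣ, (∀ f g, l (f * g) = l f * p f • l g) ∧ ∀ r : p.ker, l r = sn L (θ r) := by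
  let P : FreeGroup (Fin d) →* MulAut Lˣ := (MulDistribMulAction.toMulAut (L ≃ₐ[K] L) Lˣ).comp p
  have hP : ∀ f y, P f y = p f • y := fun f y => rfl
  let j : p.ker →* Lˣ ⋊[P] FreeGroup (Fin d) :=
    { toFun := fun r => ⟨sn L (θ r), r⟩
      map_one' := by rw [map_one, map_one]; rfl
      map_mul' := fun r s => by
        refine SemidirectProduct.ext ?_ rfl
        rw [SemidirectProduct.mul_left, hP, MonoidHom.mem_ker.1 r.2, one_smul, ← map_mul, ← map_mul] }
  have hj : ∀ r, j r = ⟨sn L (θ r), r⟩ := fun r => rfl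
  have hN : j.range.Normal := ⟨by
    rintro _ ⟨r, rfl⟩ ⟨y, f⟩
    refine ⟨MulAut.conjNormal f r, ?_⟩
    rw [eq_mul_inv_iff_mul_eq]
    have h1 : θ (MulAut.conjNormal f r) = θ r := hθ f r
    rw [hj, hj, h1]
    refine SemidirectProduct.ext ?_ ?_
    · rw [SemidirectProduct.mul_left, SemidirectProduct.mul_left, hP, hP, sn_fix, MonoidHom.mem_ker.1 (MulAut.conjNormal f r).2,
        one_smul, mul_comm]
    · simp only [SemidirectProduct.mul_right, MulAut.conjNormal_apply, inv_mul_cancel_right]⟩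
  let mk := QuotientGroup.mk' j.range
  have hmk : Function.Surjective mk := QuotientGroup.mk'_surjective _
  have hmj : ∀ r, mk (j r) = 1 := fun r => (QuotientGroup.eq_one_iff _).2 ⟨r, rfl⟩
  let π : (Lˣ ⋊[P] FreeGroup (Fin d)) ⧸ j.range →* (L ≃ₐ[K] L) :=
    QuotientGroup.lift j.range (p.comp SemidirectProduct.rightHom) (by
      rintro _ ⟨r, rfl⟩
      exact r.2)
  have hπ : ∀ e, π (mk e) = p e.right := fun e => rfl
  let φ : (Lˣ ⋊[P] FreeGroup (Fin d)) ⧸ j.range → Dv L := fun e => (dv e.out.left).toAdd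
  have hφ : ∀ e, φ (mk e) = (dv e.left).toAdd := by
    intro e
    have h5 : mk (Quotient.out (mk e)) = mk e := Quotient.out_eq _
    obtain ⟨r, hr⟩ : (Quotient.out (mk e))⁻¹ * e ∈ j.range := QuotientGroup.eq.1 h5
    rw [eq_inv_mul_iff_mul_eq] at hr
    rw [← congrArg SemidirectProduct.left hr, SemidirectProduct.mul_left, hj, hP, sn_fix, map_mul, toAdd_mul, dv_sn, add_zero]
  let ι : Lˣ →* (Lˣ ⋊[P] FreeGroup (Fin d)) ⧸ j.range := mk.comp SemidirectProduct.inl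
  have hι : ∀ y, ι y = mk (SemidirectProduct.inl y) := fun y => rfl
  have hιr : ∀ r : p.ker, ι (sn L (θ r)) * mk (SemidirectProduct.inr r) = 1 := by
    intro r
    rw [hι, ← map_mul, ← hmj r, hj, SemidirectProduct.mk_eq_inl_mul_inr]
  have X : Ex ι π φ := by
    refine ⟨?_, ?_, ?_, ?_, ?_, ?_⟩
    · rw [injective_iff_map_eq_one]
      intro y hy
      obtain ⟨r, hr⟩ := (QuotientGroup.eq_one_iff _).1 hy
      rw [hj] at hr
      have h1 : (r : FreeGroup (Fin d)) = 1 := congrArg SemidirectProduct.right hr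
      have h3 : sn L (θ r) = y := congrArg SemidirectProduct.left hr
      rw [← h3, show r = 1 from Subtype.ext h1, map_one, map_one]
    · intro g
      obtain ⟨f, rfl⟩ := hs g
      exact ⟨mk (SemidirectProduct.inr f), rfl⟩
    · ext e
      obtain ⟨⟨y, f⟩, rfl⟩ := hmk e
      rw [MonoidHom.mem_ker, hπ]
      constructor
      · rintro ⟨a, ha⟩
        have h1 := congrArg π ha
        rw [hπ] at h1
        rw [← h1, hι, hπ, SemidirectProduct.right_inl, map_one]
      · intro hf
        have h1 := hιr ⟨f, hf⟩
        refine ⟨y * (sn L (θ ⟨f, hf⟩))⁻¹, ?_⟩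
        rw [map_mul, map_inv, inv_eq_of_mul_eq_one_right h1, hι, ← map_mul, SemidirectProduct.mk_eq_inl_mul_inr]
    · intro e y
      obtain ⟨⟨a, f⟩, rfl⟩ := hmk e
      rw [hπ, mul_inv_eq_iff_eq_mul, hι, hι, ← map_mul, ← map_mul]
      congr 1
      refine SemidirectProduct.ext ?_ ?_
      · simp [hP, mul_comm]
      · simp
    · intro e e'
      obtain ⟨a, rfl⟩ := hmk e
      obtain ⟨b, rfl⟩ := hmk e'
      rw [← map_mul, hφ, hφ, hφ, hπ, ← dv_smul, SemidirectProduct.mul_left, map_mul, toAdd_mul, hP]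
    · intro y
      rw [hι, hφ, SemidirectProduct.left_inl]
  obtain ⟨S, hS1, hS2⟩ := split_ext h2 n L hn hu _ ι π φ X
  have hS0 : ∀ a, ι a ∈ S → a = 1 := by
    intro a ha
    have h1 : ι a ∈ S ⊓ ι.range := ⟨ha, a, rfl⟩
    rw [hS1, Subgroup.mem_bot] at h1
    exact X.inj (h1.trans (map_one _).symm)
  let q (f : FreeGroup (Fin d)) := mk (SemidirectProduct.inr f)
  have hq : ∀ f, π (q f) = p f := fun f => rfl
  have hl : ∀ f, ∃ a, ι a * q f ∈ S := by
    intro f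
    obtain ⟨s, hs, hs'⟩ : p f ∈ S.map π := hS2 ▸ Subgroup.mem_top _
    obtain ⟨a, ha⟩ := X.lift (g := s * (q f)⁻¹) (by rw [map_mul, map_inv, hs', hq, mul_inv_cancel])
    exact ⟨a, by rw [ha, inv_mul_cancel_right]; exact hs⟩
  choose l hl using hl
  have huniq : ∀ f a, ι a * q f ∈ S → a = l f := by
    intro f a ha
    have h1 := S.mul_mem ha (S.inv_mem (hl f))
    rw [mul_inv_rev, mul_assoc, mul_inv_cancel_left, ← map_inv, ← map_mul] at h1
    exact mul_inv_eq_one.1 (hS0 _ h1)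
  refine ⟨l, fun f g => (huniq _ _ ?_).symm, fun r => (huniq _ _ ?_).symm⟩
  · have h1 := S.mul_mem (hl f) (hl g)
    have h3 : q (f * g) = q f * q g := by
      change mk (SemidirectProduct.inr (f * g)) = mk _ * mk _
      rw [map_mul, map_mul]
    rw [mul_assoc, ← mul_assoc (q f), X.cj', hq, mul_assoc, ← h3, ← mul_assoc, ← map_mul] at h1
    exact h1
  · change ι _ * mk _ ∈ S
    rw [hιr]
    exact S.one_mem
theorem kummer [IsGalois K L] {p : FreeGroup (Fin d) →* (L ≃ₐ[K] L)} (hs : Function.Surjective p) (l : FreeGroup (Fin d) → Lˣ)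
    (h1 : ∀ f g, l (f * g) = l f * p f • l g)
    (h2 : ∀ r ∈ p.ker, l r * l r = 1) :
    ∃ γ : Lˣ, ∀ f, p f • γ = γ * l f ^ 2 := by
  choose s hs' using hs
  have h3 : ∀ f g, p f = p g → l f ^ 2 = l g ^ 2 := by
    intro f g h
    have h4 : g⁻¹ * f ∈ p.ker := by rw [MonoidHom.mem_ker, map_mul, map_inv, h, inv_mul_cancel]
    have h5 := h1 g (g⁻¹ * f)
    rw [mul_inv_cancel_left] at h5
    rw [h5, mul_pow, ← smul_pow', pow_two (l (g⁻¹ * f)), h2 _ h4, smul_one, mul_one]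
  obtain ⟨γ, hγ⟩ := groupCohomology.isMulCoboundary₁_of_isMulCocycle₁_of_aut_to_units (fun g => l (s g) ^ 2) (by
    intro g h
    change l (s (g * h)) ^ 2 = g • l (s h) ^ 2 * l (s g) ^ 2
    rw [h3 (s (g * h)) (s g * s h) (by rw [map_mul, hs', hs', hs']), h1, hs', mul_pow, mul_comm, smul_pow'])
  refine ⟨γ, fun f => ?_⟩
  have h4 : p f • γ / γ = l (s (p f)) ^ 2 := hγ (p f)
  rw [h3 f (s (p f)) (by rw [hs']), ← h4, mul_div_cancel]
end
end NF
end
section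
set_option linter.unusedSectionVars false
namespace NF
open NumberField Amb IsDedekindDomain
open scoped Pointwise
section
variable {K L : Type} [Field K] [NumberField K] [Field L] [NumberField L] [Algebra K L]
theorem exists_trace (hu : Unr K L) : ∃ t : 𝓞 L, Algebra.trace K L t = 1 := by
  have htr : ∀ y, algebraMap (𝓞 K) K (Algebra.intTrace (𝓞 K) (𝓞 L) y) = Algebra.trace K L (algebraMap (𝓞 L) L y) :=
    fun y => Algebra.algebraMap_intTrace (A := 𝓞 K) (K := K) (L := L) y
  let I : Ideal (𝓞 K) := LinearMap.range (Algebra.intTrace (𝓞 K) (𝓞 L))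
  by_cases hI : I = ⊤
  · obtain ⟨t, ht⟩ : (1 : 𝓞 K) ∈ I := hI ▸ Submodule.mem_top
    refine ⟨t, ?_⟩
    have h1 := htr t
    rw [ht, map_one] at h1
    exact h1.symm
  · exfalso
    obtain ⟨P, hP, hle⟩ := Ideal.exists_le_maximal _ hI
    have hP0 : P ≠ ⊥ := Ring.ne_bot_of_isMaximal_of_not_isField hP (RingOfIntegers.not_isField K)
    obtain ⟨x, hx, hx1⟩ := FractionalIdeal.exists_notMem_one_of_ne_bot (K := K) hP0 hP.ne_top
    apply hx1
    have hx2 : ∀ a ∈ P, x * algebraMap (𝓞 K) K a ∈ (1 : FractionalIdeal (nonZeroDivisors (𝓞 K)) K) := by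
      intro a ha
      exact (FractionalIdeal.mem_inv_iff (FractionalIdeal.coeIdeal_ne_zero.2 hP0)).1 hx _
        (FractionalIdeal.mem_coeIdeal_of_mem _ ha)
    have h1 : algebraMap K L x ∈ Submodule.traceDual (𝓞 K) K (1 : Submodule (𝓞 L) L) := by
      rw [Submodule.mem_traceDual]
      intro a ha
      obtain ⟨b, rfl⟩ := Submodule.mem_one.1 ha
      rw [Algebra.traceForm_apply, ← Algebra.smul_def, map_smul, smul_eq_mul, ← htr]
      obtain ⟨c, hc⟩ := (FractionalIdeal.mem_one_iff _).1 (hx2 _ (hle ⟨b, rfl⟩))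
      exact ⟨c, hc⟩
    have h3 := coeSubmodule_differentIdeal (A := 𝓞 K) (B := 𝓞 L) (K := K) (L := L)
    have h4 : (1 : L) ∈ IsLocalization.coeSubmodule L (differentIdeal (𝓞 K) (𝓞 L)) :=
      ⟨1, by rw [show differentIdeal (𝓞 K) (𝓞 L) = ⊤ from hu]; exact Submodule.mem_top, map_one (algebraMap (𝓞 L) L)⟩
    rw [h3, Submodule.mem_div_iff_forall_mul_mem] at h4
    have h5 := h4 _ h1
    rw [one_mul] at h5
    obtain ⟨b, hb⟩ := Submodule.mem_one.1 h5
    have h6 : IsIntegral ℤ x := by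
      have : IsIntegral ℤ (algebraMap K L x) := by rw [← hb]; exact RingOfIntegers.isIntegral_coe b
      exact (isIntegral_algebraMap_iff (algebraMap K L).injective).1 this
    exact (FractionalIdeal.mem_one_iff _).2 ⟨⟨x, h6⟩, rfl⟩
theorem fix_two [IsGalois K L] (hu : Unr K L) (u : 𝓞 L) (h : ∀ σ : L ≃ₐ[K] L, ∃ c : 𝓞 L, σ • u = u + 2 * c) :
    ∃ (k : 𝓞 K) (c : 𝓞 L), u = algebraMap (𝓞 K) (𝓞 L) k + 2 * c := by
  obtain ⟨t, ht⟩ := exists_trace hu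
  choose c hc using h
  refine ⟨Algebra.intTrace (𝓞 K) (𝓞 L) (t * u), - ∑ σ : L ≃ₐ[K] L, σ • t * c σ, ?_⟩
  have h1 : ∀ y : 𝓞 L, ((∑ σ : L ≃ₐ[K] L, σ • y : 𝓞 L) : L) = algebraMap K L (Algebra.trace K L y) := by
    intro y
    rw [trace_eq_sum_automorphisms]
    exact map_sum (algebraMap (𝓞 L) L) _ _
  have h2 : ∑ σ : L ≃ₐ[K] L, σ • t = 1 := by
    apply RingOfIntegers.ext
    rw [h1, ht, map_one]; rfl
  have h3 : algebraMap (𝓞 K) (𝓞 L) (Algebra.intTrace (𝓞 K) (𝓞 L) (t * u)) = ∑ σ : L ≃ₐ[K] L, σ • (t * u) := by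
    apply RingOfIntegers.ext
    rw [h1]
    have := Algebra.algebraMap_intTrace (A := 𝓞 K) (K := K) (L := L) (t * u)
    exact congrArg (algebraMap K L) this
  rw [h3, mul_neg, ← sub_eq_add_neg, Finset.mul_sum, ← Finset.sum_sub_distrib]
  calc u = (∑ σ : L ≃ₐ[K] L, σ • t) * u := by rw [h2, one_mul]
    _ = _ := by
      rw [Finset.sum_mul]
      refine Finset.sum_congr rfl fun σ _ => ?_
      rw [smul_mul', hc]; ring
theorem two_uniq (h2 : SqF2 L) (r : Lˣ) (u u' : 𝓞 L) (h : (r : L) ^ 2 * (1 + 2 * u) = 1 + 2 * u') :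
    ∃ c : 𝓞 L, u' = u + 2 * c := by
  have key : ∀ v : S L, v.valuation L (((u' : L) - u) / 2) ≤ 1 := by
    intro v
    have hint : ∀ a : 𝓞 L, v.valuation L (a : L) ≤ 1 := fun a => HeightOneSpectrum.valuation_le_one v a
    have hd : v.valuation L ((u' : L) - u) ≤ 1 := by
      have := hint (u' - u)
      rwa [show ((u' - u : 𝓞 L) : L) = u' - u from map_sub (algebraMap (𝓞 L) L) _ _] at this
    have ht := val_eq v (tw L)
    have ht' : ((tw L : Lˣ) : L) = 2 := rfl
    rw [ht'] at ht
    have h3 := h2 v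
    have h4 := ord_tw_nonneg v
    rw [map_div₀]
    obtain h5 | h5 : ord v (tw L) = 0 ∨ ord v (tw L) = 1 := by omega
    · rw [ht, h5, neg_zero, WithZero.exp_zero, div_one]; exact hd
    · rw [h5] at ht
      set q : WithZero (Multiplicative ℤ) := WithZero.exp (-1) with hq
      have hq1 : q < 1 := by rw [hq, ← WithZero.exp_zero, WithZero.exp_lt_exp]; norm_num
      have hq0 : 0 < q := WithZero.exp_pos
      rw [ht]
      have hunit : ∀ a : 𝓞 L, v.valuation L (1 + 2 * (a : L)) = 1 := by
        intro a
        apply Valuation.map_one_add_of_lt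
        rw [map_mul, ht]
        exact (mul_le_of_le_one_right' (hint a)).trans_lt hq1
      have hr : v.valuation L (r : L) = 1 := by
        have := congrArg (v.valuation L) h
        rw [map_mul, hunit, hunit, mul_one, map_pow] at this
        exact (pow_eq_one_iff.1 this).resolve_right (by norm_num)
      have he : v.valuation L ((r : L) - 1) * v.valuation L ((r : L) - 1 + 2) = q * v.valuation L ((u' : L) - u) := by
        rw [← ht, ← map_mul, ← map_mul, ← mul_one (v.valuation L (_ * _)), ← hunit u, ← map_mul]
        congr 1
        linear_combination h
      have he1 : v.valuation L ((r : L) - 1) ≤ 1 :=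
        (Valuation.map_sub _ _ _).trans (by rw [hr, map_one, max_self])
      have he2 : v.valuation L ((r : L) - 1) < 1 := by
        refine lt_of_le_of_ne he1 fun h6 => ?_
        rw [h6, one_mul, Valuation.map_add_eq_of_lt_left _ (by rw [ht, h6]; exact hq1), h6] at he
        exact absurd he (ne_of_gt ((mul_le_of_le_one_right' hd).trans_lt hq1))
      have he3 : v.valuation L ((r : L) - 1) ≤ q := by
        by_cases h0 : (r : L) - 1 = 0
        · rw [h0, map_zero]; exact zero_le
        · have h7 := val_eq v (Units.mk0 _ h0)
          have h8 := (ord_pos_iff v (Units.mk0 _ h0)).2 he2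
          rw [Units.val_mk0] at h7
          rw [h7, hq, WithZero.exp_le_exp]
          omega
      have he4 : v.valuation L ((r : L) - 1 + 2) ≤ q :=
        (Valuation.map_add _ _ _).trans (max_le he3 ht.le)
      have he5 : q * v.valuation L ((u' : L) - u) ≤ q * q := he ▸ mul_le_mul' he3 he4
      rw [div_le_one₀ hq0]
      exact le_of_mul_le_mul_left he5 hq0
  obtain ⟨c, hc⟩ := int_of _ key
  refine ⟨c, RingOfIntegers.ext ?_⟩
  have : ((u + 2 * c : 𝓞 L) : L) = u + 2 * c := by push_cast; rfl
  rw [this, hc]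
  field_simp
  ring
end
end NF
end
section
set_option linter.unusedSectionVars false
namespace NF
open NumberField Amb IsDedekindDomain
open scoped Pointwise
theorem cut {G : Type*} [CommGroup G] {A B T : Subgroup G} {a t : ℕ} (h : T.relIndex B ≤ t ∧ T.relIndex B ≠ 0)
    (h' : A.relIndex (T ⊓ B) ≤ a ∧ A.relIndex (T ⊓ B) ≠ 0) : A.relIndex B ≤ a * t ∧ A.relIndex B ≠ 0 := by
  have h1 := Subgroup.relIndex_inf_mul_relIndex (H := A) (K := T) (L := B)
  have h2 : (A ⊓ T).relIndex B ≠ 0 := h1 ▸ Nat.mul_ne_zero h'.2 h.2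
  have h3 := Subgroup.relIndex_le_of_le_left (L := B) (inf_le_left : A ⊓ T ≤ A) h2
  refine ⟨h3.trans (h1 ▸ Nat.mul_le_mul h'.1 h.1), fun h0 => h2 ?_⟩
  have := Subgroup.relIndex_dvd_of_le_left B (inf_le_left : A ⊓ T ≤ A)
  rw [h0] at this
  exact Nat.eq_zero_of_zero_dvd this
section
variable (K L : Type) [Field K] [NumberField K] [Field L] [NumberField L] [Algebra K L]
def Gm : Subgroup Lˣ where
  carrier := {y | ∀ σ : L ≃ₐ[K] L, σ • y / y ∈ sq L}
  one_mem' σ := by simp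
  mul_mem' {a b} ha hb σ := by rw [smul_mul', mul_div_mul_comm]; exact (sq L).mul_mem (ha σ) (hb σ)
  inv_mem' {a} ha σ := by rw [smul_inv', inv_div_inv, ← inv_div]; exact (sq L).inv_mem (ha σ)
noncomputable def KS : Subgroup Lˣ := (inc K L).range ⊔ sq L
def W (M : Type) [Field M] [NumberField M] : Subgroup Mˣ := VT ∅ ⊓ TP M ⊓ Loc (P4 M)
variable {K L}
theorem KS_le : KS K L ≤ Gm K L := by
  refine sup_le ?_ ?_
  · rintro _ ⟨k, rfl⟩ σ
    rw [show σ • inc K L k = inc K L k from Units.ext (σ.commutes _), div_self']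
    exact one_mem _
  · rintro _ ⟨y, rfl⟩ σ
    refine ⟨σ • y / y, ?_⟩
    rw [powMonoidHom_apply, powMonoidHom_apply, div_pow, smul_pow']
theorem Gm_par [IsGalois K L] (hu : Unr K L) (y : Lˣ) (hy : y ∈ Gm K L) :
    ∃ D : Dv K, ∀ w : S L, Even (ord w y - D (bel K w)) := by
  let D' : Dv L := (dv y).toAdd.mapRange (fun n => n % 2) (by simp)
  have hD' : ∀ w, D' w = ord w y % 2 := fun w => rfl
  obtain ⟨D, hD⟩ := mem_exd (M := K) D' (fun σ => by
    ext w
    rw [dsmul_apply, hD', hD', ← ord_smul']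
    obtain ⟨s, hs⟩ := (mem_sq _).1 (hy σ)
    have h1 : σ • y = s ^ 2 * y := by rw [hs, div_mul_cancel]
    rw [h1, ord_mul, ord_pow]
    push_cast
    omega) (fun w => by rw [ram_one hu]; simp)
  refine ⟨D, fun w => ?_⟩
  have h1 := hD' w
  rw [← hD, exd_apply, ram_one hu, Nat.cast_one, one_mul] at h1
  rw [h1, Int.even_iff]
  omega
theorem Gm1 [IsGalois K L] (hu : Unr K L) : (KS K L ⊔ (VT ∅ ⊓ Gm K L)).relIndex (Gm K L) ≤ (I2P K).index ∧
    (KS K L ⊔ (VT ∅ ⊓ Gm K L)).relIndex (Gm K L) ≠ 0 := by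
  classical
  have hI : (I2P K).index ≠ 0 := fun h =>
    dv_index (M := K) (Nat.eq_zero_of_zero_dvd (h ▸ Subgroup.index_dvd_of_le le_sup_left))
  have : Finite (Multiplicative (Dv K) ⧸ I2P K) := Nat.finite_of_card_ne_zero hI
  have hex : ∀ y : Lˣ, ∃ D : Dv K, y ∈ Gm K L → ∀ w : S L, Even (ord w y - D (bel K w)) := by
    intro y
    by_cases h : y ∈ Gm K L
    · obtain ⟨D, hD⟩ := Gm_par hu y h
      exact ⟨D, fun _ => hD⟩
    · exact ⟨0, fun h' => absurd h' h⟩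
  choose D hD using hex
  refine idx_le (T := Multiplicative (Dv K) ⧸ I2P K) _ _ (fun y => QuotientGroup.mk (Multiplicative.ofAdd (D y))) ?_
  intro y hy z hz h
  obtain ⟨_, ⟨k, rfl⟩, _, ⟨B, rfl⟩, hk⟩ := Subgroup.mem_sup.1 (QuotientGroup.eq.1 h.symm)
  have hk' : ∀ v, ord v k + 2 * B.toAdd v = D y v - D z v := by
    intro v
    have h1 := DFunLike.congr_fun (congrArg Multiplicative.toAdd hk) v
    rw [powMonoidHom_apply, toAdd_mul, toAdd_mul, toAdd_inv, toAdd_pow, two_nsmul, toAdd_ofAdd, toAdd_ofAdd] at h1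
    simp only [Finsupp.coe_add, Pi.add_apply, Finsupp.coe_neg, Pi.neg_apply, dv_apply] at h1
    omega
  have hK : inc K L k ∈ KS K L := Subgroup.mem_sup_left ⟨k, rfl⟩
  refine Subgroup.mem_sup.2 ⟨_, hK, y / z / inc K L k, ⟨?_, ?_⟩, by rw [mul_div_cancel]⟩
  · intro w _
    rw [div_eq_mul_inv, div_eq_mul_inv, ord_mul, ord_mul, ord_inv, ord_inv, ord_bel, ram_one hu, Nat.cast_one, one_mul]
    obtain ⟨a, ha⟩ := hD y hy w
    obtain ⟨b, hb⟩ := hD z hz w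
    have := hk' (bel K w)
    exact ⟨a - b + B.toAdd (bel K w), by linarith⟩
  · exact (Gm K L).div_mem ((Gm K L).div_mem hy hz) (KS_le hK)
theorem Gm2 [IsGalois K L] : (TP L).relIndex (VT ∅ ⊓ Gm K L) ≤ 2 ^ Module.finrank ℚ K ∧
    (TP L).relIndex (VT ∅ ⊓ Gm K L) ≠ 0 := by
  have hinj : Function.Injective fun φ : K →+* ℝ => Complex.ofRealHom.comp φ := by
    intro a b h; ext x
    exact Complex.ofReal_injective (RingHom.congr_fun h x)
  have : Finite (K →+* ℝ) := Finite.of_injective _ hinj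
  let c (y : Lˣ) (ψ : K →+* ℝ) : Prop := ∃ φ : L →+* ℝ, φ.comp (algebraMap K L) = ψ ∧ 0 < φ y
  have hc : ∀ y ∈ Gm K L, ∀ φ : L →+* ℝ, (0 < φ y ↔ c y (φ.comp (algebraMap K L))) := by
    intro y hy φ
    refine ⟨fun h => ⟨φ, rfl, h⟩, ?_⟩
    rintro ⟨φ', h1, h2⟩
    obtain ⟨σ, hσ⟩ := NumberField.ComplexEmbedding.exists_comp_symm_eq_of_comp_eq (k := K)
      (Complex.ofRealHom.comp φ') (Complex.ofRealHom.comp φ) (by rw [RingHom.comp_assoc, h1]; rfl)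
    have h3 : φ y = φ' (σ.symm y) := Complex.ofReal_injective (RingHom.congr_fun hσ y).symm
    obtain ⟨s, hs⟩ := (mem_sq _).1 (hy σ.symm)
    have h4 : σ.symm (y : L) = (s : L) ^ 2 * y := by
      have : σ.symm • y = s ^ 2 * y := by rw [hs, div_mul_cancel]
      exact congrArg Units.val this
    rw [h3, h4, map_mul, map_pow]
    have : φ' s ≠ 0 := by simp
    positivity
  obtain ⟨h1, h2⟩ := idx_le (T := (K →+* ℝ) → Prop) (TP L) (VT ∅ ⊓ Gm K L) c (by
    intro y hy' z hz' h φ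
    have h3 : 0 < φ y ↔ 0 < φ z := by rw [hc y hy'.2, hc z hz'.2, h]
    rw [Units.val_div_eq_div_val, map_div₀]
    have hy : φ y ≠ 0 := by simp
    have hz : φ z ≠ 0 := by simp
    rcases lt_or_gt_of_ne hy with h | h
    · refine div_pos_of_neg_of_neg h (lt_of_le_of_ne ?_ hz)
      rw [← not_lt, ← h3]; exact h.not_gt
    · exact div_pos h (h3.1 h))
  refine ⟨h1.trans ?_, h2⟩
  rw [Nat.card_fun, Nat.card_eq_fintype_card (α := Prop), Fintype.card_prop]
  refine Nat.pow_le_pow_right (by norm_num) ?_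
  refine (Nat.card_le_card_of_injective _ hinj).trans (le_of_eq ?_)
  rw [Nat.card_eq_fintype_card, NumberField.Embeddings.card]
theorem Gm3 [IsGalois K L] (h2 : SqF2 K) (hu : Unr K L) (H : Subgroup Lˣ) (hH : H ≤ VT ∅ ⊓ Gm K L) :
    (Loc (P4 L)).relIndex H ≤ 2 ^ Module.finrank ℚ K ∧ (Loc (P4 L)).relIndex H ≠ 0 := by
  classical
  have h2L : SqF2 L := h2.up hu
  have hex : ∀ y : Lˣ, ∃ (k : 𝓞 K), y ∈ H → ∃ (s : Lˣ) (c : 𝓞 L),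
      ((y * s ^ 2 : Lˣ) : L) = 1 + 2 * (algebraMap (𝓞 K) (𝓞 L) k + 2 * c : 𝓞 L) := by
    intro y
    by_cases h : y ∈ H
    · obtain ⟨s, u, hs⟩ := two_red h2L y (fun v _ => (hH h).1 v (Set.notMem_empty v))
      obtain ⟨k, c, hk⟩ := fix_two hu u (fun σ => by
        obtain ⟨t, ht⟩ := (mem_sq _).1 ((hH h).2 σ)
        have h1 : σ • y = t ^ 2 * y := by rw [ht, div_mul_cancel]
        refine two_uniq h2L (t * (σ • s) / s) u (σ • u) ?_
        have h3 : (1 : L) + 2 * ((σ • u : 𝓞 L) : L) = ((σ • (y * s ^ 2) : Lˣ) : L) := by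
          change _ = σ ((y * s ^ 2 : Lˣ) : L)
          rw [hs, map_add, map_mul, map_one, map_ofNat]; rfl
        rw [h3, ← hs, ← Units.val_pow_eq_pow_val, ← Units.val_mul]
        congr 1
        rw [smul_mul', h1, smul_pow', div_pow, mul_pow, mul_comm y (s ^ 2), ← mul_assoc, div_mul_cancel,
          mul_right_comm])
      exact ⟨k, fun _ => ⟨s, c, by rw [hs, hk]⟩⟩
    · exact ⟨0, fun h' => absurd h' h⟩
  choose u hu using hex
  have : Finite (𝓞 K ⧸ Ideal.span {(2 : 𝓞 K)}) :=
    Ideal.finiteQuotientOfFreeOfNeBot _ (by simp)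
  have := idx_le (T := 𝓞 K ⧸ Ideal.span {(2 : 𝓞 K)}) (Loc (P4 L)) H (fun y => Ideal.Quotient.mk _ (u y)) (by
    intro y hy z hz h
    apply div_mem_of_mul (sq_le_Loc _)
    obtain ⟨s, a, hs⟩ := hu y hy
    obtain ⟨t, b, ht⟩ := hu z hz
    rw [Ideal.Quotient.eq, Ideal.mem_span_singleton] at h
    obtain ⟨c, hc⟩ := h
    have hc1 : algebraMap (𝓞 K) (𝓞 L) (u y) + 2 * a =
        (algebraMap (𝓞 K) (𝓞 L) (u z) + 2 * b) + 2 * (algebraMap (𝓞 K) (𝓞 L) c + a - b) := by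
      have : u y = u z + 2 * c := by rw [← hc]; ring
      rw [this, map_add, map_mul, map_ofNat]; ring
    rw [hc1] at hs
    generalize algebraMap (𝓞 K) (𝓞 L) (u z) + 2 * b = p at hs ht
    generalize algebraMap (𝓞 K) (𝓞 L) c + a - b = r at hs
    refine ⟨s * t, p + r + p * p + (p * r + p * r), ?_⟩
    have e : ((y * z : Lˣ) : L) * ((s * t : Lˣ) : L) ^ 2 = ((y * s ^ 2 : Lˣ) : L) * ((z * t ^ 2 : Lˣ) : L) := by
      push_cast; ring
    rw [e, hs, ht, show ((p + 2 * r : 𝓞 L) : L) = p + 2 * r by push_cast; rfl]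
    push_cast; ring)
  rwa [card_two] at this
theorem Gm_idx [IsGalois K L] (h2 : SqF2 K) (hu : Unr K L) (hW : W L ≤ sq L) :
    (KS K L).relIndex (Gm K L) ≤ 2 ^ Module.finrank ℚ K * 2 ^ Module.finrank ℚ K * (I2P K).index ∧
    (KS K L).relIndex (Gm K L) ≠ 0 := by
  refine cut (Gm1 hu) ?_
  rw [inf_eq_left.2 (sup_le KS_le inf_le_right), Subgroup.relIndex_sup_left]
  refine cut Gm2 ?_
  have h3 := Gm3 h2 hu (TP L ⊓ (VT ∅ ⊓ Gm K L)) inf_le_right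
  have := cut (A := KS K L) (a := 1) h3 (by
    rw [Subgroup.relIndex_eq_one.2]
    · exact ⟨le_rfl, one_ne_zero⟩
    · rintro y ⟨h4, h5, h6, h7⟩
      exact Subgroup.mem_sup_right (hW ⟨⟨h6, h5⟩, h4⟩))
  rwa [one_mul] at this
end
end NF
end
section
set_option linter.unusedSectionVars false
namespace NF
open NumberField Amb IsDedekindDomain
open scoped Pointwise
theorem pw {A : Type*} [CommGroup A] (a : A) (ha : a ^ 2 = 1) (u v : ZMod 2) : a ^ (u + v).val = a ^ u.val * a ^ v.val := by
  have h : ∀ u v : ZMod 2, (u + v).val % 2 = (u.val + v.val) % 2 := by decide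
  rw [← pow_add]
  rw [pow_eq_pow_mod _ ha, h u v, ← pow_eq_pow_mod _ ha]
theorem hom_triv {A G : Type*} [CommGroup A] [Group G] {d : ℕ} (x : Fin d → G) (χ : Fin d → G → ZMod 2)
    (hχ : ∀ j g h, χ j (g * h) = χ j g + χ j h) (hχx : ∀ i j, χ j (x i) = if i = j then 1 else 0)
    (e : FreeGroup (Fin d) →* A) (he : ∀ f, e f ^ 2 = 1) (r : FreeGroup (Fin d)) (hr : FreeGroup.lift x r = 1) : e r = 1 := by
  have h0 : ∀ j, χ j 1 = 0 := fun j => by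
    have := hχ j 1 1
    rw [mul_one] at this
    exact left_eq_add.1 this
  let e' : FreeGroup (Fin d) →* A :=
    { toFun := fun f => ∏ i, e (FreeGroup.of i) ^ (χ i (FreeGroup.lift x f)).val
      map_one' := by simp [h0]
      map_mul' := fun f g => by
        rw [← Finset.prod_mul_distrib]
        refine Finset.prod_congr rfl fun i _ => ?_
        rw [map_mul, hχ, pw _ (he _)] }
  have h1 : e = e' := by
    refine FreeGroup.ext_hom _ _ fun j => ?_
    change _ = ∏ i, e (FreeGroup.of i) ^ (χ i (FreeGroup.lift x (FreeGroup.of j))).val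
    rw [FreeGroup.lift_apply_of, Finset.prod_eq_single j]
    · rw [hχx, if_pos rfl, ZMod.val_one, pow_one]
    · intro i _ hi
      rw [hχx, if_neg (Ne.symm hi), ZMod.val_zero, pow_zero]
    · simp
  rw [h1]
  change ∏ i, e (FreeGroup.of i) ^ (χ i (FreeGroup.lift x r)).val = 1
  simp [hr, h0]
section
variable {K L : Type} [Field K] [NumberField K] [Field L] [NumberField L] [Algebra K L]
theorem theta_card [IsGalois K L] [IsTotallyReal L] (h2 : SqF2 K) {n : ℕ} (hn : Module.finrank K L = 2 ^ n) (hu : Unr K L)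
    {d : ℕ} (x : Fin d → L ≃ₐ[K] L) (hs : Function.Surjective (FreeGroup.lift x)) (χ : Fin d → (L ≃ₐ[K] L) → ZMod 2)
    (hχ : ∀ j g h, χ j (g * h) = χ j g + χ j h) (hχx : ∀ i j, χ j (x i) = if i = j then 1 else 0)
    (hfin : (KS K L).relIndex (Gm K L) ≠ 0) :
    Finite (GS.Theta x) ∧ Nat.card (GS.Theta x) ≤ (KS K L).relIndex (Gm K L) := by
  have hex : ∀ θ : GS.Theta x, ∃ (l : FreeGroup (Fin d) → Lˣ) (γ : Lˣ),
      (∀ f g, l (f * g) = l f * FreeGroup.lift x f • l g) ∧ (∀ r : (FreeGroup.lift x).ker, l r = sn L (θ.1 r)) ∧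
      ∀ f, FreeGroup.lift x f • γ = γ * l f ^ 2 := by
    intro θ
    obtain ⟨l, h1, h3⟩ := crossed h2 hn hu hs θ.1 θ.2
    obtain ⟨γ, hγ⟩ := kummer hs l h1 (fun r hr => by
      have := h3 ⟨r, hr⟩
      rw [this, sn_sq])
    exact ⟨l, γ, h1, h3, hγ⟩
  choose l γ h1 h3 hγ using hex
  have hmem : ∀ θ, γ θ ∈ Gm K L := by
    intro θ σ
    obtain ⟨f, rfl⟩ := hs σ
    exact ⟨l θ f, by rw [powMonoidHom_apply, hγ, mul_div_cancel_left]⟩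
  let Q := Gm K L ⧸ (KS K L).subgroupOf (Gm K L)
  have : Finite Q := Nat.finite_of_card_ne_zero hfin
  let c : GS.Theta x → Q := fun θ => QuotientGroup.mk ⟨γ θ, hmem θ⟩
  have hc : Function.Injective c := by
    intro θ θ' h
    have h4 : (γ θ)⁻¹ * γ θ' ∈ KS K L := by
      have h40 : (QuotientGroup.mk ⟨γ θ, hmem θ⟩ : Q) = QuotientGroup.mk ⟨γ θ', hmem θ'⟩ := h
      have h41 := QuotientGroup.eq.1 h40
      exact h41
    obtain ⟨_, ⟨k, rfl⟩, _, ⟨s, rfl⟩, hk⟩ := Subgroup.mem_sup.1 h4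
    rw [powMonoidHom_apply] at hk
    have hk' : γ θ' = γ θ * (inc K L k * s ^ 2) := by rw [hk, mul_inv_cancel_left]
    have h8 : ∀ f, (l θ' f / l θ f * (s / FreeGroup.lift x f • s)) ^ 2 = 1 := by
      intro f
      have h5 := hγ θ' f
      have hfix : FreeGroup.lift x f • inc K L k = inc K L k := Units.ext ((FreeGroup.lift x f).commutes _)
      rw [hk', smul_mul', smul_mul', smul_pow', hγ, hfix] at h5
      have h6 : l θ' f ^ 2 * s ^ 2 = l θ f ^ 2 * (FreeGroup.lift x f • s) ^ 2 := by
        have : γ θ * inc K L k * (l θ' f ^ 2 * s ^ 2) = γ θ * inc K L k * (l θ f ^ 2 * (FreeGroup.lift x f • s) ^ 2) := by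
          calc _ = γ θ * (inc K L k * s ^ 2) * l θ' f ^ 2 := by
                simp only [mul_assoc, mul_comm, mul_left_comm]
            _ = _ := by rw [← h5]; simp only [mul_assoc, mul_comm, mul_left_comm]
        exact mul_left_cancel this
      rw [div_mul_div_comm, div_pow, mul_pow, mul_pow, h6, div_self']
    have h9 : ∀ σ : L ≃ₐ[K] L, ∀ t : Lˣ, t ^ 2 = 1 → σ • t = t := by
      intro σ t ht
      have : (t : L) ^ 2 = 1 := congrArg Units.val ht
      apply Units.ext
      change σ (t : L) = t
      rcases sq_eq_sq_iff_eq_or_eq_neg.1 (this.trans (one_pow 2).symm) with h | h <;> rw [h] <;> simp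
    let e : FreeGroup (Fin d) →* Lˣ :=
      { toFun := fun f => l θ' f / l θ f * (s / FreeGroup.lift x f • s)
        map_one' := by
          have h5 := h1 θ 1 1
          have h6 := h1 θ' 1 1
          rw [mul_one, map_one, one_smul] at h5 h6
          rw [left_eq_mul.1 h5, left_eq_mul.1 h6, map_one, one_smul, div_self', div_self', one_mul]
        map_mul' := fun f g => by
          rw [← h9 (FreeGroup.lift x f) _ (h8 g), h1, h1, map_mul, mul_smul, smul_mul', smul_div', smul_div']
          generalize FreeGroup.lift x f • FreeGroup.lift x g • s = A
          generalize FreeGroup.lift x f • s = B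
          generalize FreeGroup.lift x f • l θ g = C
          generalize FreeGroup.lift x f • l θ' g = D
          apply Units.ext
          push_cast
          field_simp }
    apply Subtype.ext
    apply MonoidHom.ext
    intro r
    have h5 : l θ' r / l θ r * (s / FreeGroup.lift x r • s) = 1 := hom_triv x χ hχ hχx e h8 r r.2
    rw [MonoidHom.mem_ker.1 r.2, one_smul, div_self', mul_one, div_eq_one, h3, h3] at h5
    rcases Int.units_eq_one_or (θ.1 r) with ha | ha <;> rcases Int.units_eq_one_or (θ'.1 r) with hb | hb <;> rw [ha, hb] at h5 ⊢
    · exact absurd (h5.trans (map_one _)) sn_ne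
    · exact absurd (h5.symm.trans (map_one _)) sn_ne
  exact ⟨Finite.of_injective c hc, Nat.card_le_card_of_injective c hc⟩
end
end NF
end
section
set_option linter.unusedSectionVars false
namespace NF
open NumberField Amb IsDedekindDomain
open scoped Pointwise
section
variable {K L : Type} [Field K] [NumberField K] [Field L] [NumberField L] [Algebra K L]
theorem W_smul (σ : L ≃ₐ[K] L) (y : Lˣ) (hy : y ∈ W L) : σ • y ∈ W L := by
  obtain ⟨⟨h1, h2⟩, s, c, h3⟩ := hy
  refine ⟨⟨fun v hv => ?_, fun φ => h2 (φ.comp (σ : L →+* L))⟩, σ • s, RingOfIntegers.mapRingHom (σ : L →+* L) c, ?_⟩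
  · rw [ord_smul']; exact h1 _ (by simp)
  · have := congrArg σ h3
    rw [map_mul, map_pow, map_add, map_mul, map_one, map_ofNat] at this
    exact this
theorem W_inc (hu : Unr K L) (y : Kˣ) (hy : y ∈ W K) : inc K L y ∈ W L := by
  obtain ⟨⟨h1, h2⟩, s, c, h3⟩ := hy
  refine ⟨⟨fun v hv => ?_, fun φ => h2 (φ.comp (algebraMap K L))⟩, inc K L s, algebraMap (𝓞 K) (𝓞 L) c, ?_⟩
  · rw [ord_bel, ram_one (M := K) hu v]
    simpa using h1 _ (by simp)
  · have := congrArg (algebraMap K L) h3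
    rw [map_mul, map_pow, map_add, map_mul, map_one, map_ofNat] at this
    exact this
theorem sq_smul (σ : L ≃ₐ[K] L) (y : Lˣ) (hy : y ∈ sq L) : σ • y ∈ sq L := by
  obtain ⟨t, rfl⟩ := (mem_sq _).1 hy
  exact (mem_sq _).2 ⟨σ • t, (smul_pow' _ _ _).symm⟩
theorem W_fin (L : Type) [Field L] [NumberField L] [IsTotallyReal L] : (sq L).relIndex (W L) ≠ 0 :=
  fun h => Vs_idx (M := L) (Subgroup.relIndex_eq_zero_of_le_right (inf_le_left.trans inf_le_left) h)
theorem W_fix [IsTotallyReal L] {n : ℕ} (hG : Nat.card (L ≃ₐ[K] L) = 2 ^ n) (hW : ¬ W L ≤ sq L) :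
    ∃ y ∈ W L, y ∉ sq L ∧ y ∈ Gm K L := by
  have : Fact (Nat.Prime 2) := ⟨Nat.prime_two⟩
  have : MulAction.QuotientAction (L ≃ₐ[K] L) (sq L) := ⟨fun σ a a' h => by
    rw [← smul_inv', ← smul_mul']
    exact sq_smul σ _ h⟩
  let f : Lˣ →* Lˣ ⧸ sq L := QuotientGroup.mk' (sq L)
  have hf : f.ker = sq L := QuotientGroup.ker_mk' _
  let T : SubMulAction (L ≃ₐ[K] L) (Lˣ ⧸ sq L) :=
    { carrier := (W L).map f
      smul_mem' := by
        rintro σ _ ⟨y, hy, rfl⟩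
        exact ⟨σ • y, W_smul σ y hy, rfl⟩ }
  have hc : Nat.card ((W L).map f) ≠ 0 := by
    rw [← Subgroup.relIndex_ker, hf]; exact W_fin L
  have : Finite ((W L).map f) := Nat.finite_of_card_ne_zero hc
  have : Finite T := this
  obtain ⟨w, hw, hw'⟩ := SetLike.not_le_iff_exists.1 hW
  have h2 : 2 ∣ Nat.card ((W L).map f) := by
    have h3 : orderOf (⟨f w, w, hw, rfl⟩ : (W L).map f) = 2 := by
      refine orderOf_eq_prime ?_ ?_
      · apply Subtype.ext
        change f w ^ 2 = 1
        rw [← map_pow, ← MonoidHom.mem_ker, hf]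
        exact (mem_sq _).2 ⟨w, rfl⟩
      · intro h
        have h := congrArg Subtype.val h
        have h : w ∈ f.ker := h
        exact hw' (hf ▸ h)
    rw [← h3]; exact orderOf_dvd_natCard _
  obtain ⟨⟨b, y, hy, rfl⟩, hb, hne⟩ := (IsPGroup.of_card hG).exists_fixed_point_of_prime_dvd_card_of_fixed_point T h2
    (a := ⟨1, 1, (W L).one_mem, map_one f⟩) (fun σ => Subtype.ext (by
      change f (σ • 1) = 1
      rw [smul_one, map_one]))
  refine ⟨y, hy, fun h => hne (Subtype.ext ?_), fun σ => ?_⟩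
  · have : y ∈ f.ker := hf.symm ▸ h
    exact this.symm
  · have h5 : f (σ • y) = f y := congrArg Subtype.val (hb σ)
    rw [← hf, MonoidHom.mem_ker, map_div, h5, div_self']
structure Cls (K L : Type) [Field K] [NumberField K] [Field L] [NumberField L] [Algebra K L] : Prop where
  gal : IsGalois K L
  deg : ∃ m, Module.finrank K L = 2 ^ m
  unr : Unr K L
  real : IsTotallyReal L
theorem norm_quad {N : Type} [Field N] [NumberField N] [Algebra K N] [Algebra L N] [IsScalarTower K L N] [IsGalois K L]
    {σ : N ≃ₐ[L] N} {α : Lˣ} {η : N} (e : Qe σ α η) (hα : α ∈ Gm K L) : IsGalois K N := by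
  let Ω := AlgebraicClosure N
  have : Algebra.IsAlgebraic K Ω := Algebra.IsAlgebraic.trans K N Ω
  have : IsAlgClosure K Ω := ⟨inferInstance, inferInstance⟩
  have : Normal K Ω := IsAlgClosure.normal K Ω
  let i : N →ₐ[K] Ω := IsScalarTower.toAlgHom K N Ω
  have hn : Normal K i.fieldRange := by
    rw [IntermediateField.normal_iff_forall_map_le]
    rintro τ _ ⟨_, ⟨y, rfl⟩, rfl⟩
    obtain ⟨a, b, rfl⟩ := e.decomp y
    have hL : ∀ a : L, τ (i (algebraMap L N a)) = i (algebraMap L N (τ.restrictNormal L a)) := by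
      intro a
      have := τ.restrictNormal_commutes L a
      exact this.symm
    let ρ : L ≃ₐ[K] L := AlgEquiv.ofBijective (τ.restrictNormal L) (Algebra.IsAlgebraic.algHom_bijective _)
    have hL' : ∀ a : L, τ (i (algebraMap L N a)) = i (algebraMap L N (ρ a)) := hL
    obtain ⟨t, ht⟩ := (mem_sq _).1 (hα ρ)
    have ht : (ρ α : L) = t ^ 2 * α := congrArg Units.val (eq_mul_of_div_eq ht.symm)
    have h1 : τ (i η) ^ 2 = i (algebraMap L N t * η) ^ 2 := by
      rw [← map_pow, ← map_pow, e.sq, hL', ht, ← map_pow, mul_pow, e.sq, ← map_pow, ← map_mul]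
    have h2 : τ (i η) ∈ i.fieldRange := by
      rcases sq_eq_sq_iff_eq_or_eq_neg.1 h1 with h | h <;> rw [h]
      · exact ⟨_, rfl⟩
      · exact neg_mem ⟨_, rfl⟩
    change τ (i (algebraMap L N a + algebraMap L N b * η)) ∈ i.fieldRange
    rw [map_add, map_add, map_mul, map_mul, hL', hL']
    exact add_mem ⟨_, rfl⟩ (mul_mem ⟨_, rfl⟩ h2)
  have : Normal K N := Normal.of_algEquiv (F := K) (E := i.fieldRange) (show i.fieldRange ≃ₐ[K] N from (AlgEquiv.ofInjectiveField i).symm)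
  exact ⟨⟩
theorem grow (h : Cls K L) (hW : ¬ W L ≤ sq L) : ∃ (N : Type) (_ : Field N) (_ : NumberField N) (_ : Algebra K N),
    Cls K N ∧ Module.finrank K N = 2 * Module.finrank K L := by
  obtain ⟨h1, ⟨m, hm⟩, h3, h4⟩ := h
  obtain ⟨y, hy, hy', hy2⟩ := W_fix (K := K) (n := m) (by rw [IsGalois.card_aut_eq_finrank, hm]) hW
  obtain ⟨N, _, _, _, σ, η, e⟩ := exists_quad y hy'
  let _ : Algebra K N := ((algebraMap L N).comp (algebraMap K L)).toAlgebra
  have : IsScalarTower K L N := IsScalarTower.of_algebraMap_eq fun _ => rfl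
  have hd : Module.finrank K N = 2 * Module.finrank K L := by
    rw [← Module.finrank_mul_finrank K L N, e.q.deg, mul_comm]
  refine ⟨N, _, _, _, ⟨norm_quad e hy2, ⟨m + 1, by rw [hd, hm, pow_succ']⟩, unr_comp h3 (e.unr hy.1.1 hy.2), e.real hy.1.2⟩, hd⟩
end
end NF
end
section
set_option linter.unusedSectionVars false
namespace NF
open NumberField Amb IsDedekindDomain
open scoped Pointwise
theorem idx2 {G : Type*} [Group G] [Finite G] {n : ℕ} (hG : Nat.card G = 2 ^ n) (H : Subgroup G) (hH : H ≠ ⊤) :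
    ∃ χ : Additive G →+ ZMod 2, χ ≠ 0 ∧ ∀ g ∈ H, χ (Additive.ofMul g) = 0 := by
  classical
  have : Fact (Nat.Prime 2) := ⟨Nat.prime_two⟩
  obtain ⟨m, hm, hHm⟩ := (Nat.dvd_prime_pow Nat.prime_two).1 (hG ▸ H.card_subgroup_dvd_card)
  have hlt : m < n := by
    refine lt_of_le_of_ne hm fun h => hH ?_
    apply Subgroup.eq_top_of_card_eq
    rw [hHm, hG, h]
  obtain ⟨M, hM, hle⟩ := Sylow.exists_subgroup_card_pow_prime_le (G := G) (p := 2) (n := m) (m := n - 1)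
    (hG ▸ pow_dvd_pow 2 (by omega)) H hHm (by omega)
  have hi : M.index = 2 := by
    have h1 := M.card_mul_index
    rw [hM, hG, show n = n - 1 + 1 by omega, pow_succ, Nat.add_sub_cancel] at h1
    exact mul_left_cancel₀ (by positivity) h1
  let χ : Additive G →+ ZMod 2 :=
    { toFun := fun g => if g.toMul ∈ M then 0 else 1
      map_zero' := if_pos M.one_mem
      map_add' := fun a b => by
        have := Subgroup.mul_mem_iff_of_index_two hi (a := a.toMul) (b := b.toMul)
        rw [toMul_add]
        by_cases h1 : a.toMul ∈ M <;> by_cases h2 : b.toMul ∈ M <;> simp [this, h1, h2] <;> rfl }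
  refine ⟨χ, fun h => ?_, fun g hg => if_pos (hle hg)⟩
  have : M = ⊤ := by
    rw [eq_top_iff]
    intro g _
    by_contra h1
    have h2 : χ (Additive.ofMul g) = 1 := if_neg h1
    rw [h] at h2
    exact zero_ne_one h2
  rw [this, Subgroup.index_top] at hi
  omega
theorem burnside {G : Type*} [Group G] [Finite G] {n : ℕ} (hG : Nat.card G = 2 ^ n) :
    ∃ (d : ℕ) (x : Fin d → G) (χ : Fin d → G → ZMod 2), (∀ j g h, χ j (g * h) = χ j g + χ j h) ∧
      (∀ i j, χ j (x i) = if i = j then 1 else 0) ∧ Function.Surjective (FreeGroup.lift x) ∧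
      Nat.card (Additive G →+ ZMod 2) = 2 ^ d := by
  let V := Additive G →+ ZMod 2
  have : Finite V := Finite.of_injective (fun f : V => (f : Additive G → ZMod 2)) DFunLike.coe_injective
  have : Fact (Nat.Prime 2) := ⟨Nat.prime_two⟩
  have : Module.Finite (ZMod 2) V := Module.Finite.of_finite
  let b := Module.finBasis (ZMod 2) V
  let ev : Additive G →+ Module.Dual (ZMod 2) V :=
    { toFun := fun g => { toFun := fun f => f g, map_add' := fun _ _ => rfl, map_smul' := fun _ _ => rfl }
      map_zero' := by ext f; exact map_zero f
      map_add' := fun g h => by ext f; exact map_add f g h }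
  let R : Submodule (ZMod 2) (Module.Dual (ZMod 2) V) := AddSubgroup.toZModSubmodule 2 ev.range
  have hco : R.dualCoannihilator = ⊥ := by
    rw [eq_bot_iff]
    intro f hf
    rw [Submodule.mem_dualCoannihilator] at hf
    exact AddMonoidHom.ext fun g => hf (ev g) ⟨g, rfl⟩
  have hR : R = ⊤ := by
    rw [← Subspace.dualCoannihilator_dualAnnihilator_eq (W := R), hco, Submodule.dualAnnihilator_bot]
  have hex : ∀ i, ∃ g : G, ∀ f : V, f (Additive.ofMul g) = b.coord i f := by
    intro i
    have : b.coord i ∈ R := hR ▸ Submodule.mem_top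
    obtain ⟨g, hg⟩ := this
    exact ⟨g.toMul, fun f => congrArg (fun t => t f) hg⟩
  choose x hx using hex
  refine ⟨_, x, fun j g => b j (Additive.ofMul g), fun j g h => map_add (b j) _ _, fun i j => ?_, ?_, ?_⟩
  · beta_reduce
    rw [hx, Module.Basis.coord_apply, Module.Basis.repr_self, Finsupp.single_apply]
    simp only [eq_comm]
  · rw [← MonoidHom.range_eq_top]
    by_contra h
    obtain ⟨χ, h0, h1⟩ := idx2 hG _ h
    apply h0
    apply b.repr.injective
    ext i
    have := h1 (x i) ⟨FreeGroup.of i, FreeGroup.lift_apply_of⟩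
    rw [hx] at this
    rw [map_zero]
    exact this
  · rw [Module.natCard_eq_pow_finrank (K := ZMod 2), Nat.card_zmod]
section
variable {K L : Type} [Field K] [NumberField K] [Field L] [NumberField L] [Algebra K L]
theorem kum [IsGalois K L] (hu : Unr K L) (hW : W L ≤ sq L) :
    (sq K).relIndex (W K) ≤ Nat.card (Additive (L ≃ₐ[K] L) →+ ZMod 2) := by
  classical
  have hex : ∀ w : W K, ∃ s : Lˣ, s ^ 2 = inc K L w := fun w => (mem_sq _).1 (hW (W_inc hu w.1 w.2))
  choose s hs using hex
  have hpm : ∀ w (σ : L ≃ₐ[K] L), σ • s w = s w ∨ σ • s w = - s w := by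
    intro w σ
    apply Units.eq_or_eq_neg_of_sq_eq_sq
    rw [← smul_pow', hs]
    exact Units.ext (σ.commutes _)
  have hne : ∀ w, - s w ≠ s w := fun w h => (s w).ne_zero (self_eq_neg.1 (congrArg Units.val h).symm)
  let f : W K → (Additive (L ≃ₐ[K] L) →+ ZMod 2) := fun w =>
    { toFun := fun σ => if σ.toMul • s w = s w then 0 else 1
      map_zero' := if_pos (one_smul _ _)
      map_add' := fun a b => by
        rw [toMul_add, mul_smul]
        have hm : a.toMul • (- s w) = - (a.toMul • s w) := Units.ext (map_neg a.toMul _)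
        rcases hpm w a.toMul with h1 | h1 <;> rcases hpm w b.toMul with h2 | h2 <;> simp [h1, h2, hm, hne] <;> decide }
  have hf : ∀ w w', f w = f w' → (w : Kˣ)⁻¹ * w' ∈ sq K := by
    intro w w' h
    have h1 : ∀ σ : L ≃ₐ[K] L, σ • (s w)⁻¹ * σ • s w' = (s w)⁻¹ * s w' := by
      intro σ
      have h2 : (if σ • s w = s w then 0 else 1 : ZMod 2) = if σ • s w' = s w' then 0 else 1 := DFunLike.congr_fun h (Additive.ofMul σ)
      rw [smul_inv']
      rcases hpm w σ with h3 | h3 <;> rcases hpm w' σ with h4 | h4 <;> simp [h3, h4, hne] at h2 ⊢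
    obtain ⟨k, hk⟩ := (IsGalois.mem_range_algebraMap_iff_fixed (F := K) (((s w)⁻¹ * s w' : Lˣ) : L)).2
      fun σ => by
        have := h1 σ
        rw [← smul_mul'] at this
        exact congrArg Units.val this
    have hk0 : k ≠ 0 := by rintro rfl; rw [map_zero] at hk; exact Units.ne_zero _ hk.symm
    refine (mem_sq _).2 ⟨Units.mk0 k hk0, Units.ext ((algebraMap K L).injective ?_)⟩
    rw [Units.val_pow_eq_pow_val, Units.val_mk0, map_pow, hk, ← Units.val_pow_eq_pow_val, mul_pow, inv_pow, hs, hs, ← map_inv, ← map_mul]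
    rfl
  have : Finite (Additive (L ≃ₐ[K] L) →+ ZMod 2) :=
    Finite.of_injective (fun f : Additive (L ≃ₐ[K] L) →+ ZMod 2 => (f : Additive (L ≃ₐ[K] L) → ZMod 2)) DFunLike.coe_injective
  refine Nat.card_le_card_of_injective (fun q : W K ⧸ (sq K).subgroupOf (W K) => f q.out) fun q q' h => ?_
  rw [← Quotient.out_eq' q, ← Quotient.out_eq' q']
  exact QuotientGroup.eq.2 (hf _ _ h)
end
end NF
end
section
set_option linter.unusedSectionVars false
namespace NF
open NumberField Amb IsDedekindDomain
open scoped Pointwise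
theorem no_max {K L : Type} [Field K] [NumberField K] [Field L] [NumberField L] [Algebra K L]
    [IsTotallyReal K] (h2 : SqF2 K) (hd : Module.finrank ℚ K = 2) (h8 : 2 ^ 8 ≤ (sq K).relIndex (W K)) (h : Cls K L) :
    ¬ W L ≤ sq L := by
  intro hW
  obtain ⟨_, ⟨m, hm⟩, hu, _⟩ := h
  have hG : Nat.card (L ≃ₐ[K] L) = 2 ^ m := by rw [IsGalois.card_aut_eq_finrank, hm]
  obtain ⟨d, x, χ, hχ, hχx, hs, hV⟩ := burnside hG
  have h1 := kum hu hW
  rw [hV] at h1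
  have h3 : 8 ≤ d := (Nat.pow_le_pow_iff_right (by norm_num)).1 (h8.trans h1)
  have h4 := Gm_idx h2 hu hW
  obtain ⟨h5, h6⟩ := theta_card h2 hm hu x hs χ hχ hχx h4.2
  have h7 : (sq K).relIndex (VT (∅ : Set (S K))) ≤ (sq K).relIndex (W K) * 2 ^ 2 * 2 ^ 2 := by
    have e1 := TP_idx (M := K) (VT ∅)
    have e2 := P4_idx h2 (TP K ⊓ VT ∅) (inf_le_right.trans fun y hy v _ => hy v (by simp))
    rw [hd] at e1 e2
    refine (cut e1 (cut e2 ⟨Subgroup.relIndex_le_of_le_right ?_ (W_fin K), ?_⟩)).1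
    · rintro y ⟨a, b, c⟩
      exact ⟨⟨c, b⟩, a⟩
    · rw [show Loc (P4 K) ⊓ (TP K ⊓ VT ∅) = W K by rw [inf_comm, inf_comm (TP K)]; rfl]
      exact W_fin K
  rw [card_V, hd] at h7
  rw [hd] at h4
  have h9 : Nat.card (GS.Theta x) ≤ 2 ^ (d + 6) := by
    refine h6.trans (h4.1.trans ?_)
    rw [pow_add]
    omega
  have h10 := GS.golod x hs (by omega) χ hχ hχx h5 (d + 6) h9
  nlinarith
theorem unr_self (K : Type) [Field K] [NumberField K] : Unr K K := by
  have h := natAbs_discr_eq_absNorm_differentIdeal_mul_natAbs_discr_pow K (𝓞 K) K (𝓞 K)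
  rw [Module.finrank_self, pow_one] at h
  exact Ideal.absNorm_eq_one_iff.1 (right_eq_mul₀ (Int.natAbs_ne_zero.2 (discr_ne_zero K)) |>.1 h)
theorem tower {K : Type} [Field K] [NumberField K]
    [IsTotallyReal K] (h2 : SqF2 K) (hd : Module.finrank ℚ K = 2) (h8 : 2 ^ 8 ≤ (sq K).relIndex (W K)) (n : ℕ) :
    ∃ (L : Type) (_ : Field L) (_ : NumberField L) (_ : Algebra K L), Cls K L ∧ Module.finrank K L = 2 ^ n := by
  induction n with
  | zero => exact ⟨K, _, _, Algebra.id K, ⟨inferInstance, ⟨0, Module.finrank_self K⟩, unr_self K, inferInstance⟩, Module.finrank_self K⟩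
  | succ n ih =>
    obtain ⟨L, _, _, _, h, h'⟩ := ih
    obtain ⟨N, i1, i2, i3, h3, h4⟩ := grow h (no_max h2 hd h8 h)
    exact ⟨N, i1, i2, i3, h3, by rw [h4, h', pow_succ']⟩
theorem disc_eq {K L : Type} [Field K] [NumberField K] [Field L] [NumberField L] [Algebra K L] (h : Unr K L) :
    (discr L).natAbs = (discr K).natAbs ^ Module.finrank K L := by
  rw [natAbs_discr_eq_absNorm_differentIdeal_mul_natAbs_discr_pow K (𝓞 K) L (𝓞 L), show differentIdeal (𝓞 K) (𝓞 L) = ⊤ from h,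
    Ideal.absNorm_top, one_mul]
theorem main0 {K : Type} [Field K] [NumberField K]
    [IsTotallyReal K] (h2 : SqF2 K) (hd : Module.finrank ℚ K = 2) (h8 : 2 ^ 8 ≤ (sq K).relIndex (W K)) :
    ∃ c₀ : ℝ, 0 < c₀ ∧
      ∀ n : ℕ, ∃ (k : Type) (_ : Field k) (_ : NumberField k),
        (∀ φ : k →+* ℂ, ∀ x : k, (φ x).im = 0) ∧
        n ≤ Module.finrank ℚ k ∧
        |(NumberField.discr k : ℝ)| ≤ c₀ ^ (Module.finrank ℚ k) := by
  have h1 : (1 : ℝ) ≤ ((discr K).natAbs : ℝ) := by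
    exact_mod_cast Int.natAbs_pos.2 (discr_ne_zero K)
  refine ⟨(discr K).natAbs, by linarith, fun n => ?_⟩
  obtain ⟨L, i1, i2, i3, h, h'⟩ := tower h2 hd h8 n
  have hf : Module.finrank ℚ L = 2 * 2 ^ n := by rw [← Module.finrank_mul_finrank ℚ K L, hd, h']
  refine ⟨L, i1, i2, fun φ x => ?_, ?_, ?_⟩
  · have := h.real
    exact Complex.conj_eq_iff_im.1 (RingHom.congr_fun (IsTotallyReal.complexEmbedding_isReal φ) x)
  · rw [hf]
    have := Nat.lt_two_pow_self (n := n)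
    omega
  · have e : |(discr L : ℝ)| = ((discr L).natAbs : ℝ) := by
      rw [Nat.cast_natAbs, Int.cast_abs]
    rw [e, disc_eq h.unr, Nat.cast_pow, h', hf]
    exact pow_le_pow_right₀ h1 (by omega)
end NF
end
section
set_option linter.unusedSectionVars false
namespace NF
open NumberField Amb IsDedekindDomain
open scoped Pointwise
def pr : Fin 9 → ℕ := ![5, 13, 17, 29, 37, 41, 53, 61, 101]
theorem pr_prime (i : Fin 9) : (pr i).Prime := by
  fin_cases i <;> norm_num [pr]
theorem pr_inj : Function.Injective pr := by decide
def mm (T : Finset (Fin 9)) : ℕ := ∏ i ∈ T, pr i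
theorem mm_ne (T) : mm T ≠ 0 := Finset.prod_ne_zero_iff.2 fun i _ => (pr_prime i).ne_zero
theorem mm_mod (T) : mm T % 4 = 1 := by
  induction T using Finset.induction_on with
  | empty => rfl
  | insert i T hi ih =>
    rw [mm, Finset.prod_insert hi, Nat.mul_mod]
    rw [mm] at ih
    rw [ih]
    exact (by decide : ∀ i, pr i % 4 * 1 % 4 = 1) i
theorem mm_compl (T) : mm T * mm Tᶜ = mm Finset.univ := Finset.prod_mul_prod_compl T pr
theorem mm_cop (T) : (mm T).Coprime (mm Tᶜ) := by
  rw [mm, mm, Nat.coprime_prod_left_iff]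
  intro i hi
  rw [Nat.coprime_prod_right_iff]
  intro j hj
  refine (Nat.coprime_primes (pr_prime i) (pr_prime j)).2 fun h => ?_
  rw [pr_inj h] at hi
  exact (Finset.mem_compl.1 hj) hi
theorem mm_fac (T) (j : Fin 9) : (mm T).factorization (pr j) = if j ∈ T then 1 else 0 := by
  rw [mm, Nat.factorization_prod fun i _ => (pr_prime i).ne_zero, Finset.sum_apply']
  rw [Finset.sum_congr rfl (g := fun i => if i = j then 1 else 0)]
  · simp
  · intro i _
    rw [(pr_prime i).factorization, Finsupp.single_apply]
    simp [pr_inj.eq_iff]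
theorem even_fac {n : ℕ} (h : IsSquare n) (q : ℕ) : Even (n.factorization q) := by
  obtain ⟨r, rfl⟩ := h
  rw [← pow_two, Nat.factorization_pow]
  exact ⟨r.factorization q, by simp [two_mul]⟩
def mq (T : Finset (Fin 9)) : ℚˣ := Units.mk0 (mm T : ℚ) (by exact_mod_cast mm_ne T)
theorem sqQ {n : ℕ} {v : ℚˣ} (hv : (v : ℚ) = n) (h : v ∈ sq ℚ) : IsSquare n := by
  rw [← Rat.isSquare_natCast_iff, ← hv]
  obtain ⟨y, rfl⟩ := (mem_sq _).1 h
  exact ⟨y, by rw [Units.val_pow_eq_pow_val, pow_two]⟩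
theorem d_nsq : mq Finset.univ ∉ sq ℚ := by
  intro h
  have := even_fac (sqQ (n := mm Finset.univ) rfl h) (pr 8)
  rw [mm_fac] at this
  simp at this
section
variable {K : Type} [Field K] [NumberField K] {σ : K ≃ₐ[ℚ] K} {η : K}
theorem exists_th (e : Qe σ (mq Finset.univ) η) : ∃ (θ : 𝓞 K) (k : ℕ), θ * (θ - 1) = 2 * k + 1 := by
  have hD : mm Finset.univ = 4 * (2 * (mm Finset.univ / 8) + 1) + 1 := by decide
  generalize mm Finset.univ / 8 = k at hD
  have h1 : η ^ 2 = 4 * (2 * k + 1) + 1 := by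
    rw [e.sq]
    have : ((mq Finset.univ : ℚˣ) : ℚ) = ((4 * (2 * k + 1) + 1 : ℕ) : ℚ) := by rw [← hD]; rfl
    rw [this, map_natCast]
    push_cast; ring
  have h2 : ((1 + η) / 2) * ((1 + η) / 2 - 1) = 2 * k + 1 := by
    field_simp
    linear_combination h1
  have hi : IsIntegral ℤ ((1 + η) / 2) := by
    refine ⟨Polynomial.X ^ 2 - (Polynomial.X + Polynomial.C (2 * k + 1 : ℤ)), ?_, ?_⟩
    · apply Polynomial.monic_X_pow_sub
      rw [Polynomial.degree_X_add_C]
      norm_num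
    · simp
      linear_combination h2
  refine ⟨⟨_, hi⟩, k, RingOfIntegers.ext ?_⟩
  push_cast
  exact h2
theorem sqf2 (e : Qe σ (mq Finset.univ) η) : SqF2 K := by
  intro v
  by_contra! h
  obtain ⟨θ, k, hk⟩ := exists_th e
  have h2 : (2 : 𝓞 K) ∈ v.asIdeal ^ 2 := by
    rw [← v.intValuation_le_pow_iff_mem, ← v.valuation_of_algebraMap (K := K)]
    have := val_eq v (tw K)
    rw [tw_val] at this
    change v.valuation K ((2 : 𝓞 K) : K) ≤ _
    rw [this, WithZero.exp_le_exp]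
    push_cast; omega
  have h3 := Ideal.absNorm_dvd_absNorm_of_le ((Ideal.span_singleton_le_iff_mem _).2 h2)
  have h4 : Ideal.absNorm (Ideal.span {(2 : 𝓞 K)}) = 2 ^ 2 := by
    rw [Ideal.absNorm_apply]
    have := card_two (M := K)
    rw [e.q.deg] at this
    exact this
  rw [h4, map_pow] at h3
  have h5 : Ideal.absNorm v.asIdeal ≠ 1 := fun h => v.isPrime.ne_top (Ideal.absNorm_eq_one_iff.1 h)
  have h6 : Ideal.absNorm v.asIdeal ∣ 2 := (Nat.pow_dvd_pow_iff two_ne_zero).1 h3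
  have h7 : Nat.card (𝓞 K ⧸ v.asIdeal) = 2 := ((Nat.dvd_prime Nat.prime_two).1 h6).resolve_left h5
  obtain ⟨y, _, hy⟩ := (Nat.card_eq_two_iff' (0 : 𝓞 K ⧸ v.asIdeal)).1 h7
  have : Nontrivial (𝓞 K ⧸ v.asIdeal) := Ideal.Quotient.nontrivial_iff.2 v.isPrime.ne_top
  have h1 := hy 1 one_ne_zero
  have h8 : θ * (θ - 1) ∈ v.asIdeal := by
    rw [← Ideal.Quotient.eq_zero_iff_mem, map_mul, map_sub, map_one]
    by_cases h0 : Ideal.Quotient.mk v.asIdeal θ = 0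
    · rw [h0, zero_mul]
    · rw [hy _ h0, h1, sub_self, mul_zero]
  rw [hk] at h8
  have h9 := v.asIdeal.sub_mem h8 (v.asIdeal.mul_mem_right (k : 𝓞 K) (Ideal.pow_le_self two_ne_zero h2))
  rw [add_sub_cancel_left] at h9
  exact v.isPrime.ne_top ((Ideal.eq_top_iff_one _).2 h9)
theorem mq_W (e : Qe σ (mq Finset.univ) η) (T) : inc ℚ K (mq T) ∈ W K := by
  have hc : ∀ n : ℕ, ((n : 𝓞 K) : K) = n := fun n => map_natCast (algebraMap (𝓞 K) K) n
  have hval : ∀ T, ((inc ℚ K (mq T) : Kˣ) : K) = ((mm T : 𝓞 K) : K) := fun T => by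
    change algebraMap ℚ K (mm T : ℚ) = _
    rw [map_natCast, hc]
  have hnn : ∀ T (v : S K), 0 ≤ ord v (inc ℚ K (mq T)) := fun T v => by
    rw [ord_nonneg_iff, hval]; exact v.valuation_le_one _
  refine ⟨⟨fun v _ => ?_, fun φ => ?_⟩, 1, ((mm T / 4 : ℕ) : 𝓞 K), ?_⟩
  · have h1 : inc ℚ K (mq T) * inc ℚ K (mq Tᶜ) = Units.mk0 η e.ne_zero ^ 2 := by
      rw [← map_mul]
      apply Units.ext
      rw [Units.val_pow_eq_pow_val, Units.val_mk0, e.sq]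
      change algebraMap ℚ K ((mm T : ℚ) * (mm Tᶜ : ℚ)) = algebraMap ℚ K (mm Finset.univ : ℚ)
      rw [← Nat.cast_mul, mm_compl]
    have h2 := congrArg (ord v) h1
    rw [ord_mul, ord_pow] at h2
    rcases (hnn T v).eq_or_lt with h | h
    · rw [← h]; exact Even.zero
    · rcases (hnn Tᶜ v).eq_or_lt with h' | h'
      · rw [← h', add_zero] at h2
        rw [h2]
        exact even_two.mul_right _
      · exfalso
        rw [ord_pos_iff, hval] at h h'
        have a1 := (v.valuation_lt_one_iff_mem _).1 h
        have a2 := (v.valuation_lt_one_iff_mem _).1 h'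
        have hb : IsCoprime (mm T : 𝓞 K) (mm Tᶜ : 𝓞 K) := by
          simpa using (Nat.isCoprime_iff_coprime.2 (mm_cop T)).map (Int.castRingHom (𝓞 K))
        obtain ⟨a, b, hab⟩ := hb
        refine v.isPrime.ne_top ((Ideal.eq_top_iff_one _).2 ?_)
        rw [← hab]
        exact v.asIdeal.add_mem (v.asIdeal.mul_mem_left _ a1) (v.asIdeal.mul_mem_left _ a2)
  · rw [hval, hc, map_natCast]
    exact_mod_cast Nat.pos_of_ne_zero (mm_ne T)
  · rw [Units.val_one, one_pow, mul_one, hval, hc, hc]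
    have h1 := mm_mod T
    have : mm T = 1 + 4 * (mm T / 4) := by omega
    exact_mod_cast congrArg (Nat.cast (R := K)) this
theorem W_big (e : Qe σ (mq Finset.univ) η) [IsTotallyReal K] : 2 ^ 8 ≤ (sq K).relIndex (W K) := by
  let Q := W K ⧸ (sq K).subgroupOf (W K)
  have : Finite Q := Nat.finite_of_card_ne_zero (W_fin K)
  let em : Finset (Fin 8) → Finset (Fin 9) := fun T => T.map Fin.castSuccEmb
  let f : Finset (Fin 8) → Q := fun T => QuotientGroup.mk ⟨inc ℚ K (mq (em T)), mq_W e _⟩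
  have hf : Function.Injective f := by
    intro T T' h
    have h40 : (QuotientGroup.mk ⟨inc ℚ K (mq (em T)), mq_W e _⟩ : Q) = QuotientGroup.mk ⟨inc ℚ K (mq (em T')), mq_W e _⟩ := h
    have h41 := QuotientGroup.eq.1 h40
    have h1 : (inc ℚ K (mq (em T)))⁻¹ * inc ℚ K (mq (em T')) ∈ sq K := h41
    have h2 : inc ℚ K (mq (em T) * mq (em T')) ∈ sq K := by
      have := mul_mem h1 ((mem_sq _).2 ⟨inc ℚ K (mq (em T)), rfl⟩)
      rw [map_mul]
      convert this using 1
      rw [pow_two, mul_assoc, mul_left_comm (inc ℚ K (mq (em T'))), inv_mul_cancel_left, mul_comm]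
    have hz : ∀ T, (8 : Fin 9) ∉ em T := fun T h => by
      obtain ⟨i, _, hi⟩ := Finset.mem_map.1 h
      exact absurd hi ((by decide : ∀ i : Fin 8, Fin.castSuccEmb i ≠ (8 : Fin 9)) i)
    rcases e.sq_up _ h2 with h3 | h3
    · have h4 := even_fac (sqQ (n := mm (em T) * mm (em T')) (by push_cast; rfl) h3)
      ext i
      have h5 := h4 (pr i.castSucc)
      rw [Nat.factorization_mul (mm_ne _) (mm_ne _), Finsupp.add_apply, mm_fac, mm_fac] at h5
      have h6 : ∀ T, i.castSucc ∈ em T ↔ i ∈ T := fun T => Finset.mem_map' Fin.castSuccEmb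
      simp only [h6] at h5
      by_cases a : i ∈ T <;> by_cases b : i ∈ T' <;> simp [a, b] at h5 ⊢
    · have h4 := even_fac (sqQ (n := mm (em T) * mm (em T') * mm Finset.univ) (by push_cast; rfl) h3) (pr 8)
      rw [Nat.factorization_mul (mul_ne_zero (mm_ne _) (mm_ne _)) (mm_ne _), Nat.factorization_mul (mm_ne _) (mm_ne _),
        Finsupp.add_apply, Finsupp.add_apply, mm_fac, mm_fac, mm_fac, if_neg (hz _), if_neg (hz _)] at h4
      simp at h4
  have := Nat.card_le_card_of_injective f hf
  rw [Nat.card_eq_fintype_card, Fintype.card_finset, Fintype.card_fin] at this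
  exact this
end
theorem main1 :
    ∃ c₀ : ℝ, 0 < c₀ ∧
      ∀ n : ℕ, ∃ (k : Type) (_ : Field k) (_ : NumberField k),
        (∀ φ : k →+* ℂ, ∀ x : k, (φ x).im = 0) ∧
        n ≤ Module.finrank ℚ k ∧
        |(NumberField.discr k : ℝ)| ≤ c₀ ^ (Module.finrank ℚ k) := by
  obtain ⟨K, i1, i2, i3, σ, η, e⟩ := exists_quad _ d_nsq
  obtain rfl : i3 = DivisionRing.toRatAlgebra := Subsingleton.elim _ _
  have : IsTotallyReal K := e.real fun φ => by
    change 0 < φ (mm Finset.univ : ℚ)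
    rw [map_natCast]
    exact_mod_cast Nat.pos_of_ne_zero (mm_ne _)
  exact main0 (sqf2 e) e.q.deg (W_big e)
end NF
end
open NumberField
/-- There is a constant `c₀ > 0` such that there exist totally real number fields of
arbitrarily large degree with `|Δ_k| ≤ c₀^{[k:ℚ]}`, i.e. root discriminant at most `c₀`. -/
theorem stmt_4 :
    ∃ c₀ : ℝ, 0 < c₀ ∧
      ∀ n : ℕ, ∃ (k : Type) (_ : Field k) (_ : NumberField k),
        (∀ φ : k →+* ℂ, ∀ x : k, (φ x).im = 0) ∧
        n ≤ Module.finrank ℚ k ∧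
        |(NumberField.discr k : ℝ)| ≤ c₀ ^ (Module.finrank ℚ k) := by
  exact NF.main1
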